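/- Let Γ ⊆ ℝ² be a compact convex set with nonempty interior, and for each m let C(Γ,m) denote the expected number of extreme points of the convex hull of m independent points each uniformly distributed on Γ. Then there exists a constant s > 0 such that, for X₁,…,X_{2n} independent uniform points on Γ, the probability of the event that there exists a set S of edges of {X₁,…,X_{2n}} with |S| ≤ 2n − s·C(Γ,2n) such that no non-crossing perfect matching of {X₁,…,X_{2n}} avoids S, tends to 1 as n → ∞. -/

import Mathlib

open MeasureTheory Set Filter

noncomputable section

abbrev Pt : Type := ℝ × ℝ

/-- A finite point set is in general position: no three distinct points are collinear. -/
def GenPos (X : Finset Pt) : Prop :=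
  ∀ a ∈ X, ∀ b ∈ X, ∀ c ∈ X, a ≠ b → a ≠ c → b ≠ c → ¬ Collinear ℝ ({a, b, c} : Set Pt)

/-- `e` is an edge of `X`: an unordered pair of distinct points of `X`. -/
def IsEdgeOf (X : Finset Pt) (e : Sym2 Pt) : Prop :=
  ¬ e.IsDiag ∧ ∀ p ∈ e, p ∈ X

/-- The closed segment joining the two points of an unordered pair. -/
def edgeSeg (e : Sym2 Pt) : Set Pt :=
  Sym2.lift ⟨fun u v => segment ℝ u v, fun u v => segment_symm ℝ u v⟩ e

/-- `M` is a non-crossing perfect matching of `X`: a partition of `X` into unordered pairs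
whose closed segments are pairwise disjoint. -/
def IsNCMatching (X : Finset Pt) (M : Finset (Sym2 Pt)) : Prop :=
  (∀ e ∈ M, IsEdgeOf X e) ∧
  (∀ p ∈ X, ∃! e, e ∈ M ∧ p ∈ e) ∧
  (M : Set (Sym2 Pt)).Pairwise fun e f => Disjoint (edgeSeg e) (edgeSeg f)

/-- The matching `M` avoids the edge set `S`. -/
def Avoids (M S : Finset (Sym2 Pt)) : Prop := ∀ e ∈ M, e ∉ S

/-- The uniform probability distribution on `Γ`: normalized Lebesgue measure restricted to `Γ`. -/
def unifOn (Γ : Set Pt) : Measure Pt := (volume Γ)⁻¹ • volume.restrict Γ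

/-- `C(Γ, m)`: the expected number of extreme points of the convex hull of `m` i.i.d. uniform
points in `Γ`. -/
def expHullPoints (Γ : Set Pt) (m : ℕ) : ℝ :=
  ∫ x : Fin m → Pt,
    ((Set.range x ∩ Set.extremePoints ℝ (convexHull ℝ (Set.range x))).ncard : ℝ)
    ∂(Measure.pi fun _ : Fin m => unifOn Γ)

open scoped ENNReal Topology

/-- Twice the signed area of the triangle `u v w`. -/
def cr (u v w : Pt) : ℝ := (v.1 - u.1) * (w.2 - u.2) - (v.2 - u.2) * (w.1 - u.1)

@[fun_prop]
theorem measurable_cr {X : Type*} [MeasurableSpace X] {f g h : X → Pt} (hf : Measurable f)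
    (hg : Measurable g) (hh : Measurable h) : Measurable fun x => cr (f x) (g x) (h x) := by
  unfold cr; fun_prop

theorem cr_swap_right (u v w : Pt) : cr u w v = -cr u v w := by unfold cr; ring

theorem cr_swap_left (u v w : Pt) : cr v u w = -cr u v w := by unfold cr; ring

theorem cr_self_left (u v : Pt) : cr u v u = 0 := by unfold cr; ring

theorem cr_self_right (u v : Pt) : cr u v v = 0 := by unfold cr; ring

theorem cr_combo (u v w z : Pt) (s : ℝ) :
    cr u v ((1 - s) • w + s • z) = (1 - s) * cr u v w + s * cr u v z := by
  simp [cr]; ring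

section Blocking

theorem exists_eq_lineMap_of_cr_eq_zero {p q z : Pt} (hpq : p ≠ q) (h : cr p q z = 0) :
    ∃ t : ℝ, z = (1 - t) • p + t • q := by
  have hn : 0 < (q.1 - p.1) ^ 2 + (q.2 - p.2) ^ 2 := by
    by_contra hcon
    have h1 : q.1 - p.1 = 0 := by nlinarith [sq_nonneg (q.1 - p.1), sq_nonneg (q.2 - p.2)]
    have h2 : q.2 - p.2 = 0 := by nlinarith [sq_nonneg (q.1 - p.1), sq_nonneg (q.2 - p.2)]
    exact hpq (Prod.ext (by linarith) (by linarith))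
  unfold cr at h
  refine ⟨((z.1 - p.1) * (q.1 - p.1) + (z.2 - p.2) * (q.2 - p.2)) /
    ((q.1 - p.1) ^ 2 + (q.2 - p.2) ^ 2), Prod.ext ?_ ?_⟩
  · simp
    field_simp
    linear_combination (p.2 - q.2) * h
  · simp
    field_simp
    linear_combination (q.1 - p.1) * h

/-- A segment with endpoints in the two closed half-planes `cr p a ≥ 0` and `cr q b ≥ 0` that
misses the segment `pq` does not leave the open half-plane to the left of `pq`. -/
theorem cr_pos_of_disjoint_segment {p q a b u v : Pt} (hpq : 0 < cr p a q) (hqp : 0 < cr q b p)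
    (hu : 0 ≤ cr p a u) (hv : 0 ≤ cr p a v) (hu' : 0 ≤ cr q b u) (hv' : 0 ≤ cr q b v)
    (hd : Disjoint (segment ℝ p q) (segment ℝ u v)) (h : 0 < cr p q u) : 0 < cr p q v := by
  by_contra hcon
  push Not at hcon
  have hne : p ≠ q := by
    rintro rfl; rw [cr_self_left] at hpq; exact lt_irrefl _ hpq
  set s := cr p q u / (cr p q u - cr p q v) with hs
  have hD : 0 < cr p q u - cr p q v := by linarith
  have hs0 : 0 ≤ s := by positivity
  have hs1 : s ≤ 1 := by rw [hs, div_le_one hD]; linarith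
  have hz : cr p q ((1 - s) • u + s • v) = 0 := by
    rw [cr_combo, hs]; field_simp; ring
  obtain ⟨t, ht⟩ := exists_eq_lineMap_of_cr_eq_zero hne hz
  have h1 : 0 ≤ cr p a ((1 - s) • u + s • v) := by
    rw [cr_combo]; have : 0 ≤ 1 - s := by linarith
    positivity
  have h2 : 0 ≤ cr q b ((1 - s) • u + s • v) := by
    rw [cr_combo]; have : 0 ≤ 1 - s := by linarith
    positivity
  rw [ht, cr_combo] at h1 h2
  rw [cr_self_left, mul_zero, zero_add] at h1
  rw [cr_self_left, mul_zero, add_zero] at h2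
  have ht0 : 0 ≤ t := nonneg_of_mul_nonneg_left h1 hpq
  have ht1 : 0 ≤ 1 - t := nonneg_of_mul_nonneg_left h2 hqp
  have hmem : (1 - t) • p + t • q ∈ segment ℝ p q := ⟨1 - t, t, ht1, ht0, by ring, rfl⟩
  rw [← ht] at hmem
  exact Set.disjoint_left.1 hd hmem ⟨1 - s, s, by linarith, hs0, by ring, rfl⟩

theorem IsNCMatching.even_card_left {X : Finset Pt} {M : Finset (Sym2 Pt)}
    (hM : IsNCMatching X M) {p q a b : Pt} (hpqM : s(p, q) ∈ M)
    (hpq : 0 < cr p a q) (hqp : 0 < cr q b p)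
    (ha : ∀ u ∈ X, 0 ≤ cr p a u) (hb : ∀ u ∈ X, 0 ≤ cr q b u) :
    Even (X.filter fun u => 0 < cr p q u).card := by
  classical
  obtain ⟨hE, hU, hD⟩ := hM
  choose! e he using fun u hu => (hU u hu).exists
  have heu : ∀ u ∈ X, ∀ f ∈ M, u ∈ f → f = e u := fun u hu f hf huf =>
    (hU u hu).unique ⟨hf, huf⟩ (he u hu)
  rw [← ZMod.natCast_eq_zero_iff_even]
  rw [Finset.cast_card]
  have hv : ∀ u (hu : u ∈ X), Sym2.Mem.other (he u hu).2 ∈ X := fun u hu =>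
    (hE _ (he u hu).1).2 _ (Sym2.other_mem _)
  refine Finset.sum_involution
    (fun u hu => Sym2.Mem.other (he u (Finset.mem_filter.1 hu).1).2) ?_ ?_ ?_ ?_
  · intro u hu; decide
  · intro u hu _ h
    exact Sym2.other_ne (hE _ (he u (Finset.mem_filter.1 hu).1).1).1 _ h
  · intro u hu
    obtain ⟨hu, hu'⟩ := Finset.mem_filter.1 hu
    refine Finset.mem_filter.2 ⟨hv u hu, ?_⟩
    have hne : s(p, q) ≠ e u := by
      intro h
      have := (he u hu).2
      rw [← h, Sym2.mem_iff] at this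
      rcases this with rfl | rfl
      · rw [cr_self_left] at hu'; exact lt_irrefl _ hu'
      · rw [cr_self_right] at hu'; exact lt_irrefl _ hu'
    have hdis := hD hpqM (he u hu).1 hne
    rw [← Sym2.other_spec (he u hu).2] at hdis
    exact cr_pos_of_disjoint_segment hpq hqp (ha _ hu) (ha _ (hv u hu)) (hb _ hu) (hb _ (hv u hu))
      hdis hu'
  · intro u hu
    have hu := (Finset.mem_filter.1 hu).1
    have h1 := heu _ (hv u hu) _ (he u hu).1 (Sym2.other_mem _)
    have h2 := Sym2.other_spec (he _ (hv u hu)).2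
    have h3 := (h2.trans h1.symm).trans (Sym2.other_spec (he u hu).2).symm
    exact Sym2.congr_right.1 (h3.trans Sym2.eq_swap)

/-- A family of hull edges `E` with a fixed member `e₀` produces a small blocking set. -/
theorem exists_blocking {N : ℕ} (x : Fin N → Pt) (hx : Function.Injective x)
    (E : Finset (Fin N × Fin N))
    (hE : ∀ e ∈ E, e.1 ≠ e.2 ∧ ∀ k, k ≠ e.1 → k ≠ e.2 → 0 < cr (x e.1) (x e.2) (x k))
    (e₀ : Fin N × Fin N) (he₀ : e₀ ∈ E) (Q : Finset (Fin N × Fin N)) (hQE : Q ⊆ E)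
    (hQ : ∀ e ∈ Q, e₀.1 ≠ e.1 ∧ e₀.1 ≠ e.2 ∧ e₀.2 ≠ e.1 ∧ e₀.2 ≠ e.2 ∧
      Odd (Finset.univ.filter fun k => 0 < cr (x e₀.1) (x e.1) (x k)).card) :
    ∃ S : Finset (Sym2 Pt), (∀ e ∈ S, IsEdgeOf (Finset.image x Finset.univ) e) ∧
      S.card + Q.card + 1 ≤ N ∧
      ∀ M : Finset (Sym2 Pt), IsNCMatching (Finset.image x Finset.univ) M → ¬ Avoids M S := by
  classical
  have hinj : Set.InjOn Prod.fst (Q : Set (Fin N × Fin N)) := by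
    rintro ⟨a, b⟩ he ⟨a', b'⟩ he' (rfl : a = a')
    by_contra hne
    have hbb : b ≠ b' := fun h => hne (by rw [h])
    have h1 := hE _ (hQE he)
    have h2 := hE _ (hQE he')
    have h3 := h1.2 b' h2.1.symm hbb.symm
    have h4 := h2.2 b h1.1.symm hbb
    simp only at h3 h4
    rw [cr_swap_right] at h4
    linarith
  set T := Q.image Prod.fst with hT
  have hTcard : T.card = Q.card := Finset.card_image_of_injOn hinj
  have hTe : e₀.1 ∉ T := by
    intro h
    obtain ⟨e, he, h⟩ := Finset.mem_image.1 h
    exact (hQ e he).1 h.symm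
  set R := (Finset.univ \ insert e₀.1 T) with hR
  have hRcard : R.card + Q.card + 1 = N := by
    have h1 := Finset.card_sdiff_add_card_eq_card (Finset.subset_univ (insert e₀.1 T))
    rw [Finset.card_insert_of_notMem hTe, hTcard, Finset.card_univ, Fintype.card_fin] at h1
    omega
  have hnn : ∀ e ∈ E, ∀ u ∈ Finset.image x Finset.univ, 0 ≤ cr (x e.1) (x e.2) u := by
    intro e he u hu
    obtain ⟨k, -, rfl⟩ := Finset.mem_image.1 hu
    by_cases h1 : k = e.1
    · rw [h1, cr_self_left]
    by_cases h2 : k = e.2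
    · rw [h2, cr_self_right]
    exact ((hE e he).2 k h1 h2).le
  refine ⟨R.image fun k => s(x e₀.1, x k), ?_, ?_, ?_⟩
  · intro e he
    obtain ⟨k, hk, rfl⟩ := Finset.mem_image.1 he
    have hk' : k ≠ e₀.1 := by rintro rfl; simp [hR] at hk
    refine ⟨?_, ?_⟩
    · rw [Sym2.mk_isDiag_iff]; exact fun h => hk' (hx h.symm)
    · intro p hp
      rcases Sym2.mem_iff.1 hp with rfl | rfl <;> simp
  · have := Finset.card_image_le (s := R) (f := fun k => s(x e₀.1, x k))
    omega
  · intro M hM hav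
    obtain ⟨f, ⟨hfM, hpf⟩, -⟩ := hM.2.1 (x e₀.1) (by simp)
    obtain ⟨v, rfl⟩ := Sym2.mem_iff_exists.1 hpf
    obtain ⟨k, -, rfl⟩ := Finset.mem_image.1 ((hM.1 _ hfM).2 v (Sym2.mem_mk_right _ _))
    have hk : k ≠ e₀.1 := by
      rintro rfl; exact (hM.1 _ hfM).1 (Sym2.mk_isDiag_iff.2 rfl)
    by_cases hkT : k ∈ T
    · obtain ⟨e, he, rfl⟩ := Finset.mem_image.1 hkT
      obtain ⟨h1, h2, h3, h4, h5⟩ := hQ e he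
      have := hM.even_card_left hfM (a := x e₀.2) (b := x e.2)
        ((hE _ he₀).2 _ h1.symm h3.symm) ((hE _ (hQE he)).2 _ h1 h2)
        (hnn _ he₀) (hnn _ (hQE he))
      rw [Finset.filter_image, Finset.card_image_of_injective _ hx] at this
      exact (Nat.not_even_iff_odd.2 h5) this
    · exact hav _ hfM (Finset.mem_image_of_mem _ (by simp [hR, hk, hkT]))

end Blocking

section Sampling

variable {X : Type*} [MeasurableSpace X]

theorem measurePreserving_split (μ : Measure X) [IsProbabilityMeasure μ] {N k : ℕ}
    (i : Fin k → Fin N) (hi : Function.Injective i) :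
    MeasurePreserving
      (fun x : Fin N → X => ((fun l => x (i l), fun j => x j) :
        (Fin k → X) × ({j // j ∉ Set.range i} → X)))
      (Measure.pi fun _ => μ) ((Measure.pi fun _ => μ).prod (Measure.pi fun _ => μ)) := by
  classical
  have h1 := measurePreserving_piEquivPiSubtypeProd (fun _ : Fin N => μ) (fun j => j ∈ Set.range i)
  have h2 := measurePreserving_piCongrLeft (fun _ : Fin k => μ) (Equiv.ofInjective i hi).symm
  rw [Subsingleton.elim (Subtype.fintype fun j => j ∈ Set.range i) (Set.fintypeRange i)] at h1
  have h3 := (h2.prod (MeasurePreserving.id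
    (Measure.pi fun _ : {j // j ∉ Set.range i} => μ))).comp h1
  convert h3 using 1
  funext x
  refine Prod.ext ?_ rfl
  funext l
  have := MeasurableEquiv.piCongrLeft_apply_apply (β := fun _ : Fin k => X)
    (Equiv.ofInjective i hi).symm (fun j => x j) (Equiv.ofInjective i hi l)
  simp at this
  simp [MeasurableEquiv.piEquivPiSubtypeProd, Equiv.piEquivPiSubtypeProd, this]

theorem card_compl_range {N k : ℕ} (i : Fin k → Fin N) (hi : Function.Injective i)
    [Fintype {j // j ∉ Set.range i}] :
    Fintype.card {j // j ∉ Set.range i} = N - k := by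
  classical
  rw [Fintype.card_subtype_compl, Fintype.card_congr (Equiv.ofInjective i hi).symm]
  simp

/-- The probability that the sample points indexed by `i` form a tuple in `A` and that all the
other sample points are in relation `B` with this tuple. -/
theorem measure_sample_eq (μ : Measure X) [IsProbabilityMeasure μ] {N k : ℕ}
    (i : Fin k → Fin N) (hi : Function.Injective i) {A : Set (Fin k → X)} (hA : MeasurableSet A)
    {B : Set ((Fin k → X) × X)} (hB : MeasurableSet B) :
    (Measure.pi fun _ : Fin N => μ)
      {x | (fun l => x (i l)) ∈ A ∧ ∀ j, j ∉ Set.range i → ((fun l => x (i l)), x j) ∈ B}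
      = ∫⁻ z in A, (μ {w | (z, w) ∈ B}) ^ (N - k) ∂(Measure.pi fun _ => μ) := by
  classical
  have hS : MeasurableSet {p : (Fin k → X) × ({j // j ∉ Set.range i} → X) |
      p.1 ∈ A ∧ ∀ j, (p.1, p.2 j) ∈ B} := by
    have : {p : (Fin k → X) × ({j // j ∉ Set.range i} → X) |
      p.1 ∈ A ∧ ∀ j, (p.1, p.2 j) ∈ B} = Prod.fst ⁻¹' A ∩ ⋂ j,
        (fun p : (Fin k → X) × ({j // j ∉ Set.range i} → X) => (p.1, p.2 j)) ⁻¹' B := by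
      ext p; simp
    rw [this]
    exact (measurable_fst hA).inter (MeasurableSet.iInter fun j =>
      (by fun_prop : Measurable fun p : (Fin k → X) × ({j // j ∉ Set.range i} → X) =>
        (p.1, p.2 j)) hB)
  have h := (measurePreserving_split μ i hi).measure_preimage hS.nullMeasurableSet
  have h' : (fun x : Fin N → X => ((fun l => x (i l), fun j => x j) :
        (Fin k → X) × ({j // j ∉ Set.range i} → X))) ⁻¹' {p : (Fin k → X) × ({j // j ∉ Set.range i} → X) |
      p.1 ∈ A ∧ ∀ j, (p.1, p.2 j) ∈ B} =
      {x | (fun l => x (i l)) ∈ A ∧ ∀ j, j ∉ Set.range i → ((fun l => x (i l)), x j) ∈ B} := by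
    ext x; simp
  rw [h'] at h
  rw [h, Measure.prod_apply hS, ← lintegral_indicator hA]
  refine lintegral_congr fun z => ?_
  by_cases hz : z ∈ A
  · have : Prod.mk z ⁻¹' {p : (Fin k → X) × ({j // j ∉ Set.range i} → X) |
      p.1 ∈ A ∧ ∀ j, (p.1, p.2 j) ∈ B} = Set.pi univ fun _ => {w | (z, w) ∈ B} := by
      ext y; simp [hz]
    rw [this, Measure.pi_pi, indicator_of_mem hz, Finset.prod_const, Finset.card_univ,
      card_compl_range i hi]
  · have : Prod.mk z ⁻¹' {p : (Fin k → X) × ({j // j ∉ Set.range i} → X) |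
      p.1 ∈ A ∧ ∀ j, (p.1, p.2 j) ∈ B} = ∅ := by
      ext y; simp [hz]
    rw [this, indicator_of_notMem hz, measure_empty]

/-- Bound on the expectation of a product kernel over the sample points not indexed by `i`. -/
theorem enorm_integral_sample_le (μ : Measure X) [IsProbabilityMeasure μ] {N k : ℕ}
    (i : Fin k → Fin N) (hi : Function.Injective i) {F : (Fin k → X) → ℝ} (hF : Measurable F)
    {g : (Fin k → X) × X → ℝ} (hg : Measurable g) :
    ‖∫ x, F (fun l => x (i l)) * ∏ j : {j // j ∉ Set.range i}, g (fun l => x (i l), x j)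
      ∂(Measure.pi fun _ : Fin N => μ)‖ₑ
      ≤ ∫⁻ z, ‖F z‖ₑ * ‖∫ w, g (z, w) ∂μ‖ₑ ^ (N - k) ∂(Measure.pi fun _ => μ) := by
  classical
  have hm : Measurable (fun p : (Fin k → X) × ({j // j ∉ Set.range i} → X) =>
      F p.1 * ∏ j, g (p.1, p.2 j)) := by fun_prop
  have h := (measurePreserving_split μ i hi).map_eq
  have h2 := integral_map (μ := Measure.pi fun _ : Fin N => μ)
    (measurePreserving_split μ i hi).measurable.aemeasurable
    (f := fun p : (Fin k → X) × ({j // j ∉ Set.range i} → X) =>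
      F p.1 * ∏ j, g (p.1, p.2 j)) hm.aestronglyMeasurable
  rw [← h2, h]
  by_cases hint : Integrable (fun p : (Fin k → X) × ({j // j ∉ Set.range i} → X) =>
      F p.1 * ∏ j, g (p.1, p.2 j)) ((Measure.pi fun _ => μ).prod (Measure.pi fun _ => μ))
  · rw [integral_prod _ hint]
    refine (enorm_integral_le_lintegral_enorm _).trans (lintegral_mono fun z => ?_)
    simp only
    rw [integral_const_mul, integral_fintype_prod_eq_pow (fun w => g (z, w)), enorm_mul,
      enorm_pow, card_compl_range i hi]
  · rw [integral_undef hint]; simp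

end Sampling

section Wedge

/-- If all sections of `R` over `B` are small and any two points of `B` are related by `R` in
one of the two directions, then `B` is small. -/
theorem measure_le_of_semiconnex {X : Type*} [MeasurableSpace X] (μ : Measure X)
    [IsProbabilityMeasure μ] {R : Set (X × X)} (hR : MeasurableSet R) {B : Set X}
    (hB : MeasurableSet B) {τ : ℝ≥0∞} (hτ : ∀ x ∈ B, μ {z | (x, z) ∈ R} ≤ τ)
    (h : ∀ x ∈ B, ∀ᵐ z ∂μ, z ∈ B → (x, z) ∈ R ∨ (z, x) ∈ R) : μ B ≤ 2 * τ := by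
  set T : Set (X × X) := Prod.fst ⁻¹' B ∩ R with hT
  have hTm : MeasurableSet T := (measurable_fst hB).inter hR
  have hTle : (μ.prod μ) T ≤ τ * μ B := by
    rw [Measure.prod_apply hTm, ← lintegral_indicator_const hB]
    refine lintegral_mono fun x => ?_
    by_cases hx : x ∈ B
    · rw [indicator_of_mem hx]
      refine (measure_mono ?_).trans (hτ x hx)
      intro z hz; exact hz.2
    · rw [indicator_of_notMem hx]
      have : Prod.mk x ⁻¹' T = ∅ := by ext z; simp [hT, hx]
      rw [this, measure_empty]
  have hswap : (μ.prod μ) (Prod.swap ⁻¹' T) = (μ.prod μ) T :=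
    (Measure.measurePreserving_swap (μ := μ) (ν := μ)).measure_preimage hTm.nullMeasurableSet
  have hcover : (μ.prod μ) (B ×ˢ B) ≤ (μ.prod μ) (T ∪ Prod.swap ⁻¹' T) := by
    rw [Measure.prod_apply (hB.prod hB), Measure.prod_apply (hTm.union (measurable_swap hTm))]
    refine lintegral_mono fun x => ?_
    by_cases hx : x ∈ B
    · refine measure_mono_ae ?_
      filter_upwards [h x hx] with z hz hzB
      rcases hz hzB.2 with h1 | h1
      · exact Or.inl ⟨hx, h1⟩
      · exact Or.inr ⟨hzB.2, h1⟩
    · have : Prod.mk x ⁻¹' (B ×ˢ B) = ∅ := by ext z; simp [hx]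
      rw [this, measure_empty]; exact zero_le
  rw [Measure.prod_prod] at hcover
  have h2 : μ B * μ B ≤ 2 * τ * μ B := by
    refine hcover.trans ((measure_union_le _ _).trans ?_)
    rw [hswap, mul_assoc, two_mul]
    gcongr
  by_cases h0 : μ B = 0
  · rw [h0]; exact zero_le
  · exact (ENNReal.mul_le_mul_iff_left h0 (measure_ne_top _ _)).1 h2

/-- The points lying on the left of exactly one of the lines `px` and `px'`. -/
def wedge (p x x' : Pt) : Set Pt := {z | ¬ (0 < cr p x z ↔ 0 < cr p x' z)}

theorem measurableSet_left {X : Type*} [MeasurableSpace X] {f g h : X → Pt} (hf : Measurable f)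
    (hg : Measurable g) (hh : Measurable h) : MeasurableSet {z | 0 < cr (f z) (g z) (h z)} :=
  measurableSet_lt measurable_const (by fun_prop)

theorem measurableSet_wedge_rel (p x : Pt) :
    MeasurableSet {q : Pt × Pt | q.2 ∈ wedge p x q.1} := by
  have h1 : MeasurableSet {q : Pt × Pt | 0 < cr p x q.2} :=
    measurableSet_left measurable_const measurable_const measurable_snd
  have h2 : MeasurableSet {q : Pt × Pt | 0 < cr p q.1 q.2} :=
    measurableSet_left measurable_const measurable_fst measurable_snd
  have : {q : Pt × Pt | q.2 ∈ wedge p x q.1} =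
      ({q : Pt × Pt | 0 < cr p x q.2} \ {q : Pt × Pt | 0 < cr p q.1 q.2}) ∪
      ({q : Pt × Pt | 0 < cr p q.1 q.2} \ {q : Pt × Pt | 0 < cr p x q.2}) := by
    ext q; simp only [wedge, mem_ofPred_eq, mem_union, Set.mem_sdiff]; tauto
  rw [this]
  exact (h1.diff h2).union (h2.diff h1)

theorem measurableSet_wedge (p x x' : Pt) : MeasurableSet (wedge p x x') :=
  measurable_prodMk_left (x := x') (measurableSet_wedge_rel p x)

variable {μ : Measure Pt} [IsProbabilityMeasure μ]
  (hline : ∀ p q : Pt, p ≠ q → μ {w | cr p q w = 0} = 0)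

include hline in
theorem measure_small_wedge_le {p x : Pt} (hpx : p ≠ x) (τ : ℝ≥0∞) :
    μ {x' | μ (wedge p x x') ≤ τ ∨ μ (wedge p x x')ᶜ ≤ τ} ≤ 8 * τ := by
  set R : Set (Pt × Pt) := {q : Pt × Pt | q.2 ∈ wedge p x q.1} with hRdef
  have hR : MeasurableSet R := measurableSet_wedge_rel p x
  have hpos : MeasurableSet {z | 0 < cr p x z} :=
    measurableSet_left measurable_const measurable_const measurable_id
  have hneg : MeasurableSet {z | cr p x z < 0} :=
    measurableSet_lt (by fun_prop) measurable_const
  have hB1 : MeasurableSet {x' | μ (wedge p x x') ≤ τ} :=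
    measurableSet_le (measurable_measure_prodMk_left hR) measurable_const
  have hB2 : MeasurableSet {x' | μ (wedge p x x')ᶜ ≤ τ} :=
    measurableSet_le (measurable_measure_prodMk_left hR.compl) measurable_const
  have hcr : ∀ x', cr p x x' ≠ 0 → ∀ᵐ z ∂μ, cr p x' z ≠ 0 := by
    intro x' hx'
    have hne : p ≠ x' := by rintro rfl; exact hx' (cr_self_left _ _)
    exact measure_eq_zero_iff_ae_notMem.1 (hline p x' hne)
  have key1 : μ ({x' | μ (wedge p x x') ≤ τ} ∩ {z | 0 < cr p x z}) ≤ 2 * τ := by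
    refine measure_le_of_semiconnex μ hR (hB1.inter hpos) (fun x' hx' => hx'.1) ?_
    rintro x' ⟨-, hx'⟩
    refine Eventually.of_forall ?_
    rintro z ⟨-, hz⟩
    simp only [hRdef, wedge, mem_ofPred_eq] at *
    rw [cr_swap_right p x' z]
    by_contra! hcon
    have h1 := hcon.1.1 hz
    have h2 := hcon.2.1 hx'
    linarith
  have key2 : μ ({x' | μ (wedge p x x') ≤ τ} ∩ {z | cr p x z < 0}) ≤ 2 * τ := by
    refine measure_le_of_semiconnex μ hR (hB1.inter hneg) (fun x' hx' => hx'.1) ?_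
    rintro x' ⟨-, hx'⟩
    filter_upwards [hcr x' (ne_of_lt hx')] with z hne
    rintro ⟨-, hz⟩
    simp only [hRdef, wedge, mem_ofPred_eq] at *
    rw [cr_swap_right p x' z]
    by_contra! hcon
    have h1 : ¬ 0 < cr p x' z := fun h => hz.not_gt (hcon.1.2 h)
    have h2 : ¬ 0 < -cr p x' z := fun h => hx'.not_gt (hcon.2.2 h)
    exact hne (by linarith)
  have key3 : μ ({x' | μ (wedge p x x')ᶜ ≤ τ} ∩ {z | 0 < cr p x z}) ≤ 2 * τ := by
    refine measure_le_of_semiconnex μ hR.compl (hB2.inter hpos) (fun x' hx' => hx'.1) ?_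
    rintro x' ⟨-, hx'⟩
    filter_upwards [hcr x' (ne_of_gt hx')] with z hne
    rintro ⟨-, hz⟩
    simp only [hRdef, wedge, mem_ofPred_eq, mem_compl_iff, not_not] at *
    rw [cr_swap_right p x' z]
    by_contra! hcon
    rcases hcon with ⟨h1 | h1, h2 | h2⟩ <;> exact hne (by linarith)
  have key4 : μ ({x' | μ (wedge p x x')ᶜ ≤ τ} ∩ {z | cr p x z < 0}) ≤ 2 * τ := by
    refine measure_le_of_semiconnex μ hR.compl (hB2.inter hneg) (fun x' hx' => hx'.1) ?_
    rintro x' ⟨-, hx'⟩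
    refine Eventually.of_forall ?_
    rintro z ⟨-, hz⟩
    simp only [hRdef, wedge, mem_ofPred_eq, mem_compl_iff, not_not] at *
    rw [cr_swap_right p x' z]
    by_contra! hcon
    rcases hcon with ⟨h1 | h1, h2 | h2⟩ <;> linarith
  have hsub : {x' | μ (wedge p x x') ≤ τ ∨ μ (wedge p x x')ᶜ ≤ τ} ⊆
      (({x' | μ (wedge p x x') ≤ τ} ∩ {z | 0 < cr p x z}) ∪
      ({x' | μ (wedge p x x') ≤ τ} ∩ {z | cr p x z < 0})) ∪
      (({x' | μ (wedge p x x')ᶜ ≤ τ} ∩ {z | 0 < cr p x z}) ∪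
      ({x' | μ (wedge p x x')ᶜ ≤ τ} ∩ {z | cr p x z < 0})) ∪ {w | cr p x w = 0} := by
    intro z hz
    rcases lt_trichotomy (cr p x z) 0 with h | h | h <;>
    · simp only [mem_union, mem_inter_iff, mem_ofPred_eq] at *
      tauto
  calc _ ≤ _ := measure_mono hsub
    _ ≤ ((2 * τ + 2 * τ) + (2 * τ + 2 * τ)) + 0 := by
      refine (measure_union_le _ _).trans (add_le_add ((measure_union_le _ _).trans
        (add_le_add ((measure_union_le _ _).trans (add_le_add key1 key2))
          ((measure_union_le _ _).trans (add_le_add key3 key4)))) (hline p x hpx).le)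
    _ = 8 * τ := by ring

end Wedge

section Vec

variable {X : Type*} [MeasurableSpace X] (μ : Measure X) [IsProbabilityMeasure μ]

theorem measurePreserving_vec2 :
    MeasurePreserving (fun p : X × X => (![p.1, p.2] : Fin 2 → X)) (μ.prod μ)
      (Measure.pi fun _ => μ) := by
  have hm : Measurable (fun p : X × X => (![p.1, p.2] : Fin 2 → X)) := by
    refine measurable_pi_iff.2 fun i => ?_
    fin_cases i <;> simp <;> fun_prop
  refine ⟨hm, (Measure.pi_eq fun s hs => ?_).symm⟩
  rw [Measure.map_apply hm (MeasurableSet.univ_pi hs)]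
  have : (fun p : X × X => (![p.1, p.2] : Fin 2 → X)) ⁻¹' Set.pi univ s = s 0 ×ˢ s 1 := by
    ext p; simp [Set.mem_pi, Fin.forall_fin_succ]
  rw [this, Measure.prod_prod, Fin.prod_univ_two]

theorem measurePreserving_vec4 :
    MeasurePreserving (fun p : (X × X) × (X × X) =>
      (![p.1.1, p.1.2, p.2.1, p.2.2] : Fin 4 → X)) ((μ.prod μ).prod (μ.prod μ))
      (Measure.pi fun _ => μ) := by
  have hm : Measurable (fun p : (X × X) × (X × X) =>
      (![p.1.1, p.1.2, p.2.1, p.2.2] : Fin 4 → X)) := by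
    refine measurable_pi_iff.2 fun i => ?_
    fin_cases i <;> simp <;> fun_prop
  refine ⟨hm, (Measure.pi_eq fun s hs => ?_).symm⟩
  rw [Measure.map_apply hm (MeasurableSet.univ_pi hs)]
  have : (fun p : (X × X) × (X × X) =>
      (![p.1.1, p.1.2, p.2.1, p.2.2] : Fin 4 → X)) ⁻¹' Set.pi univ s =
      (s 0 ×ˢ s 1) ×ˢ (s 2 ×ˢ s 3) := by
    ext p; simp [Set.mem_pi, Fin.forall_fin_succ, and_assoc]
  rw [this, Measure.prod_prod, Measure.prod_prod, Measure.prod_prod, Fin.prod_univ_four]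
  ring

theorem measurePreserving_vec5 :
    MeasurePreserving (fun p : ((X × X) × (X × X)) × X =>
      (![p.1.1.1, p.1.1.2, p.1.2.1, p.1.2.2, p.2] : Fin 5 → X))
      (((μ.prod μ).prod (μ.prod μ)).prod μ) (Measure.pi fun _ => μ) := by
  have hm : Measurable (fun p : ((X × X) × (X × X)) × X =>
      (![p.1.1.1, p.1.1.2, p.1.2.1, p.1.2.2, p.2] : Fin 5 → X)) := by
    refine measurable_pi_iff.2 fun i => ?_
    fin_cases i <;> simp <;> fun_prop
  refine ⟨hm, (Measure.pi_eq fun s hs => ?_).symm⟩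
  rw [Measure.map_apply hm (MeasurableSet.univ_pi hs)]
  have : (fun p : ((X × X) × (X × X)) × X =>
      (![p.1.1.1, p.1.1.2, p.1.2.1, p.1.2.2, p.2] : Fin 5 → X)) ⁻¹' Set.pi univ s =
      ((s 0 ×ˢ s 1) ×ˢ (s 2 ×ˢ s 3)) ×ˢ s 4 := by
    ext p; simp [Set.mem_pi, Fin.forall_fin_succ, and_assoc]
  rw [this, Measure.prod_prod, Measure.prod_prod, Measure.prod_prod, Measure.prod_prod,
    Fin.prod_univ_five]
  ring

theorem measurePreserving_vec6 :
    MeasurePreserving (fun p : ((X × X) × (X × X)) × (X × X) =>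
      (![p.1.1.1, p.1.1.2, p.1.2.1, p.1.2.2, p.2.1, p.2.2] : Fin 6 → X))
      (((μ.prod μ).prod (μ.prod μ)).prod (μ.prod μ)) (Measure.pi fun _ => μ) := by
  have hm : Measurable (fun p : ((X × X) × (X × X)) × (X × X) =>
      (![p.1.1.1, p.1.1.2, p.1.2.1, p.1.2.2, p.2.1, p.2.2] : Fin 6 → X)) := by
    refine measurable_pi_iff.2 fun i => ?_
    fin_cases i <;> simp <;> fun_prop
  refine ⟨hm, (Measure.pi_eq fun s hs => ?_).symm⟩
  rw [Measure.map_apply hm (MeasurableSet.univ_pi hs)]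
  have : (fun p : ((X × X) × (X × X)) × (X × X) =>
      (![p.1.1.1, p.1.1.2, p.1.2.1, p.1.2.2, p.2.1, p.2.2] : Fin 6 → X)) ⁻¹' Set.pi univ s =
      ((s 0 ×ˢ s 1) ×ˢ (s 2 ×ˢ s 3)) ×ˢ (s 4 ×ˢ s 5) := by
    ext p; simp [Set.mem_pi, Fin.forall_fin_succ, and_assoc]
  rw [this, Measure.prod_prod, Measure.prod_prod, Measure.prod_prod, Measure.prod_prod,
    Measure.prod_prod, Fin.prod_univ_six]
  ring

end Vec

/-- `measure_sample_eq` in coordinates on another probability space. -/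
theorem measure_sample_eq_of_measurePreserving {X Y : Type*} [MeasurableSpace X]
    [MeasurableSpace Y] (μ : Measure X) [IsProbabilityMeasure μ] {ν : Measure Y} {N k : ℕ}
    {v : Y → Fin k → X} (hv : MeasurePreserving v ν (Measure.pi fun _ => μ))
    (i : Fin k → Fin N) (hi : Function.Injective i) {A : Set (Fin k → X)} (hA : MeasurableSet A)
    {B : Set ((Fin k → X) × X)} (hB : MeasurableSet B) :
    (Measure.pi fun _ : Fin N => μ)
      {x | (fun l => x (i l)) ∈ A ∧ ∀ j, j ∉ Set.range i → ((fun l => x (i l)), x j) ∈ B}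
      = ∫⁻ y in v ⁻¹' A, (μ {w | (v y, w) ∈ B}) ^ (N - k) ∂ν :=
  (measure_sample_eq μ i hi hA hB).trans
    (hv.setLIntegral_comp_preimage hA ((measurable_measure_prodMk_left hB).pow_const _)).symm

section HullEdges

/-- `e` is a pair of indices whose sample points lie in relation `D` and all other sample points
are strictly to the left of the line through them. -/
def IsHullEdge (D : Set (Pt × Pt)) {N : ℕ} (x : Fin N → Pt) (e : Fin N × Fin N) : Prop :=
  e.1 ≠ e.2 ∧ (x e.1, x e.2) ∈ D ∧ ∀ k, k ≠ e.1 → k ≠ e.2 → 0 < cr (x e.1) (x e.2) (x k)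

open scoped Classical in
/-- The set of index pairs satisfying `IsHullEdge D x`. -/
def hullEdges (D : Set (Pt × Pt)) {N : ℕ} (x : Fin N → Pt) : Finset (Fin N × Fin N) :=
  Finset.univ.filter fun e => IsHullEdge D x e

variable {D : Set (Pt × Pt)} {N : ℕ}

theorem mem_hullEdges {x : Fin N → Pt} {e : Fin N × Fin N} :
    e ∈ hullEdges D x ↔ IsHullEdge D x e := by
  simp [hullEdges]

theorem IsHullEdge.snd_eq {x : Fin N → Pt} {e f : Fin N × Fin N} (he : IsHullEdge D x e)
    (hf : IsHullEdge D x f) (h : e.1 = f.1) : e = f := by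
  obtain ⟨a, b⟩ := e
  obtain ⟨a', b'⟩ := f
  obtain rfl : a = a' := h
  by_contra hne
  have hbb : b ≠ b' := fun h => hne (by rw [h])
  have h3 := he.2.2 b' hf.1.symm hbb.symm
  have h4 := hf.2.2 b he.1.symm hbb
  simp only at h3 h4
  rw [cr_swap_right] at h4
  linarith

theorem IsHullEdge.fst_eq {x : Fin N → Pt} {e f : Fin N × Fin N} (he : IsHullEdge D x e)
    (hf : IsHullEdge D x f) (h : e.2 = f.2) : e = f := by
  obtain ⟨a, b⟩ := e
  obtain ⟨a', b'⟩ := f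
  obtain rfl : b = b' := h
  by_contra hne
  have hbb : a ≠ a' := fun h => hne (by rw [h])
  have h3 := he.2.2 a' hbb.symm hf.1
  have h4 := hf.2.2 a hbb he.1
  simp only [cr] at h3 h4
  linarith

/-- The index pairs `e` and `f` have no index in common. -/
def Apart {N : ℕ} (e f : Fin N × Fin N) : Prop := e.1 ≠ f.1 ∧ e.1 ≠ f.2 ∧ e.2 ≠ f.1 ∧ e.2 ≠ f.2

instance (e f : Fin N × Fin N) : Decidable (Apart e f) := by unfold Apart; infer_instance

theorem card_not_apart_le (x : Fin N → Pt) (e : Fin N × Fin N) :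
    ((hullEdges D x).filter fun f => ¬ Apart e f).card ≤ 4 := by
  have h1 : ∀ a, ((hullEdges D x).filter fun f => f.1 = a).card ≤ 1 := fun a =>
    Finset.card_le_one.2 fun f hf g hg => by
      rw [Finset.mem_filter, mem_hullEdges] at hf hg
      exact hf.1.snd_eq hg.1 (hf.2.trans hg.2.symm)
  have h2 : ∀ a, ((hullEdges D x).filter fun f => f.2 = a).card ≤ 1 := fun a =>
    Finset.card_le_one.2 fun f hf g hg => by
      rw [Finset.mem_filter, mem_hullEdges] at hf hg
      exact hf.1.fst_eq hg.1 (hf.2.trans hg.2.symm)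
  have hsub : ((hullEdges D x).filter fun f => ¬ Apart e f) ⊆
      (((hullEdges D x).filter fun f => f.1 = e.1) ∪ ((hullEdges D x).filter fun f => f.2 = e.1)) ∪
      (((hullEdges D x).filter fun f => f.1 = e.2) ∪
        ((hullEdges D x).filter fun f => f.2 = e.2)) := by
    intro f hf
    simp only [Apart, Finset.mem_filter, Finset.mem_union] at hf ⊢
    grind
  have := h1 e.1
  have := h1 e.2
  have := h2 e.1
  have := h2 e.2
  refine (Finset.card_le_card hsub).trans ((Finset.card_union_le _ _).trans
    ((add_le_add (Finset.card_union_le _ _) (Finset.card_union_le _ _)).trans (by omega)))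

theorem measurableSet_isHullEdge (hD : MeasurableSet D) (e : Fin N × Fin N) :
    MeasurableSet {x : Fin N → Pt | IsHullEdge D x e} := by
  have : {x : Fin N → Pt | IsHullEdge D x e} =
      {x | e.1 ≠ e.2} ∩ ((fun x : Fin N → Pt => (x e.1, x e.2)) ⁻¹' D ∩
        ⋂ k, ⋂ (_ : k ≠ e.1), ⋂ (_ : k ≠ e.2), {x | 0 < cr (x e.1) (x e.2) (x k)}) := by
    ext x; simp [IsHullEdge]
  rw [this]
  refine (MeasurableSet.const _).inter (((by fun_prop : Measurable fun x : Fin N → Pt =>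
    (x e.1, x e.2)) hD).inter (MeasurableSet.iInter fun k => MeasurableSet.iInter fun _ =>
      MeasurableSet.iInter fun _ => measurableSet_left (by fun_prop) (by fun_prop) (by fun_prop)))

theorem card_hullEdges (x : Fin N → Pt) :
    ((hullEdges D x).card : ℝ≥0∞) =
      ∑ e, {x : Fin N → Pt | IsHullEdge D x e}.indicator (fun _ => 1) x := by
  classical
  rw [hullEdges, Finset.card_filter]
  push_cast
  refine Finset.sum_congr rfl fun e _ => ?_
  simp [Set.indicator_apply]

theorem measurable_card_hullEdges (hD : MeasurableSet D) :
    Measurable fun x : Fin N → Pt => ((hullEdges D x).card : ℝ≥0∞) := by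
  simp_rw [card_hullEdges]
  exact Finset.measurable_sum _ fun e _ =>
    measurable_const.indicator (measurableSet_isHullEdge hD e)

variable (μ : Measure Pt) [IsProbabilityMeasure μ]

theorem measure_isHullEdge (hD : MeasurableSet D) {e : Fin N × Fin N} (he : e.1 ≠ e.2) :
    (Measure.pi fun _ : Fin N => μ) {x | IsHullEdge D x e} =
      ∫⁻ p in D, (μ {w | 0 < cr p.1 p.2 w}) ^ (N - 2) ∂(μ.prod μ) := by
  have hi : Function.Injective ![e.1, e.2] := by
    intro i j; fin_cases i <;> fin_cases j <;> simp [he, he.symm]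
  have hA : MeasurableSet {z : Fin 2 → Pt | (z 0, z 1) ∈ D} :=
    (by fun_prop : Measurable fun z : Fin 2 → Pt => (z 0, z 1)) hD
  have hB : MeasurableSet {q : (Fin 2 → Pt) × Pt | 0 < cr (q.1 0) (q.1 1) q.2} :=
    measurableSet_left (by fun_prop) (by fun_prop) (by fun_prop)
  have h := measure_sample_eq_of_measurePreserving (k := 2) μ (measurePreserving_vec2 μ)
    ![e.1, e.2] hi hA hB
  have hset : {x : Fin N → Pt | IsHullEdge D x e} = {x |
      (fun l => x (![e.1, e.2] l)) ∈ {z : Fin 2 → Pt | (z 0, z 1) ∈ D} ∧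
      ∀ j, j ∉ Set.range ![e.1, e.2] → ((fun l => x (![e.1, e.2] l)), x j) ∈
        {q : (Fin 2 → Pt) × Pt | 0 < cr (q.1 0) (q.1 1) q.2}} := by
    ext x; simp [IsHullEdge, he]; grind
  rw [hset, h]
  rfl

theorem lintegral_card_hullEdges (hD : MeasurableSet D) :
    ∫⁻ x, ((hullEdges D x).card : ℝ≥0∞) ∂(Measure.pi fun _ : Fin N => μ) =
      (N * (N - 1) : ℕ) * ∫⁻ p in D, (μ {w | 0 < cr p.1 p.2 w}) ^ (N - 2) ∂(μ.prod μ) := by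
  classical
  simp_rw [card_hullEdges]
  rw [lintegral_finsetSum _ fun e _ =>
    measurable_const.indicator (measurableSet_isHullEdge hD e)]
  have : ∀ e : Fin N × Fin N, ∫⁻ x, {x : Fin N → Pt | IsHullEdge D x e}.indicator (fun _ => 1) x
      ∂(Measure.pi fun _ : Fin N => μ) = if e.1 ≠ e.2 then
      ∫⁻ p in D, (μ {w | 0 < cr p.1 p.2 w}) ^ (N - 2) ∂(μ.prod μ) else 0 := by
    intro e
    rw [lintegral_indicator_const (measurableSet_isHullEdge hD e), one_mul]
    split_ifs with he
    · exact measure_isHullEdge μ hD he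
    · have : {x : Fin N → Pt | IsHullEdge D x e} = ∅ := by
        ext x; simp only [IsHullEdge, mem_ofPred_eq]; tauto
      rw [this, measure_empty]
  simp_rw [this]
  rw [← Finset.sum_filter, Finset.sum_const, nsmul_eq_mul]
  congr 2
  have h := Finset.offDiag_card (Finset.univ : Finset (Fin N))
  have h' : (Finset.univ.filter fun e : Fin N × Fin N => e.1 ≠ e.2) =
    (Finset.univ : Finset (Fin N)).offDiag := by ext e; simp
  rw [h', h, Finset.card_univ, Fintype.card_fin, Nat.mul_sub_one]

end HullEdges

section SecondMoment

variable {D : Set (Pt × Pt)} {N : ℕ}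

theorem card_sq_le (x : Fin N → Pt) :
    (hullEdges D x).card * (hullEdges D x).card ≤ 4 * (hullEdges D x).card +
      ((hullEdges D x ×ˢ hullEdges D x).filter fun q => Apart q.1 q.2).card := by
  have h1 := Finset.card_filter_add_card_filter_not (s := hullEdges D x ×ˢ hullEdges D x)
    fun q => Apart q.1 q.2
  have h2 : ((hullEdges D x ×ˢ hullEdges D x).filter fun q => ¬ Apart q.1 q.2).card ≤
      4 * (hullEdges D x).card := by
    rw [Finset.card_filter, Finset.sum_product, mul_comm, ← smul_eq_mul]
    refine Finset.sum_le_card_nsmul _ _ _ fun e he => ?_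
    rw [← Finset.card_filter]
    exact card_not_apart_le x e
  rw [Finset.card_product] at h1
  omega

theorem card_apart_eq (x : Fin N → Pt) :
    (((hullEdges D x ×ˢ hullEdges D x).filter fun q => Apart q.1 q.2).card : ℝ≥0∞) =
      ∑ q ∈ (Finset.univ.filter fun q : (Fin N × Fin N) × (Fin N × Fin N) =>
        q.1.1 ≠ q.1.2 ∧ q.2.1 ≠ q.2.2 ∧ Apart q.1 q.2),
        ({x : Fin N → Pt | IsHullEdge D x q.1} ∩ {x | IsHullEdge D x q.2}).indicator
          (fun _ => 1) x := by
  classical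
  rw [Finset.sum_filter]
  simp only [Set.indicator_apply]
  rw [← Finset.sum_boole]
  rw [← Finset.sum_filter, ← Finset.sum_filter, ← Finset.sum_filter]
  congr 1
  ext q
  simp only [Finset.mem_filter, Finset.mem_product, mem_hullEdges, Finset.mem_univ, true_and,
    mem_inter_iff, mem_ofPred_eq]
  constructor
  · rintro ⟨⟨h1, h2⟩, h3⟩
    exact ⟨⟨h1.1, h2.1, h3⟩, h1, h2⟩
  · rintro ⟨⟨-, -, h3⟩, h1, h2⟩
    exact ⟨⟨h1, h2⟩, h3⟩

theorem card_pairs_le (N : ℕ) :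
    (Finset.univ.filter fun q : (Fin N × Fin N) × (Fin N × Fin N) =>
        q.1.1 ≠ q.1.2 ∧ q.2.1 ≠ q.2.2 ∧ Apart q.1 q.2).card ≤ (N * (N - 1)) ^ 2 := by
  have h := Finset.offDiag_card (Finset.univ : Finset (Fin N))
  rw [Finset.card_univ, Fintype.card_fin, ← Nat.mul_sub_one] at h
  rw [sq, ← h, ← Finset.card_product]
  refine Finset.card_le_card fun q hq => ?_
  simp at hq ⊢
  exact ⟨hq.1, hq.2.1⟩

variable (μ : Measure Pt) [IsProbabilityMeasure μ]

theorem measure_isHullEdge_inter_le (hD : MeasurableSet D) {e f : Fin N × Fin N}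
    (he : e.1 ≠ e.2) (hf : f.1 ≠ f.2) (hef : Apart e f) :
    (Measure.pi fun _ : Fin N => μ) ({x | IsHullEdge D x e} ∩ {x | IsHullEdge D x f}) ≤
      ∫⁻ p in D ×ˢ D, (μ {w | 0 < cr p.1.1 p.1.2 w ∧ 0 < cr p.2.1 p.2.2 w}) ^ (N - 4)
        ∂((μ.prod μ).prod (μ.prod μ)) := by
  obtain ⟨h1, h2, h3, h4⟩ := hef
  have hi : Function.Injective ![e.1, e.2, f.1, f.2] := by
    intro i j; fin_cases i <;> fin_cases j <;> simp [*, Ne.symm he, Ne.symm hf, h1.symm, h2.symm,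
      h3.symm, h4.symm]
  have hA : MeasurableSet {z : Fin 4 → Pt | (z 0, z 1) ∈ D ∧ (z 2, z 3) ∈ D} :=
    ((by fun_prop : Measurable fun z : Fin 4 → Pt => (z 0, z 1)) hD).inter
      ((by fun_prop : Measurable fun z : Fin 4 → Pt => (z 2, z 3)) hD)
  have hB : MeasurableSet {q : (Fin 4 → Pt) × Pt |
      0 < cr (q.1 0) (q.1 1) q.2 ∧ 0 < cr (q.1 2) (q.1 3) q.2} :=
    (measurableSet_left (by fun_prop) (by fun_prop) (by fun_prop)).inter
      (measurableSet_left (by fun_prop) (by fun_prop) (by fun_prop))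
  have h := measure_sample_eq_of_measurePreserving (k := 4) μ (measurePreserving_vec4 μ)
    ![e.1, e.2, f.1, f.2] hi hA hB
  refine (measure_mono ?_).trans h.le
  rintro x ⟨hx, hx'⟩
  refine ⟨⟨hx.2.1, hx'.2.1⟩, fun j hj => ?_⟩
  have hj0 : j ≠ e.1 := fun h => hj ⟨0, h.symm⟩
  have hj1 : j ≠ e.2 := fun h => hj ⟨1, h.symm⟩
  have hj2 : j ≠ f.1 := fun h => hj ⟨2, h.symm⟩
  have hj3 : j ≠ f.2 := fun h => hj ⟨3, h.symm⟩
  exact ⟨hx.2.2 j hj0 hj1, hx'.2.2 j hj2 hj3⟩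

theorem lintegral_card_sq_le (hD : MeasurableSet D) :
    ∫⁻ x, ((hullEdges D x).card : ℝ≥0∞) * (hullEdges D x).card
        ∂(Measure.pi fun _ : Fin N => μ) ≤
      4 * ∫⁻ x, ((hullEdges D x).card : ℝ≥0∞) ∂(Measure.pi fun _ : Fin N => μ) +
      ((N * (N - 1)) ^ 2 : ℕ) *
        ∫⁻ p in D ×ˢ D, (μ {w | 0 < cr p.1.1 p.1.2 w ∧ 0 < cr p.2.1 p.2.2 w}) ^ (N - 4)
          ∂((μ.prod μ).prod (μ.prod μ)) := by
  have hms : ∀ q : (Fin N × Fin N) × (Fin N × Fin N),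
      MeasurableSet ({x : Fin N → Pt | IsHullEdge D x q.1} ∩ {x | IsHullEdge D x q.2}) :=
    fun q => (measurableSet_isHullEdge hD _).inter (measurableSet_isHullEdge hD _)
  calc _ ≤ ∫⁻ x, (4 * ((hullEdges D x).card : ℝ≥0∞) +
        ((hullEdges D x ×ˢ hullEdges D x).filter fun q => Apart q.1 q.2).card)
        ∂(Measure.pi fun _ : Fin N => μ) := by
        refine lintegral_mono fun x => ?_
        have h := (Nat.cast_le (α := ℝ≥0∞)).2 (card_sq_le (D := D) x)
        push_cast at h
        exact h
    _ ≤ _ := by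
        rw [lintegral_add_left ((measurable_card_hullEdges hD).const_mul _),
          lintegral_const_mul _ (measurable_card_hullEdges hD)]
        gcongr
        simp_rw [card_apart_eq]
        rw [lintegral_finsetSum _ fun q _ => measurable_const.indicator (hms q)]
        refine (Finset.sum_le_card_nsmul _ _ (∫⁻ p in D ×ˢ D,
          (μ {w | 0 < cr p.1.1 p.1.2 w ∧ 0 < cr p.2.1 p.2.2 w}) ^ (N - 4)
            ∂((μ.prod μ).prod (μ.prod μ))) fun q hq => ?_).trans ?_
        · rw [lintegral_indicator_const (hms q), one_mul]
          obtain ⟨h1, h2, h3⟩ := (Finset.mem_filter.1 hq).2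
          exact measure_isHullEdge_inter_le μ hD h1 h2 h3
        · rw [nsmul_eq_mul]
          gcongr
          exact card_pairs_le N

end SecondMoment

section Asymptotics

variable (μ : Measure Pt) [IsProbabilityMeasure μ]

/-- The pairs of points for which the cap cut off to the right of the line through them has
measure at most `k / N`. -/
def capPairs (k N : ℕ) : Set (Pt × Pt) := {p | μ {w | cr p.1 p.2 w ≤ 0} ≤ (k : ℝ≥0∞) / N}

theorem measurableSet_cap_rel : MeasurableSet {q : (Pt × Pt) × Pt | cr q.1.1 q.1.2 q.2 ≤ 0} :=
  measurableSet_le (by fun_prop) measurable_const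

theorem measurableSet_capPairs (k N : ℕ) : MeasurableSet (capPairs μ k N) :=
  measurableSet_le (measurable_measure_prodMk_left measurableSet_cap_rel) measurable_const

theorem compl_left (p q : Pt) : {w | 0 < cr p q w}ᶜ = {w | cr p q w ≤ 0} := by
  ext w; simp

theorem measurableSet_left' (p q : Pt) : MeasurableSet {w | 0 < cr p q w} :=
  measurableSet_left measurable_const measurable_const measurable_id

/-- The expected number of hull edges that cut off a small cap. -/
def meanEdges (k N : ℕ) : ℝ≥0∞ :=
  ∫⁻ x, ((hullEdges (capPairs μ k N) x).card : ℝ≥0∞) ∂(Measure.pi fun _ : Fin N => μ)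

theorem pow_inter_le {a b s o δ k : ℝ} {N : ℕ} (hN : 4 ≤ N) (hk : 2 * k ≤ N)
    (hδ : 0 ≤ δ)
    (ha : 1 - k / N ≤ a) (ha1 : a ≤ 1) (hb : 1 - k / N ≤ b) (hb1 : b ≤ 1) (hs0 : 0 ≤ s)
    (hs : s = a + b - 1 + o) (ho : o ≤ δ / N) :
    s ^ (N - 4) ≤ Real.exp (4 * δ) * ((1 - k / N) ^ 4)⁻¹ * (a ^ (N - 2) * b ^ (N - 2)) := by
  have hN0 : (0 : ℝ) < N := by positivity
  have hkN : k / N ≤ 1 / 2 := by rw [div_le_iff₀ hN0]; linarith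
  have hc : 0 < 1 - k / N := by linarith
  have ha0 : 0 < a := by linarith
  have hb0 : 0 < b := by linarith
  have hab : 1 / 4 ≤ a * b := by nlinarith
  have hδN : 0 ≤ δ / N := by positivity
  have h1 : s ≤ a * b * (1 + 4 * (δ / N)) := by nlinarith
  have h2 : (1 + 4 * (δ / N)) ^ (N - 4) ≤ Real.exp (4 * δ) := by
    calc (1 + 4 * (δ / N)) ^ (N - 4) ≤ (1 + 4 * (δ / N)) ^ N :=
          pow_le_pow_right₀ (by linarith) (by omega)
      _ ≤ (Real.exp (4 * (δ / N))) ^ N := by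
          gcongr; linarith [Real.add_one_le_exp (4 * (δ / N))]
      _ = Real.exp (4 * δ) := by
          rw [← Real.exp_nat_mul]; congr 1; field_simp
  have h3 : (a * b) ^ (N - 4) ≤ ((1 - k / N) ^ 4)⁻¹ * (a ^ (N - 2) * b ^ (N - 2)) := by
    rw [← mul_pow, show N - 2 = (N - 4) + 2 by omega, pow_add, inv_mul_eq_div, le_div_iff₀ (by positivity)]
    gcongr
    calc (1 - k / N) ^ 4 = ((1 - k / N) * (1 - k / N)) ^ 2 := by ring
      _ ≤ (a * b) ^ 2 := by gcongr
  calc s ^ (N - 4) ≤ (a * b * (1 + 4 * (δ / N))) ^ (N - 4) := by gcongr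
    _ = (a * b) ^ (N - 4) * (1 + 4 * (δ / N)) ^ (N - 4) := mul_pow _ _ _
    _ ≤ (((1 - k / N) ^ 4)⁻¹ * (a ^ (N - 2) * b ^ (N - 2))) * Real.exp (4 * δ) := by gcongr
    _ = _ := by ring

theorem exists_delta_eventually (k : ℝ) {η : ℝ} (hη : 0 < η) : ∃ δ : ℝ, 0 < δ ∧
    ∀ᶠ N : ℕ in atTop, Real.exp (4 * δ) * ((1 - k / N) ^ 4)⁻¹ ≤ 1 + η := by
  refine ⟨Real.log (1 + η / 2) / 4, by have := Real.log_pos (show 1 < 1 + η / 2 by linarith); positivity, ?_⟩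
  have h : Tendsto (fun N : ℕ => Real.exp (4 * (Real.log (1 + η / 2) / 4)) *
      ((1 - k / N) ^ 4)⁻¹) atTop (𝓝 (Real.exp (4 * (Real.log (1 + η / 2) / 4)) *
      ((1 - 0) ^ 4)⁻¹)) := by
    refine Tendsto.const_mul _ (Tendsto.inv₀ ((Tendsto.sub tendsto_const_nhds ?_).pow 4) (by simp))
    exact tendsto_const_div_atTop_nhds_zero_nat k
  refine h.eventually_le_const ?_
  rw [mul_div_cancel₀ _ (by norm_num), Real.exp_log (by linarith)]
  norm_num; linarith

variable {μ}

theorem left_real_ge {k N : ℕ} (hN : 0 < N) {p : Pt × Pt} (hp : p ∈ capPairs μ k N) :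
    1 - (k : ℝ) / N ≤ μ.real {w | 0 < cr p.1 p.2 w} := by
  have h1 := probReal_compl_eq_one_sub (μ := μ) (measurableSet_left' p.1 p.2)
  rw [compl_left] at h1
  have h2 : μ.real {w | cr p.1 p.2 w ≤ 0} ≤ (k : ℝ) / N := by
    refine ENNReal.toReal_le_of_le_ofReal (by positivity) ?_
    rw [ENNReal.ofReal_div_of_pos (by positivity)]
    rw [ENNReal.ofReal_natCast, ENNReal.ofReal_natCast]
    exact hp
  linarith

theorem inter_real_eq (p p' : Pt × Pt) :
    μ.real {w | 0 < cr p.1 p.2 w ∧ 0 < cr p'.1 p'.2 w} = μ.real {w | 0 < cr p.1 p.2 w} +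
      μ.real {w | 0 < cr p'.1 p'.2 w} - 1 +
      μ.real ({w | cr p.1 p.2 w ≤ 0} ∩ {w | cr p'.1 p'.2 w ≤ 0}) := by
  have h1 := measureReal_union_add_inter (μ := μ) (s := {w | 0 < cr p.1 p.2 w})
    (measurableSet_left' p'.1 p'.2)
  have h2 := probReal_compl_eq_one_sub (μ := μ)
    ((measurableSet_left' p.1 p.2).union (measurableSet_left' p'.1 p'.2))
  rw [compl_union, compl_left, compl_left] at h2
  have h3 : {w | 0 < cr p.1 p.2 w ∧ 0 < cr p'.1 p'.2 w} =
    {w | 0 < cr p.1 p.2 w} ∩ {w | 0 < cr p'.1 p'.2 w} := rfl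
  rw [h3]
  linarith

variable (hov : ∀ (k : ℕ) (δ : ℝ), 0 < δ → ∃ G : ℕ, ∀ N : ℕ, 0 < N → ∀ p ∈ capPairs μ k N,
    ∃ Λ : Set Pt, μ Λ ≤ (G : ℝ≥0∞) / N ∧ ∀ p' ∈ capPairs μ k N,
      ENNReal.ofReal (δ / N) < μ ({w | cr p.1 p.2 w ≤ 0} ∩ {w | cr p'.1 p'.2 w ≤ 0}) →
        p'.1 ∈ Λ ∧ p'.2 ∈ Λ)

include hov in
theorem eventually_lintegral_inter_le (k : ℕ) {η : ℝ} (hη : 0 < η) : ∃ G : ℕ,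
    ∀ᶠ N : ℕ in atTop, ∫⁻ p in capPairs μ k N ×ˢ capPairs μ k N,
        (μ {w | 0 < cr p.1.1 p.1.2 w ∧ 0 < cr p.2.1 p.2.2 w}) ^ (N - 4)
          ∂((μ.prod μ).prod (μ.prod μ)) ≤
      ENNReal.ofReal (1 + η) * (∫⁻ p in capPairs μ k N, (μ {w | 0 < cr p.1 p.2 w}) ^ (N - 2)
        ∂(μ.prod μ)) ^ 2 + ((G : ℝ≥0∞) / N) ^ 2 * (μ.prod μ) (capPairs μ k N) := by
  obtain ⟨δ, hδ, hev⟩ := exists_delta_eventually k hη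
  obtain ⟨G, hG⟩ := hov k δ hδ
  refine ⟨G, ?_⟩
  filter_upwards [hev, eventually_ge_atTop 4, eventually_ge_atTop (2 * k)] with N hN hN4 hN2k
  have hN0 : 0 < N := by omega
  set D := capPairs μ k N with hDdef
  have hD : MeasurableSet D := measurableSet_capPairs μ k N
  set J : Pt × Pt → ℝ≥0∞ := fun p => (μ {w | 0 < cr p.1 p.2 w}) ^ (N - 2) with hJ
  have hJm : Measurable J := by
    have : MeasurableSet {q : (Pt × Pt) × Pt | 0 < cr q.1.1 q.1.2 q.2} :=
      measurableSet_left (by fun_prop) (by fun_prop) (by fun_prop)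
    exact (measurable_measure_prodMk_left this).pow_const _
  set V : Set ((Pt × Pt) × (Pt × Pt)) := {q | ENNReal.ofReal (δ / N) <
    μ ({w | cr q.1.1 q.1.2 w ≤ 0} ∩ {w | cr q.2.1 q.2.2 w ≤ 0})} with hV
  have hVm : MeasurableSet V := by
    have : MeasurableSet {q : ((Pt × Pt) × (Pt × Pt)) × Pt |
        cr q.1.1.1 q.1.1.2 q.2 ≤ 0 ∧ cr q.1.2.1 q.1.2.2 q.2 ≤ 0} :=
      (((by fun_prop : Measurable fun q : ((Pt × Pt) × (Pt × Pt)) × Pt => (q.1.1, q.2))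
        measurableSet_cap_rel).inter
        ((by fun_prop : Measurable fun q : ((Pt × Pt) × (Pt × Pt)) × Pt => (q.1.2, q.2))
          measurableSet_cap_rel))
    exact measurableSet_lt measurable_const (measurable_measure_prodMk_left this)
  have hpt : ∀ q ∈ D ×ˢ D, (μ {w | 0 < cr q.1.1 q.1.2 w ∧ 0 < cr q.2.1 q.2.2 w}) ^ (N - 4) ≤
      ENNReal.ofReal (1 + η) * (J q.1 * J q.2) + V.indicator (fun _ => 1) q := by
    rintro ⟨p, p'⟩ ⟨hp, hp'⟩
    by_cases hq : (p, p') ∈ V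
    · rw [indicator_of_mem hq]
      exact le_add_left (pow_le_one' prob_le_one _)
    · rw [indicator_of_notMem hq, add_zero]
      have ho : μ.real ({w | cr p.1 p.2 w ≤ 0} ∩ {w | cr p'.1 p'.2 w ≤ 0}) ≤ δ / N :=
        ENNReal.toReal_le_of_le_ofReal (by positivity) (not_lt.1 hq)
      have h := pow_inter_le hN4 (by exact_mod_cast hN2k) hδ.le
        (left_real_ge hN0 hp) measureReal_le_one
        (left_real_ge hN0 hp') measureReal_le_one measureReal_nonneg (inter_real_eq p p') ho
      have h' := h.trans (mul_le_mul_of_nonneg_right hN (by positivity))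
      have h'' := ENNReal.ofReal_le_ofReal h'
      rw [ENNReal.ofReal_mul (by positivity), ENNReal.ofReal_mul (by positivity),
        ENNReal.ofReal_pow measureReal_nonneg, ENNReal.ofReal_pow measureReal_nonneg,
        ENNReal.ofReal_pow measureReal_nonneg, ofReal_measureReal, ofReal_measureReal,
        ofReal_measureReal] at h''
      exact h''
  have hVle : ((μ.prod μ).prod (μ.prod μ)) (V ∩ D ×ˢ D) ≤
      ((G : ℝ≥0∞) / N) ^ 2 * (μ.prod μ) D := by
    rw [Measure.prod_apply (hVm.inter (hD.prod hD)), ← lintegral_indicator_const hD]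
    refine lintegral_mono fun p => ?_
    by_cases hp : p ∈ D
    · rw [indicator_of_mem hp]
      obtain ⟨Λ, hΛ, hΛ'⟩ := hG N hN0 p hp
      calc (μ.prod μ) (Prod.mk p ⁻¹' (V ∩ D ×ˢ D)) ≤ (μ.prod μ) (Λ ×ˢ Λ) :=
            measure_mono fun p' hp' => hΛ' p' hp'.2.2 hp'.1
        _ = μ Λ ^ 2 := by rw [Measure.prod_prod, sq]
        _ ≤ _ := by gcongr
    · have : Prod.mk p ⁻¹' (V ∩ D ×ˢ D) = ∅ := by ext p'; simp [hp]
      rw [this, measure_empty]; exact zero_le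
  calc _ ≤ ∫⁻ q in D ×ˢ D, (ENNReal.ofReal (1 + η) * (J q.1 * J q.2) +
        V.indicator (fun _ => 1) q) ∂((μ.prod μ).prod (μ.prod μ)) :=
        setLIntegral_mono' (hD.prod hD) hpt
    _ = ENNReal.ofReal (1 + η) * (∫⁻ p in D, J p ∂(μ.prod μ)) ^ 2 +
        ((μ.prod μ).prod (μ.prod μ)) (V ∩ D ×ˢ D) := by
        rw [lintegral_add_left (by fun_prop), lintegral_const_mul _ (by fun_prop),
          ← Measure.prod_restrict, lintegral_prod_mul hJm.aemeasurable hJm.aemeasurable, sq,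
          lintegral_indicator_const hVm, one_mul, Measure.prod_restrict,
          Measure.restrict_apply hVm]
    _ ≤ _ := by gcongr

theorem meanEdges_eq (k N : ℕ) : meanEdges μ k N = (N * (N - 1) : ℕ) *
    ∫⁻ p in capPairs μ k N, (μ {w | 0 < cr p.1 p.2 w}) ^ (N - 2) ∂(μ.prod μ) :=
  lintegral_card_hullEdges μ (measurableSet_capPairs μ k N)

theorem meanEdges_ne_top (k N : ℕ) : meanEdges μ k N ≠ ∞ := by
  rw [meanEdges_eq]
  refine ENNReal.mul_ne_top (ENNReal.natCast_ne_top _) (ne_of_lt ?_)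
  calc _ ≤ ∫⁻ p in capPairs μ k N, 1 ∂(μ.prod μ) :=
        lintegral_mono fun p => pow_le_one' prob_le_one _
    _ ≤ 1 := by simpa using prob_le_one
    _ < ∞ := ENNReal.one_lt_top

include hov in
theorem eventually_second_moment_le {k : ℕ} {K : ℕ}
    (hK : ∀ᶠ N : ℕ in atTop, (N : ℝ≥0∞) ^ 2 * (μ.prod μ) (capPairs μ k N) ≤
      K * meanEdges μ k N)
    (hm : Tendsto (meanEdges μ k) atTop (𝓝 ∞)) {η : ℝ} (hη : 0 < η) :
    ∀ᶠ N : ℕ in atTop, ∫⁻ x, ((hullEdges (capPairs μ k N) x).card : ℝ≥0∞) *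
      (hullEdges (capPairs μ k N) x).card ∂(Measure.pi fun _ : Fin N => μ) ≤
      ENNReal.ofReal (1 + η) * meanEdges μ k N ^ 2 := by
  obtain ⟨G, hG⟩ := eventually_lintegral_inter_le hov k (half_pos hη)
  have hbig : ∀ᶠ N : ℕ in atTop, ((4 : ℝ≥0∞) + G ^ 2 * K) / ENNReal.ofReal (η / 2) <
      meanEdges μ k N := by
    refine hm.eventually_const_lt (ENNReal.div_lt_top ?_ ?_)
    · exact ENNReal.add_ne_top.2 ⟨by simp, ENNReal.mul_ne_top (by simp) (by simp)⟩
    · simpa using hη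
  filter_upwards [hG, hK, hbig, eventually_ge_atTop 1] with N hGN hKN hbigN hN
  refine (lintegral_card_sq_le μ (measurableSet_capPairs μ k N)).trans ?_
  have e1 := meanEdges_eq (μ := μ) k N
  set m := meanEdges μ k N with hmdef
  set J := ∫⁻ p in capPairs μ k N, (μ {w | 0 < cr p.1 p.2 w}) ^ (N - 2) ∂(μ.prod μ) with hJ
  set I := (μ.prod μ) (capPairs μ k N) with hI
  have hη2 : ENNReal.ofReal (η / 2) ≠ 0 := by simpa using hη
  have h4 : (4 : ℝ≥0∞) + G ^ 2 * K ≤ ENNReal.ofReal (η / 2) * m := by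
    rw [mul_comm _ m]
    exact (ENNReal.div_le_iff hη2 ENNReal.ofReal_ne_top).1 hbigN.le
  have hN0 : (N : ℝ≥0∞) ≠ 0 := by simpa using (by omega : N ≠ 0)
  have h5 : (((N * (N - 1)) ^ 2 : ℕ) : ℝ≥0∞) * (((G : ℝ≥0∞) / N) ^ 2 * I) ≤ G ^ 2 * (K * m) := by
    calc (((N * (N - 1)) ^ 2 : ℕ) : ℝ≥0∞) * (((G : ℝ≥0∞) / N) ^ 2 * I)
        ≤ (((N * N) ^ 2 : ℕ) : ℝ≥0∞) * (((G : ℝ≥0∞) / N) ^ 2 * I) := by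
          gcongr; omega
      _ = ((N : ℝ≥0∞) * (G / N)) ^ 2 * (N ^ 2 * I) := by push_cast; ring
      _ = G ^ 2 * (N ^ 2 * I) := by
          rw [ENNReal.mul_div_cancel hN0 (ENNReal.natCast_ne_top _)]
      _ ≤ _ := by gcongr
  calc 4 * m + (((N * (N - 1)) ^ 2 : ℕ) : ℝ≥0∞) * _
      ≤ 4 * m + (((N * (N - 1)) ^ 2 : ℕ) : ℝ≥0∞) *
        (ENNReal.ofReal (1 + η / 2) * J ^ 2 + ((G : ℝ≥0∞) / N) ^ 2 * I) := by gcongr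
    _ = 4 * m + ENNReal.ofReal (1 + η / 2) * m ^ 2 +
        (((N * (N - 1)) ^ 2 : ℕ) : ℝ≥0∞) * (((G : ℝ≥0∞) / N) ^ 2 * I) := by
        rw [e1]; push_cast; ring
    _ ≤ 4 * m + ENNReal.ofReal (1 + η / 2) * m ^ 2 + G ^ 2 * (K * m) := by gcongr
    _ = (4 + G ^ 2 * K) * m + ENNReal.ofReal (1 + η / 2) * m ^ 2 := by ring
    _ ≤ (ENNReal.ofReal (η / 2) * m) * m + ENNReal.ofReal (1 + η / 2) * m ^ 2 := by gcongr
    _ = (ENNReal.ofReal (1 + η / 2) + ENNReal.ofReal (η / 2)) * m ^ 2 := by ring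
    _ = _ := by
        rw [← ENNReal.ofReal_add (by positivity) (by positivity)]; congr 2; ring

end Asymptotics

section SignSums

open scoped Classical in
/-- `-1` if `w` is to the left of `uv`, and `1` otherwise. -/
def sgnLeft (u v w : Pt) : ℝ := if 0 < cr u v w then -1 else 1

theorem abs_sgnLeft (u v w : Pt) : |sgnLeft u v w| = 1 := by
  unfold sgnLeft; split_ifs <;> simp

@[fun_prop]
theorem measurable_sgnLeft {X : Type*} [MeasurableSpace X] {f g h : X → Pt} (hf : Measurable f)
    (hg : Measurable g) (hh : Measurable h) :
    Measurable fun x => sgnLeft (f x) (g x) (h x) :=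
  Measurable.ite (measurableSet_left hf hg hh) measurable_const measurable_const

theorem sgnLeft_mul (p x x' w : Pt) [Decidable (w ∈ wedge p x x')] :
    sgnLeft p x w * sgnLeft p x' w = if w ∈ wedge p x x' then -1 else 1 := by
  by_cases h1 : 0 < cr p x w <;> by_cases h2 : 0 < cr p x' w <;> simp [sgnLeft, wedge, h1, h2]

/-- `1` or `-1` according to the parity of the number of sample points to the left of the line
through the points with indices `a` and `b`. -/
def leftParity {N : ℕ} (x : Fin N → Pt) (a b : Fin N) : ℝ := ∏ k, sgnLeft (x a) (x b) (x k)

theorem abs_leftParity {N : ℕ} (x : Fin N → Pt) (a b : Fin N) : |leftParity x a b| = 1 := by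
  rw [leftParity, Finset.abs_prod]
  exact Finset.prod_eq_one fun k _ => abs_sgnLeft _ _ _

theorem leftParity_eq {N : ℕ} (x : Fin N → Pt) (a b : Fin N) :
    leftParity x a b = (-1) ^ (Finset.univ.filter fun k => 0 < cr (x a) (x b) (x k)).card := by
  classical
  rw [leftParity, ← Finset.prod_const, Finset.prod_filter]
  exact Finset.prod_congr rfl fun k _ => by unfold sgnLeft; congr

@[fun_prop]
theorem measurable_leftParity {N : ℕ} (a b : Fin N) :
    Measurable fun x : Fin N → Pt => leftParity x a b := by
  unfold leftParity; fun_prop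

/-- The triples of index pairs that use six different indices. -/
def apartTriples (N : ℕ) : Finset ((Fin N × Fin N) × (Fin N × Fin N) × (Fin N × Fin N)) :=
  Finset.univ.filter fun q => q.1.1 ≠ q.1.2 ∧ q.2.1.1 ≠ q.2.1.2 ∧ q.2.2.1 ≠ q.2.2.2 ∧
    Apart q.1 q.2.1 ∧ Apart q.1 q.2.2 ∧ Apart q.2.1 q.2.2

/-- The six indices of a triple of index pairs. -/
def tripleIdx {N : ℕ} (q : (Fin N × Fin N) × (Fin N × Fin N) × (Fin N × Fin N)) :
    Fin 6 → Fin N := ![q.1.1, q.1.2, q.2.1.1, q.2.1.2, q.2.2.1, q.2.2.2]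

theorem tripleIdx_injective {N : ℕ} {q : (Fin N × Fin N) × (Fin N × Fin N) × (Fin N × Fin N)}
    (hq : q ∈ apartTriples N) : Function.Injective (tripleIdx q) := by
  obtain ⟨h1, h2, h3, ⟨h4, h5, h6, h7⟩, ⟨h8, h9, h10, h11⟩, h12, h13, h14, h15⟩ :=
    (Finset.mem_filter.1 hq).2
  intro i j
  fin_cases i <;> fin_cases j <;> simp [tripleIdx, *, Ne.symm h1, Ne.symm h2, Ne.symm h3,
    h4.symm, h5.symm, h6.symm, h7.symm, h8.symm, h9.symm, h10.symm, h11.symm, h12.symm, h13.symm,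
    h14.symm, h15.symm]

theorem forall_ne_iff {N k : ℕ} {i : Fin k → Fin N} (hi : Function.Injective i) (a b : Fin k)
    (P : Fin N → Prop) : (∀ j, j ≠ i a → j ≠ i b → P j) ↔
      (∀ l, l ≠ a → l ≠ b → P (i l)) ∧ ∀ j, j ∉ Set.range i → P j := by
  constructor
  · intro h
    exact ⟨fun l ha hb => h _ (hi.ne ha) (hi.ne hb),
      fun j hj => h j (fun e => hj ⟨a, e.symm⟩) (fun e => hj ⟨b, e.symm⟩)⟩
  · rintro ⟨h1, h2⟩ j ha hb
    by_cases hj : j ∈ Set.range i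
    · obtain ⟨l, rfl⟩ := hj
      exact h1 l (fun e => ha (by rw [e])) (fun e => hb (by rw [e]))
    · exact h2 j hj

variable (μ : Measure Pt) [IsProbabilityMeasure μ]

/-- The triples of points for which the wedge or its complement has measure at most `τ`. -/
def thinWedges (τ : ℝ≥0∞) : Set (Pt × Pt × Pt) :=
  {t | μ (wedge t.1 t.2.1 t.2.2) ≤ τ ∨ μ (wedge t.1 t.2.1 t.2.2)ᶜ ≤ τ}

theorem measurableSet_thinWedges (τ : ℝ≥0∞) : MeasurableSet (thinWedges μ τ) := by
  have h1 : MeasurableSet {q : (Pt × Pt × Pt) × Pt | 0 < cr q.1.1 q.1.2.1 q.2} :=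
    measurableSet_left (by fun_prop) (by fun_prop) (by fun_prop)
  have h2 : MeasurableSet {q : (Pt × Pt × Pt) × Pt | 0 < cr q.1.1 q.1.2.2 q.2} :=
    measurableSet_left (by fun_prop) (by fun_prop) (by fun_prop)
  have hR : MeasurableSet {q : (Pt × Pt × Pt) × Pt | q.2 ∈ wedge q.1.1 q.1.2.1 q.1.2.2} :=
    (h1.iff h2).compl
  exact (measurableSet_le (measurable_measure_prodMk_left hR) measurable_const).union
    (measurableSet_le (measurable_measure_prodMk_left hR.compl) measurable_const)

variable {μ}

theorem abs_integral_left_signs_le {k N : ℕ} {L : ℝ} (hN : 0 < N) {p p' p'' : Pt × Pt}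
    (hp : p ∈ capPairs μ k N) (hp' : p' ∈ capPairs μ k N)
    (hp'' : p'' ∈ capPairs μ k N)
    (hw : (p.1, p'.1, p''.1) ∉ thinWedges μ (ENNReal.ofReal ((L + 3 * k) / N))) :
    |∫ w, {w | 0 < cr p.1 p.2 w ∧ 0 < cr p'.1 p'.2 w ∧ 0 < cr p''.1 p''.2 w}.indicator
      (fun w => sgnLeft p.1 p'.1 w * sgnLeft p.1 p''.1 w) w ∂μ| ≤ 1 - 2 * (L / N) := by
  classical
  set W := wedge p.1 p'.1 p''.1 with hW
  set R : Set Pt := {w | 0 < cr p.1 p.2 w ∧ 0 < cr p'.1 p'.2 w ∧ 0 < cr p''.1 p''.2 w} with hR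
  have hWm : MeasurableSet W := measurableSet_wedge _ _ _
  have hRm : MeasurableSet R := (measurableSet_left' _ _).inter
    ((measurableSet_left' _ _).inter (measurableSet_left' _ _))
  have hfun : (fun w => R.indicator
      (fun w => sgnLeft p.1 p'.1 w * sgnLeft p.1 p''.1 w) w) =
      fun w => (R \ W).indicator (fun _ => (1 : ℝ)) w - (R ∩ W).indicator (fun _ => (1 : ℝ)) w := by
    funext w
    by_cases h1 : w ∈ R <;> by_cases h2 : w ∈ W <;>
      simp [h1, h2, indicator, sgnLeft_mul, ← hW]
  have hint : ∀ s : Set Pt, MeasurableSet s →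
      Integrable (fun w => s.indicator (fun _ => (1 : ℝ)) w) μ := fun s hs =>
    (integrable_const _).indicator hs
  rw [hfun, integral_sub (hint _ (hRm.diff hWm)) (hint _ (hRm.inter hWm)),
    integral_indicator_const _ (hRm.diff hWm), integral_indicator_const _ (hRm.inter hWm)]
  simp only [smul_eq_mul, mul_one]
  have hN' : (0 : ℝ) < N := by exact_mod_cast hN
  rw [thinWedges, mem_ofPred_eq, not_or, not_le, not_le] at hw
  have hw1 : (L + 3 * k) / N ≤ μ.real W := by
    rw [measureReal_def, ← ENNReal.ofReal_le_iff_le_toReal (measure_ne_top _ _)]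
    exact hw.1.le
  have hw2 : (L + 3 * k) / N ≤ μ.real Wᶜ := by
    rw [measureReal_def, ← ENNReal.ofReal_le_iff_le_toReal (measure_ne_top _ _)]
    exact hw.2.le
  have hRc : μ.real Rᶜ ≤ 3 * k / N := by
    have hle : ∀ p : Pt × Pt, p ∈ capPairs μ k N → μ.real {w | 0 < cr p.1 p.2 w}ᶜ ≤ k / N := by
      intro p hp
      have := left_real_ge hN hp
      rw [probReal_compl_eq_one_sub (measurableSet_left' _ _)]; linarith
    have : Rᶜ ⊆ {w | 0 < cr p.1 p.2 w}ᶜ ∪ ({w | 0 < cr p'.1 p'.2 w}ᶜ ∪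
        {w | 0 < cr p''.1 p''.2 w}ᶜ) := by
      intro w hw
      simp only [hR, mem_compl_iff, mem_union, mem_ofPred_eq] at hw ⊢
      tauto
    have h1 := measureReal_mono this (μ := μ)
    have h2 := measureReal_union_le (μ := μ) ({w | 0 < cr p.1 p.2 w}ᶜ)
      ({w | 0 < cr p'.1 p'.2 w}ᶜ ∪ {w | 0 < cr p''.1 p''.2 w}ᶜ)
    have h3 := measureReal_union_le (μ := μ) ({w | 0 < cr p'.1 p'.2 w}ᶜ)
      ({w | 0 < cr p''.1 p''.2 w}ᶜ)
    have := hle p hp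
    have := hle p' hp'
    have := hle p'' hp''
    have : (3 : ℝ) * k / N = k / N + (k / N + k / N) := by ring
    linarith
  have e1 := measureReal_inter_add_sdiff (μ := μ) (s := R) hWm
  have e2 : μ.real W ≤ μ.real (R ∩ W) + μ.real Rᶜ :=
    (measureReal_mono (by intro w hw; by_cases h : w ∈ R <;> simp [h, hw])).trans
      (measureReal_union_le _ _)
  have e3 : μ.real Wᶜ ≤ μ.real (R \ W) + μ.real Rᶜ :=
    (measureReal_mono (by
      intro w hw
      by_cases h : w ∈ R
      · exact Or.inl ⟨h, hw⟩
      · exact Or.inr h)).trans (measureReal_union_le _ _)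
  have e4 : μ.real R ≤ 1 := measureReal_le_one
  have e5 : (L + 3 * k) / N = L / N + 3 * k / N := by ring
  rw [abs_le]
  constructor <;> linarith

end SignSums

section TripleBound

theorem prod_eq_prod_mul_prod_compl_range {N k : ℕ} {i : Fin k → Fin N}
    (hi : Function.Injective i) (h : Fin N → ℝ) [Fintype {j // j ∉ Set.range i}] :
    ∏ j, h j = (∏ l, h (i l)) * ∏ j : {j // j ∉ Set.range i}, h j := by
  classical
  rw [← Fintype.prod_subtype_mul_prod_subtype (fun j => j ∈ Set.range i) h]
  congr 1
  · exact (@Fintype.prod_equiv _ _ _ _ (Subtype.fintype _) _ (Equiv.ofInjective i hi)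
      (fun l => h (i l)) (fun j => h j) fun l => rfl).symm
  · exact Finset.prod_congr (by ext; simp) fun _ _ => rfl

variable {μ : Measure Pt}

/-- The signed indicator of three hull edges whose tails do not span a thin wedge. -/
def tripleTerm (μ : Measure Pt) (D : Set (Pt × Pt)) (τ : ℝ≥0∞) {N : ℕ}
    (q : (Fin N × Fin N) × (Fin N × Fin N) × (Fin N × Fin N)) (x : Fin N → Pt) : ℝ :=
  {x : Fin N → Pt | IsHullEdge D x q.1 ∧ IsHullEdge D x q.2.1 ∧ IsHullEdge D x q.2.2 ∧
    (x q.1.1, x q.2.1.1, x q.2.2.1) ∉ thinWedges μ τ}.indicator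
    (fun x => leftParity x q.1.1 q.2.1.1 * leftParity x q.1.1 q.2.2.1) x

theorem measurable_tripleTerm [IsProbabilityMeasure μ] {D : Set (Pt × Pt)} (hD : MeasurableSet D) (τ : ℝ≥0∞) {N : ℕ}
    (q : (Fin N × Fin N) × (Fin N × Fin N) × (Fin N × Fin N)) :
    Measurable (tripleTerm μ D τ q) := by
  refine Measurable.indicator (by fun_prop) ?_
  exact (measurableSet_isHullEdge hD _).inter ((measurableSet_isHullEdge hD _).inter
    ((measurableSet_isHullEdge hD _).inter
      ((by fun_prop : Measurable fun x : Fin N → Pt => (x q.1.1, x q.2.1.1, x q.2.2.1))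
        (measurableSet_thinWedges μ τ)).compl))

theorem abs_tripleTerm_le (D : Set (Pt × Pt)) (τ : ℝ≥0∞) {N : ℕ}
    (q : (Fin N × Fin N) × (Fin N × Fin N) × (Fin N × Fin N)) (x : Fin N → Pt) :
    |tripleTerm μ D τ q x| ≤ 1 := by
  unfold tripleTerm indicator
  split_ifs
  · rw [abs_mul, abs_leftParity, abs_leftParity, one_mul]
  · simp

/-- The admissible positions of the six endpoints of three hull edges. -/
def tripleDomain (μ : Measure Pt) (D : Set (Pt × Pt)) (τ : ℝ≥0∞) : Set (Fin 6 → Pt) :=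
  {z | (z 0, z 1) ∈ D} ∩ {z | (z 2, z 3) ∈ D} ∩ {z | (z 4, z 5) ∈ D} ∩
    {z | (z 0, z 2, z 4) ∈ thinWedges μ τ}ᶜ ∩
    (⋂ l, ⋂ (_ : l ≠ 0), ⋂ (_ : l ≠ 1), {z | 0 < cr (z 0) (z 1) (z l)}) ∩
    (⋂ l, ⋂ (_ : l ≠ 2), ⋂ (_ : l ≠ 3), {z | 0 < cr (z 2) (z 3) (z l)}) ∩
    (⋂ l, ⋂ (_ : l ≠ 4), ⋂ (_ : l ≠ 5), {z | 0 < cr (z 4) (z 5) (z l)})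

theorem measurableSet_tripleDomain [IsProbabilityMeasure μ] {D : Set (Pt × Pt)} (hD : MeasurableSet D) (τ : ℝ≥0∞) :
    MeasurableSet (tripleDomain μ D τ) := by
  have h1 : ∀ a b : Fin 6, MeasurableSet {z : Fin 6 → Pt | (z a, z b) ∈ D} := fun a b =>
    (by fun_prop : Measurable fun z : Fin 6 → Pt => (z a, z b)) hD
  have h2 : ∀ a b : Fin 6, MeasurableSet
      (⋂ l, ⋂ (_ : l ≠ a), ⋂ (_ : l ≠ b), {z : Fin 6 → Pt | 0 < cr (z a) (z b) (z l)}) :=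
    fun a b => MeasurableSet.iInter fun l => MeasurableSet.iInter fun _ =>
      MeasurableSet.iInter fun _ => measurableSet_left (by fun_prop) (by fun_prop) (by fun_prop)
  have h3 : MeasurableSet {z : Fin 6 → Pt | (z 0, z 2, z 4) ∈ thinWedges μ τ} :=
    (by fun_prop : Measurable fun z : Fin 6 → Pt => (z 0, z 2, z 4)) (measurableSet_thinWedges μ τ)
  exact ((((((h1 0 1).inter (h1 2 3)).inter (h1 4 5)).inter h3.compl).inter (h2 0 1)).inter
    (h2 2 3)).inter (h2 4 5)

/-- The contribution of the six endpoints to `tripleTerm`. -/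
def tripleHead (μ : Measure Pt) (D : Set (Pt × Pt)) (τ : ℝ≥0∞) (z : Fin 6 → Pt) : ℝ :=
  (tripleDomain μ D τ).indicator
    (fun z => ∏ l, sgnLeft (z 0) (z 2) (z l) * sgnLeft (z 0) (z 4) (z l)) z

/-- The set of points to the left of the three edges with endpoints `z`. -/
def tripleLeft (z : Fin 6 → Pt) : Set Pt :=
  {w | 0 < cr (z 0) (z 1) w ∧ 0 < cr (z 2) (z 3) w ∧ 0 < cr (z 4) (z 5) w}

/-- The contribution of any other sample point to `tripleTerm`. -/
def tripleKernel (t : (Fin 6 → Pt) × Pt) : ℝ :=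
  (tripleLeft t.1).indicator
    (fun w => sgnLeft (t.1 0) (t.1 2) w * sgnLeft (t.1 0) (t.1 4) w) t.2

theorem measurable_tripleKernel : Measurable tripleKernel := by
  have h1 : ∀ a b : Fin 6, MeasurableSet {t : (Fin 6 → Pt) × Pt | 0 < cr (t.1 a) (t.1 b) t.2} :=
    fun a b => measurableSet_left (by fun_prop) (by fun_prop) (by fun_prop)
  have h : Measurable fun t : (Fin 6 → Pt) × Pt =>
      ({t : (Fin 6 → Pt) × Pt | 0 < cr (t.1 0) (t.1 1) t.2} ∩
        ({t | 0 < cr (t.1 2) (t.1 3) t.2} ∩ {t | 0 < cr (t.1 4) (t.1 5) t.2})).indicator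
      (fun t => sgnLeft (t.1 0) (t.1 2) t.2 * sgnLeft (t.1 0) (t.1 4) t.2) t :=
    Measurable.indicator (by fun_prop) ((h1 0 1).inter ((h1 2 3).inter (h1 4 5)))
  exact h

theorem tripleTerm_eq {D : Set (Pt × Pt)} {τ : ℝ≥0∞} {N : ℕ}
    {q : (Fin N × Fin N) × (Fin N × Fin N) × (Fin N × Fin N)} (hq : q ∈ apartTriples N)
    (x : Fin N → Pt) [Fintype {j // j ∉ Set.range (tripleIdx q)}] :
    tripleTerm μ D τ q x = tripleHead μ D τ (fun l => x (tripleIdx q l)) *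
      ∏ j : {j // j ∉ Set.range (tripleIdx q)},
        tripleKernel (fun l => x (tripleIdx q l), x j) := by
  classical
  have hi := tripleIdx_injective hq
  obtain ⟨h1, h2, h3, -⟩ := (Finset.mem_filter.1 hq).2
  have g1 := forall_ne_iff hi 0 1 fun j => 0 < cr (x q.1.1) (x q.1.2) (x j)
  have g2 := forall_ne_iff hi 2 3 fun j => 0 < cr (x q.2.1.1) (x q.2.1.2) (x j)
  have g3 := forall_ne_iff hi 4 5 fun j => 0 < cr (x q.2.2.1) (x q.2.2.2) (x j)
  have key : x ∈ {x : Fin N → Pt | IsHullEdge D x q.1 ∧ IsHullEdge D x q.2.1 ∧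
      IsHullEdge D x q.2.2 ∧ (x q.1.1, x q.2.1.1, x q.2.2.1) ∉ thinWedges μ τ} ↔
      (fun l => x (tripleIdx q l)) ∈ tripleDomain μ D τ ∧
        ∀ j, j ∉ Set.range (tripleIdx q) → x j ∈ tripleLeft (fun l => x (tripleIdx q l)) := by
    simp only [IsHullEdge, tripleDomain, tripleLeft, mem_ofPred_eq, mem_inter_iff, mem_iInter,
      mem_compl_iff, forall_and]
    change (_ ∧ _ ∧ (∀ j, j ≠ tripleIdx q 0 → j ≠ tripleIdx q 1 → _)) ∧
      (_ ∧ _ ∧ (∀ j, j ≠ tripleIdx q 2 → j ≠ tripleIdx q 3 → _)) ∧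
      (_ ∧ _ ∧ (∀ j, j ≠ tripleIdx q 4 → j ≠ tripleIdx q 5 → _)) ∧ _ ↔ _
    rw [g1, g2, g3]
    change _ ↔ ((((((_ ∧ _) ∧ _) ∧ ¬ (x q.1.1, x q.2.1.1, x q.2.2.1) ∈ thinWedges μ τ) ∧
      (∀ l, l ≠ 0 → l ≠ 1 → 0 < cr (x q.1.1) (x q.1.2) (x (tripleIdx q l)))) ∧
      (∀ l, l ≠ 2 → l ≠ 3 → 0 < cr (x q.2.1.1) (x q.2.1.2) (x (tripleIdx q l)))) ∧
      (∀ l, l ≠ 4 → l ≠ 5 → 0 < cr (x q.2.2.1) (x q.2.2.2) (x (tripleIdx q l)))) ∧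
      (∀ j, j ∉ Set.range (tripleIdx q) → 0 < cr (x q.1.1) (x q.1.2) (x j)) ∧
      (∀ j, j ∉ Set.range (tripleIdx q) → 0 < cr (x q.2.1.1) (x q.2.1.2) (x j)) ∧
      (∀ j, j ∉ Set.range (tripleIdx q) → 0 < cr (x q.2.2.1) (x q.2.2.2) (x j))
    constructor
    · rintro ⟨⟨-, d1, c1, e1⟩, ⟨-, d2, c2, e2⟩, ⟨-, d3, c3, e3⟩, t⟩
      exact ⟨⟨⟨⟨⟨⟨⟨d1, d2⟩, d3⟩, t⟩, c1⟩, c2⟩, c3⟩, e1, e2, e3⟩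
    · rintro ⟨⟨⟨⟨⟨⟨⟨d1, d2⟩, d3⟩, t⟩, c1⟩, c2⟩, c3⟩, e1, e2, e3⟩
      exact ⟨⟨h1, d1, c1, e1⟩, ⟨h2, d2, c2, e2⟩, ⟨h3, d3, c3, e3⟩, t⟩
  by_cases hx : x ∈ {x : Fin N → Pt | IsHullEdge D x q.1 ∧ IsHullEdge D x q.2.1 ∧
      IsHullEdge D x q.2.2 ∧ (x q.1.1, x q.2.1.1, x q.2.2.1) ∉ thinWedges μ τ}
  · rw [tripleTerm, indicator_of_mem hx]
    obtain ⟨hA, hB⟩ := key.1 hx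
    rw [tripleHead, indicator_of_mem hA, leftParity, leftParity, ← Finset.prod_mul_distrib,
      prod_eq_prod_mul_prod_compl_range hi]
    congr 1
    refine Finset.prod_congr rfl fun j _ => ?_
    rw [tripleKernel, indicator_of_mem (hB j j.2)]
    rfl
  · rw [tripleTerm, indicator_of_notMem hx]
    by_cases hA : (fun l => x (tripleIdx q l)) ∈ tripleDomain μ D τ
    · have : ∃ j, j ∉ Set.range (tripleIdx q) ∧
          x j ∉ tripleLeft (fun l => x (tripleIdx q l)) := by
        by_contra! hcon
        exact hx (key.2 ⟨hA, hcon⟩)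
      obtain ⟨j, hj, hj'⟩ := this
      rw [Finset.prod_eq_zero (Finset.mem_univ ⟨j, hj⟩), mul_zero]
      rw [tripleKernel, indicator_of_notMem hj']
    · rw [tripleHead, indicator_of_notMem hA, zero_mul]

theorem enorm_integral_tripleTerm_le [IsProbabilityMeasure μ] {k N : ℕ} (hN : 12 ≤ N) {L : ℝ} (hL : 0 ≤ L)
    {q : (Fin N × Fin N) × (Fin N × Fin N) × (Fin N × Fin N)} (hq : q ∈ apartTriples N) :
    ‖∫ x, tripleTerm μ (capPairs μ k N) (ENNReal.ofReal ((L + 3 * k) / N)) q x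
      ∂(Measure.pi fun _ : Fin N => μ)‖ₑ ≤
      ENNReal.ofReal (Real.exp (-L)) * (μ.prod μ) (capPairs μ k N) ^ 3 := by
  classical
  set D := capPairs μ k N with hDdef
  set τ := ENNReal.ofReal ((L + 3 * k) / N) with hτ
  have hD : MeasurableSet D := measurableSet_capPairs μ k N
  have hAm := measurableSet_tripleDomain (μ := μ) hD τ
  simp_rw [tripleTerm_eq hq]
  have hF : Measurable (tripleHead μ D τ) := Measurable.indicator (by fun_prop) hAm
  have h := enorm_integral_sample_le μ (tripleIdx q) (tripleIdx_injective hq) hF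
    measurable_tripleKernel
  refine h.trans ?_
  set c : ℝ≥0∞ := ENNReal.ofReal (Real.exp (-L)) with hc
  have hpt : ∀ z, ‖tripleHead μ D τ z‖ₑ * ‖∫ w, tripleKernel (z, w) ∂μ‖ₑ ^ (N - 6) ≤
      (({z : Fin 6 → Pt | (z 0, z 1) ∈ D} ∩ {z | (z 2, z 3) ∈ D}) ∩ {z | (z 4, z 5) ∈ D}).indicator
        (fun _ => c) z := by
    intro z
    by_cases hz : z ∈ tripleDomain μ D τ
    · have hz' := hz
      obtain ⟨⟨⟨⟨⟨⟨d1, d2⟩, d3⟩, d4⟩, -⟩, -⟩, -⟩ := hz'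
      have hmem : z ∈ ({z : Fin 6 → Pt | (z 0, z 1) ∈ D} ∩ {z | (z 2, z 3) ∈ D}) ∩
          {z | (z 4, z 5) ∈ D} := ⟨⟨d1, d2⟩, d3⟩
      rw [indicator_of_mem hmem, tripleHead, indicator_of_mem hz]
      have e1 : ‖∏ l, sgnLeft (z 0) (z 2) (z l) * sgnLeft (z 0) (z 4) (z l)‖ₑ = 1 := by
        rw [← ofReal_norm, Real.norm_eq_abs, Finset.abs_prod]
        simp [abs_mul, abs_sgnLeft]
      rw [e1, one_mul]
      have e2 := abs_integral_left_signs_le (L := L) (by omega) d1 d2 d3 d4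
      have e3 : ‖∫ w, tripleKernel (z, w) ∂μ‖ₑ ≤ ENNReal.ofReal (Real.exp (-(2 * (L / N)))) := by
        rw [← ofReal_norm, Real.norm_eq_abs]
        refine ENNReal.ofReal_le_ofReal (e2.trans ?_)
        linarith [Real.add_one_le_exp (-(2 * (L / N)))]
      calc _ ≤ ENNReal.ofReal (Real.exp (-(2 * (L / N)))) ^ (N - 6) := by gcongr
        _ = ENNReal.ofReal (Real.exp (-(2 * (L / N))) ^ (N - 6)) :=
            (ENNReal.ofReal_pow (Real.exp_pos _).le _).symm
        _ ≤ c := by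
            refine ENNReal.ofReal_le_ofReal ?_
            rw [← Real.exp_nat_mul, Real.exp_le_exp, Nat.cast_sub (by omega)]
            have hN' : (12 : ℝ) ≤ N := by exact_mod_cast hN
            have : L = N * (L / N) := by field_simp
            have h0 : 0 ≤ L / N := by positivity
            push_cast
            nlinarith
    · rw [tripleHead, indicator_of_notMem hz]; simp
  refine (lintegral_mono hpt).trans ?_
  have hDm : ∀ a b : Fin 6, MeasurableSet {z : Fin 6 → Pt | (z a, z b) ∈ D} := fun a b =>
    (by fun_prop : Measurable fun z : Fin 6 → Pt => (z a, z b)) hD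
  have hSm := ((hDm 0 1).inter (hDm 2 3)).inter (hDm 4 5)
  rw [lintegral_indicator_const hSm,
    ← (measurePreserving_vec6 μ).measure_preimage hSm.nullMeasurableSet]
  have : (fun p : ((Pt × Pt) × (Pt × Pt)) × (Pt × Pt) =>
      (![p.1.1.1, p.1.1.2, p.1.2.1, p.1.2.2, p.2.1, p.2.2] : Fin 6 → Pt)) ⁻¹'
      (({z : Fin 6 → Pt | (z 0, z 1) ∈ D} ∩ {z | (z 2, z 3) ∈ D}) ∩ {z | (z 4, z 5) ∈ D}) =
      (D ×ˢ D) ×ˢ D := rfl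
  rw [this, Measure.prod_prod, Measure.prod_prod]
  refine le_of_eq ?_
  ring

end TripleBound

section SignSquares

theorem lintegral_ofReal_le_add {X : Type*} [MeasurableSpace X] {ν : Measure X} {S b : X → ℝ}
    {A : X → ℝ≥0∞} (hA : Measurable A) (hAt : ∀ x, A x ≠ ∞) (hS0 : ∀ x, 0 ≤ S x)
    (hS : ∀ x, S x ≤ (A x).toReal + b x) (hb : Integrable b ν) :
    ∫⁻ x, ENNReal.ofReal (S x) ∂ν ≤ ∫⁻ x, A x ∂ν + ‖∫ x, b x ∂ν‖ₑ := by
  by_cases ht : ∫⁻ x, A x ∂ν = ∞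
  · rw [ht]; simp
  have ha := integrable_toReal_of_lintegral_ne_top hA.aemeasurable ht
  calc _ ≤ ∫⁻ x, ENNReal.ofReal ((A x).toReal + b x) ∂ν :=
        lintegral_mono fun x => ENNReal.ofReal_le_ofReal (hS x)
    _ = ENNReal.ofReal (∫ x, ((A x).toReal + b x) ∂ν) :=
        (ofReal_integral_eq_lintegral_ofReal (ha.add hb)
          (Eventually.of_forall fun x => (hS0 x).trans (hS x))).symm
    _ = ENNReal.ofReal (∫ x, (A x).toReal ∂ν + ∫ x, b x ∂ν) := by rw [integral_add ha hb]
    _ ≤ _ := by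
        refine ENNReal.ofReal_add_le.trans (add_le_add (le_of_eq ?_) ?_)
        · rw [ofReal_integral_eq_lintegral_ofReal ha (Eventually.of_forall fun x =>
            ENNReal.toReal_nonneg)]
          exact lintegral_congr fun x => ENNReal.ofReal_toReal (hAt x)
        · rw [← ofReal_norm]
          exact ENNReal.ofReal_le_ofReal (le_abs_self _)

/-- The index configurations of two pairs and one further index, all different. -/
def apartQuints (N : ℕ) : Finset (((Fin N × Fin N) × (Fin N × Fin N)) × Fin N) :=
  Finset.univ.filter fun q => q.1.1.1 ≠ q.1.1.2 ∧ q.1.2.1 ≠ q.1.2.2 ∧ Apart q.1.1 q.1.2 ∧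
    q.2 ≠ q.1.1.1 ∧ q.2 ≠ q.1.1.2 ∧ q.2 ≠ q.1.2.1 ∧ q.2 ≠ q.1.2.2

variable {μ : Measure Pt}

/-- Two pairs of sample points in relation `D` whose tails, together with a further sample point,
span a thin wedge. -/
def thinQuint (μ : Measure Pt) (D : Set (Pt × Pt)) (τ : ℝ≥0∞) {N : ℕ}
    (q : ((Fin N × Fin N) × (Fin N × Fin N)) × Fin N) : Set (Fin N → Pt) :=
  {x | (x q.1.1.1, x q.1.1.2) ∈ D ∧ (x q.1.2.1, x q.1.2.2) ∈ D ∧ x q.1.1.1 ≠ x q.1.2.1 ∧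
    (x q.1.1.1, x q.1.2.1, x q.2) ∈ thinWedges μ τ}

theorem measurableSet_thinQuint [IsProbabilityMeasure μ] {D : Set (Pt × Pt)}
    (hD : MeasurableSet D) (τ : ℝ≥0∞) {N : ℕ}
    (q : ((Fin N × Fin N) × (Fin N × Fin N)) × Fin N) :
    MeasurableSet (thinQuint μ D τ q) := by
  have h1 : ∀ a b : Fin N, MeasurableSet {x : Fin N → Pt | (x a, x b) ∈ D} := fun a b =>
    (by fun_prop : Measurable fun x : Fin N → Pt => (x a, x b)) hD
  have h2 : MeasurableSet {x : Fin N → Pt | x q.1.1.1 ≠ x q.1.2.1} :=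
    (measurableSet_eq_fun (by fun_prop) (by fun_prop)).compl
  exact (h1 _ _).inter ((h1 _ _).inter (h2.inter
    ((by fun_prop : Measurable fun x : Fin N → Pt => (x q.1.1.1, x q.1.2.1, x q.2))
      (measurableSet_thinWedges μ τ))))

theorem measure_thinQuint_le [IsProbabilityMeasure μ]
    (hline : ∀ p q : Pt, p ≠ q → μ {w | cr p q w = 0} = 0) {D : Set (Pt × Pt)}
    (hD : MeasurableSet D) (τ : ℝ≥0∞) {N : ℕ}
    {q : ((Fin N × Fin N) × (Fin N × Fin N)) × Fin N} (hq : q ∈ apartQuints N) :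
    (Measure.pi fun _ : Fin N => μ) (thinQuint μ D τ q) ≤ (μ.prod μ) D ^ 2 * (8 * τ) := by
  obtain ⟨h1, h2, ⟨h3, h4, h5, h6⟩, h7, h8, h9, h10⟩ := (Finset.mem_filter.1 hq).2
  set i : Fin 5 → Fin N := ![q.1.1.1, q.1.1.2, q.1.2.1, q.1.2.2, q.2] with hi
  have hinj : Function.Injective i := by
    intro a b
    fin_cases a <;> fin_cases b <;> simp [*, h1.symm, h2.symm, h3.symm, h4.symm, h5.symm,
      h6.symm, h7.symm, h8.symm, h9.symm, h10.symm]
  set A : Set (Fin 5 → Pt) := {z | (z 0, z 1) ∈ D ∧ (z 2, z 3) ∈ D ∧ z 0 ≠ z 2 ∧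
    (z 0, z 2, z 4) ∈ thinWedges μ τ} with hAdef
  have hd : ∀ a b : Fin 5, MeasurableSet {x : Fin 5 → Pt | (x a, x b) ∈ D} := fun a b =>
    (by fun_prop : Measurable fun x : Fin 5 → Pt => (x a, x b)) hD
  have hA : MeasurableSet A := (hd _ _).inter ((hd _ _).inter
    ((measurableSet_eq_fun (by fun_prop) (by fun_prop)).compl.inter
    ((by fun_prop : Measurable fun x : Fin 5 → Pt => (x 0, x 2, x 4))
      (measurableSet_thinWedges μ τ))))
  have h := measure_sample_eq_of_measurePreserving μ (measurePreserving_vec5 μ) i hinj hA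
    (B := univ) MeasurableSet.univ
  have e : {x : Fin N → Pt | (fun l => x (i l)) ∈ A ∧ ∀ j, j ∉ Set.range i →
      ((fun l => x (i l)), x j) ∈ univ} = thinQuint μ D τ q := by
    ext x; simp [hAdef, thinQuint, hi]
  rw [e] at h
  rw [h]
  simp only [mem_univ, ofPred_true, measure_univ, one_pow, setLIntegral_one]
  rw [Measure.prod_apply ((measurePreserving_vec5 μ).measurable hA)]
  calc _ ≤ ∫⁻ p, (D ×ˢ D).indicator (fun _ => 8 * τ) p ∂((μ.prod μ).prod (μ.prod μ)) := by
        refine lintegral_mono fun p => ?_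
        by_cases hp : p ∈ D ×ˢ D ∧ p.1.1 ≠ p.2.1
        · rw [indicator_of_mem hp.1]
          refine (measure_mono ?_).trans (measure_small_wedge_le hline hp.2 τ)
          intro w hw
          exact hw.2.2.2
        · refine le_of_eq_of_le ?_ zero_le
          rw [← measure_empty (μ := μ)]
          congr 1
          ext w
          simp only [mem_empty_iff_false, iff_false]
          exact fun hw => hp ⟨⟨hw.1, hw.2.1⟩, hw.2.2.1⟩
    _ = _ := by
        rw [lintegral_indicator_const (hD.prod hD), Measure.prod_prod]; ring

theorem card_apartQuints_le (N : ℕ) : (apartQuints N).card ≤ N ^ 5 := by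
  refine (Finset.card_filter_le _ _).trans (le_of_eq ?_)
  simp [Fintype.card_prod]; ring

theorem card_apartTriples_le (N : ℕ) : (apartTriples N).card ≤ N ^ 6 := by
  refine (Finset.card_filter_le _ _).trans (le_of_eq ?_)
  simp [Fintype.card_prod]; ring

/-- The signed count of the hull edges apart from `e`. -/
def signedCount (D : Set (Pt × Pt)) {N : ℕ} (x : Fin N → Pt) (e : Fin N × Fin N) : ℝ :=
  ∑ f ∈ (hullEdges D x).filter (Apart e), leftParity x e.1 f.1

open scoped Classical in
/-- The contributions of degenerate pairs of edges to the sum of the squared signed counts. -/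
def degenerateCount (μ : Measure Pt) (D : Set (Pt × Pt)) (τ : ℝ≥0∞) {N : ℕ} (x : Fin N → Pt) : ℕ :=
  4 * ((hullEdges D x).card * (hullEdges D x).card) +
    ((apartQuints N).filter fun q => x ∈ thinQuint μ D τ q).card

theorem sum_signedCount_sq_le (D : Set (Pt × Pt)) (τ : ℝ≥0∞) {N : ℕ} (x : Fin N → Pt) :
    ∑ e ∈ hullEdges D x, signedCount D x e ^ 2 ≤
      degenerateCount μ D τ x + ∑ q ∈ apartTriples N, tripleTerm μ D τ q x := by
  classical
  set E := hullEdges D x with hE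
  set T := (E ×ˢ (E ×ˢ E)).filter fun q => Apart q.1 q.2.1 ∧ Apart q.1 q.2.2 with hT
  have h1 : ∑ e ∈ E, signedCount D x e ^ 2 =
      ∑ q ∈ T, leftParity x q.1.1 q.2.1.1 * leftParity x q.1.1 q.2.2.1 := by
    rw [hT, Finset.sum_filter, Finset.sum_product]
    refine Finset.sum_congr rfl fun e _ => ?_
    rw [Finset.sum_product, signedCount, sq, Finset.sum_mul_sum, Finset.sum_filter]
    refine Finset.sum_congr rfl fun f _ => ?_
    by_cases hf : Apart e f
    · simp [hf, Finset.sum_filter, hE]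
    · simp [hf]
  have hTm : ∀ q ∈ T, IsHullEdge D x q.1 ∧ IsHullEdge D x q.2.1 ∧ IsHullEdge D x q.2.2 ∧
      Apart q.1 q.2.1 ∧ Apart q.1 q.2.2 := by
    intro q hq
    simpa [hT, hE, mem_hullEdges, and_assoc] using hq
  have h2 : ∑ q ∈ T with ¬ Apart q.2.1 q.2.2,
      leftParity x q.1.1 q.2.1.1 * leftParity x q.1.1 q.2.2.1 ≤
      ((4 * (E.card * E.card) : ℕ) : ℝ) := by
    calc _ ≤ ∑ q ∈ T with ¬ Apart q.2.1 q.2.2, (1 : ℝ) := Finset.sum_le_sum fun q _ =>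
          (le_abs_self _).trans (by rw [abs_mul, abs_leftParity, abs_leftParity, one_mul])
      _ = ((T.filter fun q => ¬ Apart q.2.1 q.2.2).card : ℝ) := by simp
      _ ≤ (((E ×ˢ (E ×ˢ E)).filter fun q => ¬ Apart q.2.1 q.2.2).card : ℝ) := by
          exact_mod_cast Finset.card_le_card (Finset.filter_subset_filter _
            (Finset.filter_subset _ _))
      _ ≤ _ := by
          rw [Finset.card_filter, Finset.sum_product]
          refine Nat.cast_le.2 ?_
          calc _ ≤ ∑ e ∈ E, ∑ f ∈ E, 4 := by
                refine Finset.sum_le_sum fun e _ => ?_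
                rw [Finset.sum_product]
                refine Finset.sum_le_sum fun f _ => ?_
                rw [← Finset.card_filter]
                exact card_not_apart_le x f
            _ = _ := by simp; ring
  set T' := T.filter fun q => Apart q.2.1 q.2.2 with hT'
  have hT'm : ∀ q ∈ T', q ∈ apartTriples N := by
    intro q hq
    obtain ⟨hq, h⟩ := Finset.mem_filter.1 hq
    obtain ⟨a, b, c, d, e⟩ := hTm q hq
    exact Finset.mem_filter.2 ⟨Finset.mem_univ _, a.1, b.1, c.1, d, e, h⟩
  have h3 : ∑ q ∈ T', tripleTerm μ D τ q x = ∑ q ∈ apartTriples N, tripleTerm μ D τ q x := by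
    refine Finset.sum_subset hT'm fun q hq hq' => ?_
    refine indicator_of_notMem (fun h => hq' ?_) _
    obtain ⟨-, -, -, a, b, c⟩ := (Finset.mem_filter.1 hq).2
    simp [hT', hT, hE, mem_hullEdges, a, b, c, h.1, h.2.1, h.2.2.1]
  have h4 : ((T'.filter fun q => (x q.1.1, x q.2.1.1, x q.2.2.1) ∈ thinWedges μ τ).card : ℝ) ≤
      (((apartQuints N).filter fun q => x ∈ thinQuint μ D τ q).card : ℝ) := by
    refine Nat.cast_le.2 (Finset.card_le_card_of_injOn
      (fun q => ((q.1, q.2.1), q.2.2.1)) ?_ ?_)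
    · intro q hq
      obtain ⟨hq, ht⟩ := Finset.mem_filter.1 hq
      obtain ⟨a, b, c, d, e, f⟩ := (Finset.mem_filter.1 (hT'm q hq)).2
      obtain ⟨h1, h2, h3, -⟩ := hTm q (Finset.mem_filter.1 hq).1
      refine Finset.mem_filter.2 ⟨Finset.mem_filter.2 ⟨Finset.mem_univ _, a, b, d, e.1.symm,
        e.2.2.1.symm, f.1.symm, f.2.2.1.symm⟩, h1.2.1, h2.2.1, fun h => ?_, ht⟩
      have := h1.2.2 q.2.1.1 d.1.symm d.2.2.1.symm
      rw [← h, cr_self_left] at this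
      exact this.false
    · intro q hq r hr h
      have hq' := hTm q (Finset.mem_filter.1 (Finset.mem_filter.1 hq).1).1
      have hr' := hTm r (Finset.mem_filter.1 (Finset.mem_filter.1 hr).1).1
      simp only [Prod.mk.injEq] at h
      exact Prod.ext h.1.1 (Prod.ext h.1.2 (hq'.2.2.1.snd_eq hr'.2.2.1 h.2))
  have h5 : ∑ q ∈ T', leftParity x q.1.1 q.2.1.1 * leftParity x q.1.1 q.2.2.1 ≤
      ((T'.filter fun q => (x q.1.1, x q.2.1.1, x q.2.2.1) ∈ thinWedges μ τ).card : ℝ) +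
        ∑ q ∈ T', tripleTerm μ D τ q x := by
    rw [Finset.card_filter, Nat.cast_sum, ← Finset.sum_add_distrib]
    refine Finset.sum_le_sum fun q hq => ?_
    obtain ⟨g1, g2, g3, -⟩ := hTm q (Finset.mem_filter.1 hq).1
    by_cases ht : (x q.1.1, x q.2.1.1, x q.2.2.1) ∈ thinWedges μ τ
    · rw [if_pos ht, tripleTerm, indicator_of_notMem (fun h => h.2.2.2 ht)]
      refine (le_abs_self _).trans ?_
      rw [abs_mul, abs_leftParity, abs_leftParity]; simp
    · have hmem : x ∈ {x : Fin N → Pt | IsHullEdge D x q.1 ∧ IsHullEdge D x q.2.1 ∧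
          IsHullEdge D x q.2.2 ∧ (x q.1.1, x q.2.1.1, x q.2.2.1) ∉ thinWedges μ τ} :=
        ⟨g1, g2, g3, ht⟩
      rw [if_neg ht, tripleTerm, indicator_of_mem hmem]
      simp
  rw [h1, ← Finset.sum_filter_add_sum_filter_not T fun q => Apart q.2.1 q.2.2, degenerateCount]
  rw [Nat.cast_add]
  linarith

variable [IsProbabilityMeasure μ]

theorem lintegral_signedCount_sq_le
    (hline : ∀ p q : Pt, p ≠ q → μ {w | cr p q w = 0} = 0) {k N : ℕ} (hN : 12 ≤ N) {L : ℝ}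
    (hL : 0 ≤ L) :
    ∫⁻ x, ENNReal.ofReal (∑ e ∈ hullEdges (capPairs μ k N) x, signedCount (capPairs μ k N) x e ^ 2)
      ∂(Measure.pi fun _ : Fin N => μ) ≤
    4 * ∫⁻ x, ((hullEdges (capPairs μ k N) x).card : ℝ≥0∞) * (hullEdges (capPairs μ k N) x).card
      ∂(Measure.pi fun _ : Fin N => μ) +
    N ^ 5 * ((μ.prod μ) (capPairs μ k N) ^ 2 * (8 * ENNReal.ofReal ((L + 3 * k) / N))) +
    N ^ 6 * (ENNReal.ofReal (Real.exp (-L)) * (μ.prod μ) (capPairs μ k N) ^ 3) := by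
  classical
  set D := capPairs μ k N with hDdef
  set τ := ENNReal.ofReal ((L + 3 * k) / N) with hτ
  have hD : MeasurableSet D := measurableSet_capPairs μ k N
  have hY := measurable_card_hullEdges (N := N) hD
  have hcast : ∀ x : Fin N → Pt, (degenerateCount μ D τ x : ℝ≥0∞) =
      4 * ((hullEdges D x).card * (hullEdges D x).card) +
        ∑ q ∈ apartQuints N, (thinQuint μ D τ q).indicator (fun _ => 1) x := by
    intro x
    rw [degenerateCount, Finset.card_filter]
    push_cast
    rfl
  have hYY : Measurable fun x : Fin N → Pt =>
      ((hullEdges D x).card : ℝ≥0∞) * (hullEdges D x).card := hY.mul hY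
  have hq1 : ∀ q : ((Fin N × Fin N) × (Fin N × Fin N)) × Fin N,
      Measurable ((thinQuint μ D τ q).indicator (fun _ => (1 : ℝ≥0∞))) := fun q =>
    measurable_const.indicator (measurableSet_thinQuint hD τ q)
  have hmeas : Measurable fun x : Fin N → Pt => (degenerateCount μ D τ x : ℝ≥0∞) := by
    simp_rw [hcast]
    exact (hYY.const_mul 4).add (Finset.measurable_fun_sum _ fun q _ => hq1 q)
  have hint : ∀ q ∈ apartTriples N, Integrable (tripleTerm μ D τ q)
      (Measure.pi fun _ : Fin N => μ) := fun q _ =>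
    Integrable.of_bound (measurable_tripleTerm hD τ q).aestronglyMeasurable 1
      (Eventually.of_forall fun x => by
        rw [Real.norm_eq_abs]; exact abs_tripleTerm_le D τ q x)
  refine (lintegral_ofReal_le_add hmeas (fun x => ENNReal.natCast_ne_top _)
    (fun x => Finset.sum_nonneg fun e _ => sq_nonneg _)
    (fun x => by simpa using sum_signedCount_sq_le D τ x)
    (integrable_finsetSum _ hint)).trans ?_
  refine add_le_add ?_ ?_
  · simp_rw [hcast]
    rw [lintegral_add_left (hYY.const_mul 4), lintegral_const_mul _ hYY,
      lintegral_finsetSum _ fun q _ => hq1 q]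
    refine add_le_add le_rfl ?_
    calc _ ≤ ∑ q ∈ apartQuints N, (μ.prod μ) D ^ 2 * (8 * τ) := by
          refine Finset.sum_le_sum fun q hq => ?_
          rw [lintegral_indicator_const (measurableSet_thinQuint hD τ q), one_mul]
          exact measure_thinQuint_le hline hD τ hq
      _ ≤ _ := by
          rw [Finset.sum_const, nsmul_eq_mul]
          gcongr
          exact_mod_cast card_apartQuints_le N
  · rw [integral_finsetSum _ hint]
    refine (enorm_sum_le _ _).trans ?_
    calc _ ≤ ∑ q ∈ apartTriples N, ENNReal.ofReal (Real.exp (-L)) * (μ.prod μ) D ^ 3 :=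
          Finset.sum_le_sum fun q hq => enorm_integral_tripleTerm_le hN hL hq
      _ ≤ _ := by
          rw [Finset.sum_const, nsmul_eq_mul]
          gcongr
          exact_mod_cast card_apartTriples_le N

theorem eventually_lintegral_signedCount_sq_le
    (hline : ∀ p q : Pt, p ≠ q → μ {w | cr p q w = 0} = 0) {k K : ℕ}
    (hK : ∀ᶠ N : ℕ in atTop, (N : ℝ≥0∞) ^ 2 * (μ.prod μ) (capPairs μ k N) ≤
      K * meanEdges μ k N)
    (hm : Tendsto (meanEdges μ k) atTop (𝓝 ∞))
    (h2 : ∀ᶠ N : ℕ in atTop, ∫⁻ x, ((hullEdges (capPairs μ k N) x).card : ℝ≥0∞) *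
      (hullEdges (capPairs μ k N) x).card ∂(Measure.pi fun _ : Fin N => μ) ≤
      2 * meanEdges μ k N ^ 2) {η : ℝ} (hη : 0 < η) :
    ∀ᶠ N : ℕ in atTop, ∫⁻ x, ENNReal.ofReal (∑ e ∈ hullEdges (capPairs μ k N) x,
      signedCount (capPairs μ k N) x e ^ 2) ∂(Measure.pi fun _ : Fin N => μ) ≤
      ENNReal.ofReal η * meanEdges μ k N ^ 3 := by
  obtain ⟨L, hL0, hL⟩ : ∃ L : ℝ, 0 ≤ L ∧ Real.exp (-L) * K ^ 3 ≤ η / 2 := by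
    have h : Tendsto (fun L : ℝ => Real.exp (-L) * K ^ 3) atTop (𝓝 (0 * K ^ 3)) :=
      (Real.tendsto_exp_neg_atTop_nhds_zero).mul_const _
    rw [zero_mul] at h
    obtain ⟨L, hL⟩ := ((eventually_ge_atTop 0).and (h.eventually_le_const (half_pos hη))).exists
    exact ⟨L, hL⟩
  set B : ℝ := 8 + 8 * (L + 3 * k) * K ^ 2 with hB
  have hB0 : 0 ≤ B := by positivity
  have hη2 : ENNReal.ofReal (η / 2) ≠ 0 := by simpa using hη
  have hbig : ∀ᶠ N : ℕ in atTop, ENNReal.ofReal B / ENNReal.ofReal (η / 2) <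
      meanEdges μ k N :=
    hm.eventually_const_lt (ENNReal.div_lt_top ENNReal.ofReal_ne_top hη2)
  filter_upwards [hK, hbig, h2, eventually_ge_atTop 12] with N hKN hbigN h2N hN
  refine (lintegral_signedCount_sq_le hline hN hL0).trans ?_
  set m := meanEdges μ k N with hmdef
  set I := (μ.prod μ) (capPairs μ k N) with hI
  have h4 : ENNReal.ofReal B ≤ ENNReal.ofReal (η / 2) * m := by
    rw [mul_comm _ m]
    exact (ENNReal.div_le_iff hη2 ENNReal.ofReal_ne_top).1 hbigN.le
  have hNr : (0 : ℝ) < N := by exact_mod_cast (by omega : 0 < N)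
  have hτ : (N : ℝ≥0∞) * ENNReal.ofReal ((L + 3 * k) / N) = ENNReal.ofReal (L + 3 * k) := by
    rw [← ENNReal.ofReal_natCast, ← ENNReal.ofReal_mul hNr.le]
    congr 1
    field_simp
  have hBe : ENNReal.ofReal B = 8 + 8 * ENNReal.ofReal (L + 3 * k) * K ^ 2 := by
    rw [hB, ENNReal.ofReal_add (by positivity) (by positivity), ENNReal.ofReal_mul (by positivity),
      ENNReal.ofReal_mul (by positivity), ENNReal.ofReal_pow (by positivity),
      ENNReal.ofReal_natCast, ENNReal.ofReal_ofNat]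
  have hKr : (K : ℝ≥0∞) = ENNReal.ofReal K := (ENNReal.ofReal_natCast K).symm
  calc _ ≤ 4 * (2 * m ^ 2) + N ^ 5 * (I ^ 2 * (8 * ENNReal.ofReal ((L + 3 * k) / N))) +
        N ^ 6 * (ENNReal.ofReal (Real.exp (-L)) * I ^ 3) := by gcongr
    _ = 8 * m ^ 2 + 8 * ((N : ℝ≥0∞) * ENNReal.ofReal ((L + 3 * k) / N)) * (N ^ 2 * I) ^ 2 +
        ENNReal.ofReal (Real.exp (-L)) * (N ^ 2 * I) ^ 3 := by ring
    _ ≤ 8 * m ^ 2 + 8 * ENNReal.ofReal (L + 3 * k) * (K * m) ^ 2 +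
        ENNReal.ofReal (Real.exp (-L)) * (K * m) ^ 3 := by
        rw [hτ]; gcongr
    _ = (8 + 8 * ENNReal.ofReal (L + 3 * k) * K ^ 2) * m ^ 2 +
        (ENNReal.ofReal (Real.exp (-L)) * K ^ 3) * m ^ 3 := by ring
    _ = ENNReal.ofReal B * m ^ 2 + ENNReal.ofReal (Real.exp (-L) * K ^ 3) * m ^ 3 := by
        rw [hBe, ENNReal.ofReal_mul (Real.exp_pos _).le, ENNReal.ofReal_pow (by positivity), hKr]
    _ ≤ (ENNReal.ofReal (η / 2) * m) * m ^ 2 + ENNReal.ofReal (η / 2) * m ^ 3 := by gcongr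
    _ = (ENNReal.ofReal (η / 2) + ENNReal.ofReal (η / 2)) * m ^ 3 := by ring
    _ = _ := by
        rw [← ENNReal.ofReal_add (by positivity) (by positivity)]; congr 2; ring

end SignSquares

section Blocking

theorem exists_blocking_of_signedCount {D : Set (Pt × Pt)} {N : ℕ} {x : Fin N → Pt}
    (hx : Function.Injective x) {m : ℝ} (hm : 16 ≤ m) (hY : m / 2 ≤ (hullEdges D x).card)
    (hZ : ∑ e ∈ hullEdges D x, signedCount D x e ^ 2 ≤ m ^ 3 / 128) :
    ∃ S : Finset (Sym2 Pt), (∀ e ∈ S, IsEdgeOf (Finset.image x Finset.univ) e) ∧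
      (S.card : ℝ) ≤ N - m / 16 ∧
      ∀ M, IsNCMatching (Finset.image x Finset.univ) M → ¬ Avoids M S := by
  classical
  set E := hullEdges D x with hE
  have hEpos : (0 : ℝ) < E.card := lt_of_lt_of_le (by linarith) hY
  obtain ⟨e₀, he₀, hZe⟩ : ∃ e₀ ∈ E, signedCount D x e₀ ^ 2 ≤ m ^ 2 / 64 := by
    by_contra! hcon
    have h := Finset.sum_lt_sum_of_nonempty (Finset.card_pos.1 (by exact_mod_cast hEpos)) hcon
    rw [Finset.sum_const, nsmul_eq_mul] at h
    nlinarith [sq_nonneg m]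
  have hZ' : signedCount D x e₀ ≤ m / 8 := by
    refine le_of_sq_le_sq ?_ (by linarith)
    linarith [hZe]
  set A := E.filter (fun f => Apart e₀ f) with hA
  set Q := A.filter fun f => Odd (Finset.univ.filter fun k => 0 < cr (x e₀.1) (x f.1) (x k)).card
    with hQ
  have h1 : signedCount D x e₀ = A.card - 2 * Q.card := by
    have e1 : ∀ f ∈ A, leftParity x e₀.1 f.1 = 1 - 2 * if
        Odd (Finset.univ.filter fun k => 0 < cr (x e₀.1) (x f.1) (x k)).card then 1 else 0 := by
      intro f _
      rw [leftParity_eq]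
      split_ifs with h
      · rw [h.neg_one_pow]; norm_num
      · rw [(Nat.not_odd_iff_even.1 h).neg_one_pow]; norm_num
    have e2 : signedCount D x e₀ = ∑ f ∈ A, leftParity x e₀.1 f.1 := rfl
    rw [e2, Finset.sum_congr rfl e1, Finset.sum_sub_distrib, ← Finset.mul_sum,
      hQ, Finset.card_filter]
    simp [hA]
  have h2 : (E.card : ℝ) ≤ A.card + 4 := by
    have := Finset.card_filter_add_card_filter_not (s := E) (fun f => Apart e₀ f)
    have h4 := card_not_apart_le (D := D) x e₀
    rw [← hE] at h4
    rw [← hA] at this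
    exact_mod_cast (by omega : E.card ≤ A.card + 4)
  obtain ⟨S, hS1, hS2, hS3⟩ := exists_blocking x hx E
    (fun e he => ⟨(mem_hullEdges.1 he).1, (mem_hullEdges.1 he).2.2⟩) e₀ he₀ Q
    ((Finset.filter_subset _ _).trans (Finset.filter_subset _ _))
    (fun e he => by
      obtain ⟨heA, ho⟩ := Finset.mem_filter.1 he
      obtain ⟨a, b, c, d⟩ := (Finset.mem_filter.1 heA).2
      exact ⟨a, b, c, d, ho⟩)
  refine ⟨S, hS1, ?_, hS3⟩
  have h3 : (S.card : ℝ) + Q.card + 1 ≤ N := by exact_mod_cast hS2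
  linarith

theorem measurable_sum_signedCount_sq {D : Set (Pt × Pt)} (hD : MeasurableSet D) {N : ℕ} :
    Measurable fun x : Fin N → Pt => ∑ e ∈ hullEdges D x, signedCount D x e ^ 2 := by
  classical
  have h : ∀ x : Fin N → Pt, ∑ e ∈ hullEdges D x, signedCount D x e ^ 2 =
      ∑ e, {x : Fin N → Pt | IsHullEdge D x e}.indicator (fun x => (∑ f ∈ Finset.univ.filter
        (fun f => Apart e f), {x : Fin N → Pt | IsHullEdge D x f}.indicator
          (fun x => leftParity x e.1 f.1) x) ^ 2) x := by
    intro x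
    rw [hullEdges, Finset.sum_filter]
    refine Finset.sum_congr rfl fun e _ => ?_
    simp only [indicator, mem_ofPred_eq, signedCount]
    refine if_congr Iff.rfl ?_ rfl
    rw [hullEdges, Finset.filter_filter, Finset.sum_filter, Finset.sum_filter]
    congr 1
    refine Finset.sum_congr rfl fun f _ => ?_
    by_cases h1 : IsHullEdge D x f <;> by_cases h2 : Apart e f <;> simp [h1, h2]
  simp_rw [h]
  refine Finset.measurable_fun_sum _ fun e _ => Measurable.indicator ?_
    (measurableSet_isHullEdge hD e)
  exact (Finset.measurable_fun_sum _ fun f _ => Measurable.indicator (by fun_prop)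
    (measurableSet_isHullEdge hD f)).pow_const 2

variable {μ : Measure Pt} [IsProbabilityMeasure μ]

theorem ae_injective (hμ : ∀ p : Pt, μ {p} = 0) (N : ℕ) :
    ∀ᵐ x ∂(Measure.pi fun _ : Fin N => μ), Function.Injective x := by
  have h : ∀ i j : Fin N, i ≠ j → ∀ᵐ x ∂(Measure.pi fun _ : Fin N => μ), x i ≠ x j := by
    intro i j hij
    have hi : Function.Injective (![i, j] : Fin 2 → Fin N) := by
      intro a b; fin_cases a <;> fin_cases b <;> simp [hij, hij.symm]
    have hA : MeasurableSet {z : Fin 2 → Pt | z 0 = z 1} :=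
      measurableSet_eq_fun (by fun_prop) (by fun_prop)
    have h := measure_sample_eq_of_measurePreserving μ (measurePreserving_vec2 μ) _ hi hA
      (B := univ) MeasurableSet.univ
    simp only [mem_univ, ofPred_true, measure_univ, one_pow, setLIntegral_one] at h
    rw [Measure.prod_apply ((measurePreserving_vec2 μ).measurable hA)] at h
    rw [ae_iff]
    have e : ∀ p : Pt, Prod.mk p ⁻¹' ((fun p : Pt × Pt => (![p.1, p.2] : Fin 2 → Pt)) ⁻¹'
        {z : Fin 2 → Pt | z 0 = z 1}) = {p} := fun p => by ext; simp [eq_comm]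
    simp only [e, hμ, lintegral_zero] at h
    rw [← h]
    congr 1
    ext x; simp
  have h' : ∀ᵐ x ∂(Measure.pi fun _ : Fin N => μ), ∀ i j : Fin N, i ≠ j → x i ≠ x j :=
    ae_all_iff.2 fun i => ae_all_iff.2 fun j => by
      by_cases hij : i = j
      · simp [hij]
      · filter_upwards [h i j hij] with x hx _ using hx
  filter_upwards [h'] with x hx i j hxy
  by_contra hij
  exact hx i j hij hxy

theorem measure_card_hullEdges_lt_le {k N : ℕ} {η : ℝ} (hη : 0 < η)
    (hm0 : 0 < (meanEdges μ k N).toReal)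
    (h2 : ∫⁻ x, ((hullEdges (capPairs μ k N) x).card : ℝ≥0∞) *
      (hullEdges (capPairs μ k N) x).card ∂(Measure.pi fun _ : Fin N => μ) ≤
      ENNReal.ofReal (1 + η) * meanEdges μ k N ^ 2) :
    (Measure.pi fun _ : Fin N => μ)
      {x | ((hullEdges (capPairs μ k N) x).card : ℝ) < (meanEdges μ k N).toReal / 2} ≤
      ENNReal.ofReal (4 * η) := by
  set P := Measure.pi fun _ : Fin N => μ with hP
  set D := capPairs μ k N with hDdef
  have hD : MeasurableSet D := measurableSet_capPairs μ k N
  set Y : (Fin N → Pt) → ℝ := fun x => (hullEdges D x).card with hY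
  have hYm : Measurable Y := by
    have := (measurable_card_hullEdges (N := N) hD).ennreal_toReal
    simpa using this
  have hYL : MemLp Y 2 P := by
    refine MemLp.of_bound hYm.aestronglyMeasurable
      ((Finset.univ : Finset (Fin N × Fin N)).card : ℝ) (Eventually.of_forall fun x => ?_)
    rw [Real.norm_eq_abs, abs_of_nonneg (Nat.cast_nonneg _)]
    exact Nat.cast_le.2 (Finset.card_le_card (Finset.subset_univ _))
  have hEY : ∫ x, Y x ∂P = (meanEdges μ k N).toReal := by
    rw [integral_eq_lintegral_of_nonneg_ae (Eventually.of_forall fun x => Nat.cast_nonneg _)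
      hYm.aestronglyMeasurable]
    simp only [ENNReal.ofReal_natCast]
    rfl
  set m := (meanEdges μ k N).toReal with hm
  have hEY2 : ∫ x, (Y ^ 2) x ∂P ≤ (1 + η) * m ^ 2 := by
    rw [integral_eq_lintegral_of_nonneg_ae (f := Y ^ 2)
      (Eventually.of_forall fun x => sq_nonneg (Y x)) (hYm.pow_const 2).aestronglyMeasurable]
    have e : ∀ x, ENNReal.ofReal ((Y ^ 2) x) = ((hullEdges D x).card : ℝ≥0∞) *
        (hullEdges D x).card := fun x => by
      rw [Pi.pow_apply, ENNReal.ofReal_pow (Nat.cast_nonneg _), ENNReal.ofReal_natCast, sq]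
    simp only [e]
    have h3 := ENNReal.toReal_mono (ENNReal.mul_ne_top ENNReal.ofReal_ne_top
      (ENNReal.pow_ne_top (meanEdges_ne_top k N))) h2
    rwa [ENNReal.toReal_mul, ENNReal.toReal_pow, ENNReal.toReal_ofReal (by positivity)] at h3
  have hcheb := ProbabilityTheory.meas_ge_le_variance_div_sq hYL (half_pos hm0)
  rw [hEY] at hcheb
  refine (measure_mono fun x hx => ?_).trans (hcheb.trans (ENNReal.ofReal_le_ofReal ?_))
  · rw [mem_ofPred_eq] at hx ⊢
    rw [abs_sub_comm]
    exact le_trans (by linarith) (le_abs_self _)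
  · rw [ProbabilityTheory.variance_eq_sub hYL, hEY, div_le_iff₀ (by positivity)]
    nlinarith

theorem tendsto_measure_blocking
    (hline : ∀ p q : Pt, p ≠ q → μ {w | cr p q w = 0} = 0)
    (hov : ∀ (k : ℕ) (δ : ℝ), 0 < δ → ∃ G : ℕ, ∀ N : ℕ, 0 < N → ∀ p ∈ capPairs μ k N, ∃ Λ : Set Pt,
      μ Λ ≤ (G : ℝ≥0∞) / N ∧ ∀ p' ∈ capPairs μ k N,
        ENNReal.ofReal (δ / N) < μ ({w | cr p.1 p.2 w ≤ 0} ∩ {w | cr p'.1 p'.2 w ≤ 0}) →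
          p'.1 ∈ Λ ∧ p'.2 ∈ Λ) {k K : ℕ}
    (hK : ∀ᶠ N : ℕ in atTop, (N : ℝ≥0∞) ^ 2 * (μ.prod μ) (capPairs μ k N) ≤
      K * meanEdges μ k N)
    (hm : Tendsto (meanEdges μ k) atTop (𝓝 ∞)) :
    Tendsto (fun N : ℕ => (Measure.pi fun _ : Fin N => μ)
      {x | ∃ S : Finset (Sym2 Pt), (∀ e ∈ S, IsEdgeOf (Finset.image x Finset.univ) e) ∧
        (S.card : ℝ) ≤ N - (meanEdges μ k N).toReal / 16 ∧
        ∀ M, IsNCMatching (Finset.image x Finset.univ) M → ¬ Avoids M S}) atTop (𝓝 1) := by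
  have hpt : ∀ p : Pt, μ {p} = 0 := fun p => by
    refine measure_mono_null ?_ (hline p (p + (1, 0)) (by simp))
    rintro w rfl
    exact cr_self_left _ _
  have key : ∀ ε : ℝ, 0 < ε → ∀ᶠ N : ℕ in atTop, (1 : ℝ≥0∞) ≤ (Measure.pi fun _ : Fin N => μ)
      {x | ∃ S : Finset (Sym2 Pt), (∀ e ∈ S, IsEdgeOf (Finset.image x Finset.univ) e) ∧
        (S.card : ℝ) ≤ N - (meanEdges μ k N).toReal / 16 ∧
        ∀ M, IsNCMatching (Finset.image x Finset.univ) M → ¬ Avoids M S} + ENNReal.ofReal ε := by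
    intro ε hε
    have h2 := eventually_second_moment_le hov hK hm (η := ε / 8) (by positivity)
    have h2' : ∀ᶠ N : ℕ in atTop, ∫⁻ x, ((hullEdges (capPairs μ k N) x).card : ℝ≥0∞) *
        (hullEdges (capPairs μ k N) x).card ∂(Measure.pi fun _ : Fin N => μ) ≤
        2 * meanEdges μ k N ^ 2 := by
      filter_upwards [eventually_second_moment_le hov hK hm (η := 1) one_pos] with N h
      rwa [one_add_one_eq_two, ENNReal.ofReal_ofNat] at h
    have h3 := eventually_lintegral_signedCount_sq_le hline hK hm h2' (η := ε / 256) (by positivity)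
    have hbig : ∀ᶠ N : ℕ in atTop, ENNReal.ofReal 16 < meanEdges μ k N :=
      hm.eventually_const_lt ENNReal.ofReal_lt_top
    filter_upwards [h2, h3, hbig] with N h2N h3N hbN
    set P := Measure.pi fun _ : Fin N => μ with hP
    set D := capPairs μ k N with hDdef
    set m := (meanEdges μ k N).toReal with hmdef
    have hm16 : 16 ≤ m := (ENNReal.ofReal_le_iff_le_toReal (meanEdges_ne_top k N)).1 hbN.le
    have hA := measure_card_hullEdges_lt_le (η := ε / 8) (by positivity)
      (by linarith) h2N
    have hB : P {x | m ^ 3 / 128 < ∑ e ∈ hullEdges D x, signedCount D x e ^ 2} ≤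
        ENNReal.ofReal (ε / 2) := by
      have hpos : ENNReal.ofReal (m ^ 3 / 128) ≠ 0 := by
        simpa using (by positivity : 0 < m ^ 3 / 128)
      have hmk := mul_meas_ge_le_lintegral (μ := P) (measurable_sum_signedCount_sq (N := N)
        (measurableSet_capPairs μ k N)).ennreal_ofReal (ENNReal.ofReal (m ^ 3 / 128))
      have hm3 : meanEdges μ k N ^ 3 = ENNReal.ofReal (m ^ 3) := by
        rw [ENNReal.ofReal_pow (by linarith), hmdef, ENNReal.ofReal_toReal (meanEdges_ne_top k N)]
      have h4 := hmk.trans h3N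
      rw [hm3, ← ENNReal.ofReal_mul (by positivity)] at h4
      have e : ε / 256 * m ^ 3 = m ^ 3 / 128 * (ε / 2) := by ring
      rw [e, ENNReal.ofReal_mul (by positivity)] at h4
      refine (measure_mono ?_).trans
        ((ENNReal.mul_le_mul_iff_right hpos ENNReal.ofReal_ne_top).1 h4)
      intro x hx
      exact ENNReal.ofReal_le_ofReal (le_of_lt hx)
    have hsub : (univ : Set (Fin N → Pt)) ⊆ ({x | ∃ S : Finset (Sym2 Pt),
        (∀ e ∈ S, IsEdgeOf (Finset.image x Finset.univ) e) ∧ (S.card : ℝ) ≤ N - m / 16 ∧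
        ∀ M, IsNCMatching (Finset.image x Finset.univ) M → ¬ Avoids M S} ∪
        {x | ((hullEdges D x).card : ℝ) < m / 2}) ∪
        ({x | m ^ 3 / 128 < ∑ e ∈ hullEdges D x, signedCount D x e ^ 2} ∪
        {x | ¬ Function.Injective x}) := by
      intro x _
      by_contra hx
      simp only [mem_union, not_or, mem_ofPred_eq, not_lt, not_not] at hx
      exact hx.1.1 (exists_blocking_of_signedCount hx.2.2 hm16 hx.1.2 hx.2.1)
    calc (1 : ℝ≥0∞) = P univ := measure_univ.symm
      _ ≤ _ := measure_mono hsub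
      _ ≤ _ := measure_union_le _ _
      _ ≤ _ := add_le_add (measure_union_le _ _) (measure_union_le _ _)
      _ ≤ (P _ + ENNReal.ofReal (4 * (ε / 8))) + (ENNReal.ofReal (ε / 2) + 0) := by
          gcongr
          exact (ae_iff.1 (ae_injective hpt N)).le
      _ = _ := by
          rw [add_zero, add_assoc, ← ENNReal.ofReal_add (by positivity) (by positivity)]
          congr 2; ring
  refine tendsto_order.2 ⟨fun a ha => ?_, fun a ha => Eventually.of_forall fun N =>
    prob_le_one.trans_lt ha⟩
  have hat : a ≠ ∞ := (ha.trans ENNReal.one_lt_top).ne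
  have hpos : 0 < (1 - a).toReal := ENNReal.toReal_pos (tsub_pos_of_lt ha).ne' (by simp)
  filter_upwards [key _ (half_pos hpos)] with N hN
  by_contra! hcon
  have h1 : (1 : ℝ≥0∞) ≤ a + ENNReal.ofReal ((1 - a).toReal / 2) := hN.trans (by gcongr)
  have h2 : ENNReal.ofReal ((1 - a).toReal / 2) < 1 - a := by
    rw [ENNReal.ofReal_lt_iff_lt_toReal (by positivity) (by simp)]
    linarith
  have h3 := ENNReal.add_lt_add_left hat h2
  rw [add_tsub_cancel_of_le ha.le] at h3
  exact absurd h1 (not_le.2 h3)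

end Blocking

section Uniform

variable {Γ : Set Pt}

theorem volume_line_eq_zero {p q : Pt} (h : p ≠ q) : volume {w | cr p q w = 0} = 0 := by
  let L : Pt →ₗ[ℝ] ℝ := (q.1 - p.1) • LinearMap.snd ℝ ℝ ℝ - (q.2 - p.2) • LinearMap.fst ℝ ℝ ℝ
  have hL : LinearMap.ker L ≠ ⊤ := by
    intro hk
    have h1 : (0, 1) ∈ LinearMap.ker L := hk ▸ Submodule.mem_top
    have h2 : (1, 0) ∈ LinearMap.ker L := hk ▸ Submodule.mem_top
    simp [L, sub_eq_zero] at h1 h2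
    exact h (Prod.ext h1.symm h2)
  have e : {w | cr p q w = 0} = (fun w => w - p) ⁻¹' (LinearMap.ker L : Set Pt) := by
    ext w
    simp [L, cr]
  simp_rw [e, sub_eq_add_neg, measure_preimage_add_right]
  exact Measure.addHaar_submodule volume _ hL

theorem volume_ne_zero (hi : (interior Γ).Nonempty) : volume Γ ≠ 0 :=
  fun h => (isOpen_interior.measure_pos volume hi).ne' (measure_mono_null interior_subset h)

theorem isProbabilityMeasure_unifOn (hc : IsCompact Γ) (hi : (interior Γ).Nonempty) :
    IsProbabilityMeasure (unifOn Γ) := by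
  refine ⟨?_⟩
  rw [unifOn, Measure.smul_apply, Measure.restrict_apply_univ, smul_eq_mul]
  exact ENNReal.inv_mul_cancel (volume_ne_zero hi) hc.measure_lt_top.ne

theorem unifOn_apply (hc : IsCompact Γ) (S : Set Pt) :
    unifOn Γ S = (volume Γ)⁻¹ * volume (S ∩ Γ) := by
  rw [unifOn, Measure.smul_apply, Measure.restrict_apply' hc.measurableSet, smul_eq_mul]

theorem unifOn_line_eq_zero (hc : IsCompact Γ) {p q : Pt} (h : p ≠ q) :
    unifOn Γ {w | cr p q w = 0} = 0 := by
  rw [unifOn_apply hc, measure_mono_null inter_subset_left (volume_line_eq_zero h), mul_zero]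

theorem image_homothety_eq (w : Pt) {r : ℝ} (hr : r ≠ 0) (S : Set Pt) :
    AffineMap.homothety w r '' S = {q | w + r⁻¹ • (q - w) ∈ S} := by
  ext q
  simp only [mem_image, mem_ofPred_eq, AffineMap.homothety_apply, vsub_eq_sub, vadd_eq_add]
  constructor
  · rintro ⟨p, hp, rfl⟩
    simpa [smul_smul, hr] using hp
  · intro h
    exact ⟨_, h, by simp [smul_smul, hr]⟩

theorem measurableSet_image_homothety (w : Pt) {r : ℝ} (hr : r ≠ 0) {S : Set Pt}
    (hS : MeasurableSet S) : MeasurableSet (AffineMap.homothety w r '' S) := by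
  rw [image_homothety_eq w hr]
  exact (by fun_prop : Measurable fun q : Pt => w + r⁻¹ • (q - w)) hS

theorem volume_image_homothety (w : Pt) {r : ℝ} (hr : 0 ≤ r) (S : Set Pt) :
    volume (AffineMap.homothety w r '' S) = ENNReal.ofReal (r ^ 2) * volume S := by
  rw [Measure.addHaar_image_homothety]
  simp [abs_of_nonneg hr]

/-- Disjoint homothetic copies of a subset of a convex set which is far from a given point. -/
theorem sum_pow_mul_volume_le {S K : Set Pt} (hS : MeasurableSet S) (hSK : S ⊆ K)
    (hK : Convex ℝ K) {w : Pt} (hw : w ∈ K) {g : Pt → ℝ}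
    (hg : ∀ p q (s : ℝ), g (p + s • (q - p)) = g p + s * (g q - g p)) {A B t : ℝ} (hA : 0 < A)
    (hSA : ∀ p ∈ S, A ≤ g p - g w ∧ g p - g w ≤ B) (ht0 : 0 < t) (ht1 : t ≤ 1) (htB : t * B < A)
    (J : ℕ) : (∑ i ∈ Finset.range J, ENNReal.ofReal (t ^ (2 * i))) * volume S ≤ volume K := by
  have hmem : ∀ i, ∀ q ∈ AffineMap.homothety w (t ^ i) '' S,
      q ∈ K ∧ t ^ i * A ≤ g q - g w ∧ g q - g w ≤ t ^ i * B := by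
    rintro i q ⟨p, hp, rfl⟩
    have e : AffineMap.homothety w (t ^ i) p = w + (t ^ i) • (p - w) := by
      simp [AffineMap.homothety_apply, add_comm]
    rw [e, hg]
    have h0 : 0 < t ^ i := pow_pos ht0 i
    refine ⟨hK.add_smul_sub_mem hw (hSK hp) ⟨h0.le, pow_le_one₀ ht0.le ht1⟩, ?_, ?_⟩
    · rw [add_sub_cancel_left]; exact mul_le_mul_of_nonneg_left (hSA p hp).1 h0.le
    · rw [add_sub_cancel_left]; exact mul_le_mul_of_nonneg_left (hSA p hp).2 h0.le
  have hdisj : ∀ i j, i < j → Disjoint (AffineMap.homothety w (t ^ i) '' S)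
      (AffineMap.homothety w (t ^ j) '' S) := by
    intro i j hij
    refine Set.disjoint_left.2 fun q hi hj => ?_
    have h1 := (hmem i q hi).2.1
    have h2 := (hmem j q hj).2.2
    have h3 : t ^ j ≤ t ^ (i + 1) := pow_le_pow_of_le_one ht0.le ht1 hij
    have hB : 0 < B := by
      obtain ⟨p, hp, -⟩ := hi
      linarith [(hSA p hp).1, (hSA p hp).2]
    have h4 : t ^ (i + 1) * B < t ^ i * A := by
      rw [pow_succ, mul_assoc]; exact mul_lt_mul_of_pos_left htB (pow_pos ht0 i)
    have h5 : t ^ j * B ≤ t ^ (i + 1) * B := mul_le_mul_of_nonneg_right h3 hB.le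
    linarith
  calc _ = ∑ i ∈ Finset.range J, volume (AffineMap.homothety w (t ^ i) '' S) := by
        rw [Finset.sum_mul]
        refine Finset.sum_congr rfl fun i _ => ?_
        rw [volume_image_homothety w (pow_pos ht0 i).le, ← pow_mul, mul_comm i 2]
    _ = volume (⋃ i ∈ Finset.range J, AffineMap.homothety w (t ^ i) '' S) := by
        refine (measure_biUnion_finset ?_ fun i _ =>
          measurableSet_image_homothety w (pow_pos ht0 i).ne' hS).symm
        intro i _ j _ hij
        rcases lt_or_gt_of_ne hij with h | h
        · exact hdisj i j h
        · exact (hdisj j i h).symm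
    _ ≤ _ := measure_mono (iUnion₂_subset fun i _ q hq => (hmem i q hq).1)

theorem lintegral_comp_add_mul {f : ℝ → ℝ≥0∞} (hf : Measurable f) {c : ℝ} (hc : c ≠ 0) (d : ℝ) :
    ENNReal.ofReal |c| * ∫⁻ a, f (d + a * c) = ∫⁻ s, f s := by
  calc ENNReal.ofReal |c| * ∫⁻ a, f (d + a * c)
      = ENNReal.ofReal |c| * ∫⁻ s, f (d + s) ∂(Measure.map (fun a => a * c) volume) := by
        rw [lintegral_map (by fun_prop) (by fun_prop)]
    _ = ∫⁻ s, f (d + s) ∂(ENNReal.ofReal |c| • Measure.map (fun a => a * c) volume) := by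
        rw [lintegral_smul_measure, smul_eq_mul]
    _ = ∫⁻ s, f (d + s) := by rw [Real.smul_map_volume_mul_right hc]
    _ = _ := lintegral_add_left_eq_self f d

/-- The double integral over `x`, `y` in coordinates adapted to the line through `x` and `y`:
slope, intercept and the two abscissas. -/
theorem lintegral_slope_coordinates {F : Pt → Pt → ℝ≥0∞} (hF : Measurable (Function.uncurry F)) :
    ∫⁻ x, ∫⁻ y, F x y = ∫⁻ a : ℝ, ∫⁻ b : ℝ, ∫⁻ t₁ : ℝ, ∫⁻ t₂ : ℝ,
      ENNReal.ofReal |t₁ - t₂| * F (t₁, b + a * t₁) (t₂, b + a * t₂) := by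
  have hF' : Measurable fun p : Pt × Pt => F p.1 p.2 := hF
  have hF2 : ∀ {β : Type} [MeasurableSpace β] {u v : β → Pt}, Measurable u → Measurable v →
      Measurable fun z => F (u z) (v z) := fun hu hv => hF'.comp (hu.prodMk hv)
  have h1 : ∀ (t₁ s₁ : ℝ), ∫⁻ y, F (t₁, s₁) y =
      ∫⁻ a : ℝ, ∫⁻ t₂ : ℝ, ENNReal.ofReal |t₁ - t₂| * F (t₁, s₁) (t₂, s₁ + a * (t₂ - t₁)) := by
    intro t₁ s₁
    rw [Measure.volume_eq_prod, lintegral_prod _ (hF2 (by fun_prop) (by fun_prop)).aemeasurable]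
    refine Eq.trans ?_ (lintegral_lintegral_swap (Measurable.aemeasurable ?_))
    · have hne : ∀ᵐ t₂ : ℝ, t₂ ≠ t₁ := by simp [ae_iff]
      refine lintegral_congr_ae ?_
      filter_upwards [hne] with t₂ ht
      rw [lintegral_const_mul _ (hF2 (by fun_prop) (by fun_prop)), abs_sub_comm,
        lintegral_comp_add_mul (f := fun s => F (t₁, s₁) (t₂, s)) (hF2 (by fun_prop) (by fun_prop))
          (sub_ne_zero.2 ht)]
    · exact Measurable.mul (by fun_prop) (hF2 (by fun_prop) (by fun_prop))
  have hm : Measurable fun z : ℝ × ℝ × ℝ × ℝ => ENNReal.ofReal |z.1 - z.2.2.2| *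
      F (z.1, z.2.2.1) (z.2.2.2, z.2.2.1 + z.2.1 * (z.2.2.2 - z.1)) :=
    Measurable.mul (by fun_prop) (hF2 (by fun_prop) (by fun_prop))
  have hm3 : ∀ {β : Type} [MeasurableSpace β] {t s a r : β → ℝ}, Measurable t → Measurable s →
      Measurable a → Measurable r → Measurable fun z => ENNReal.ofReal |t z - r z| *
        F (t z, s z) (r z, s z + a z * (r z - t z)) := fun h1 h2 h3 h4 =>
    hm.comp (h1.prodMk (h3.prodMk (h2.prodMk h4)))
  calc ∫⁻ x, ∫⁻ y, F x y = ∫⁻ t₁ : ℝ, ∫⁻ s₁ : ℝ, ∫⁻ y, F (t₁, s₁) y := by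
        conv_lhs => rw [Measure.volume_eq_prod]
        exact lintegral_prod _ (hF.lintegral_prod_right').aemeasurable
    _ = ∫⁻ t₁ : ℝ, ∫⁻ s₁ : ℝ, ∫⁻ a : ℝ, ∫⁻ t₂ : ℝ,
          ENNReal.ofReal |t₁ - t₂| * F (t₁, s₁) (t₂, s₁ + a * (t₂ - t₁)) := by
        simp_rw [h1]
    _ = ∫⁻ t₁ : ℝ, ∫⁻ a : ℝ, ∫⁻ s₁ : ℝ, ∫⁻ t₂ : ℝ,
          ENNReal.ofReal |t₁ - t₂| * F (t₁, s₁) (t₂, s₁ + a * (t₂ - t₁)) := by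
        refine lintegral_congr fun t₁ => lintegral_lintegral_swap (Measurable.aemeasurable ?_)
        exact Measurable.lintegral_prod_right' (f := fun z : (ℝ × ℝ) × ℝ =>
          ENNReal.ofReal |t₁ - z.2| * F (t₁, z.1.1) (z.2, z.1.1 + z.1.2 * (z.2 - t₁)))
          (hm3 (by fun_prop) (by fun_prop) (by fun_prop) (by fun_prop))
    _ = ∫⁻ t₁ : ℝ, ∫⁻ a : ℝ, ∫⁻ b : ℝ, ∫⁻ t₂ : ℝ,
          ENNReal.ofReal |t₁ - t₂| * F (t₁, b + a * t₁) (t₂, b + a * t₂) := by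
        refine lintegral_congr fun t₁ => lintegral_congr fun a => ?_
        rw [← lintegral_add_right_eq_self _ (a * t₁)]
        refine lintegral_congr fun b => lintegral_congr fun t₂ => ?_
        rw [show b + a * t₁ + a * (t₂ - t₁) = b + a * t₂ by ring]
    _ = ∫⁻ a : ℝ, ∫⁻ t₁ : ℝ, ∫⁻ b : ℝ, ∫⁻ t₂ : ℝ,
          ENNReal.ofReal |t₁ - t₂| * F (t₁, b + a * t₁) (t₂, b + a * t₂) := by
        refine lintegral_lintegral_swap (Measurable.aemeasurable ?_)
        refine Measurable.lintegral_prod_right' (f := fun z : (ℝ × ℝ) × ℝ => ∫⁻ t₂ : ℝ,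
          ENNReal.ofReal |z.1.1 - t₂| * F (z.1.1, z.2 + z.1.2 * z.1.1) (t₂, z.2 + z.1.2 * t₂)) ?_
        refine Measurable.lintegral_prod_right' (f := fun z : ((ℝ × ℝ) × ℝ) × ℝ =>
          ENNReal.ofReal |z.1.1.1 - z.2| *
            F (z.1.1.1, z.1.2 + z.1.1.2 * z.1.1.1) (z.2, z.1.2 + z.1.1.2 * z.2)) ?_
        exact Measurable.mul (by fun_prop) (hF2 (by fun_prop) (by fun_prop))
    _ = _ := by
        refine lintegral_congr fun a => lintegral_lintegral_swap (Measurable.aemeasurable ?_)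
        refine Measurable.lintegral_prod_right' (f := fun z : (ℝ × ℝ) × ℝ =>
          ENNReal.ofReal |z.1.1 - z.2| *
            F (z.1.1, z.1.2 + a * z.1.1) (z.2, z.1.2 + a * z.2)) ?_
        exact Measurable.mul (by fun_prop) (hF2 (by fun_prop) (by fun_prop))

end Uniform

section Overlap

variable {Γ : Set Pt}

theorem cr_add_smul_sub (u v p q : Pt) (s : ℝ) :
    cr u v (p + s • (q - p)) = cr u v p + s * (cr u v q - cr u v p) := by
  simp only [cr, Prod.fst_add, Prod.snd_add, Prod.smul_fst, Prod.smul_snd, Prod.fst_sub,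
    Prod.snd_sub, smul_eq_mul]
  ring

theorem convex_cr_nonpos (u v : Pt) : Convex ℝ {w | cr u v w ≤ 0} := by
  rw [convex_iff_add_mem]
  intro p hp q hq a b ha hb hab
  have e : a • p + b • q = p + b • (q - p) := by
    rw [← eq_sub_iff_add_eq] at hab
    rw [hab, sub_smul, smul_sub, one_smul]; abel
  simp only [mem_ofPred_eq] at hp hq ⊢
  rw [e, cr_add_smul_sub]
  nlinarith

theorem measurable_cr_right (u v : Pt) : Measurable (cr u v) := by
  unfold cr; fun_prop

theorem measurableSet_cr_nonpos (u v : Pt) : MeasurableSet {w | cr u v w ≤ 0} :=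
  measurableSet_le (measurable_cr_right u v) measurable_const

theorem unifOn_compl_self (hc : IsCompact Γ) : unifOn Γ Γᶜ = 0 := by
  rw [unifOn_apply hc, compl_inter_self, measure_empty, mul_zero]

/-- A convex set which contains a point at depth more than `4 J η` below the line `g = 0` is much
larger than any part of it on which `0 ≤ g ≤ η`. -/
theorem mul_volume_le_of_deep_point {S K : Set Pt} (hS : MeasurableSet S) (hSK : S ⊆ K)
    (hK : Convex ℝ K) {g : Pt → ℝ} (hg : ∀ p q (s : ℝ), g (p + s • (q - p)) = g p + s * (g q - g p))
    {J : ℕ} {η : ℝ} (hη : 0 ≤ η) (hgS : ∀ p ∈ S, 0 ≤ g p ∧ g p ≤ η) {w₀ : Pt} (hw₀ : w₀ ∈ K)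
    (hdeep : g w₀ < -(4 * J * η)) : (J : ℝ≥0∞) * ENNReal.ofReal (1 / 2) * volume S ≤ volume K := by
  have hJ0 : (0 : ℝ) ≤ J := J.cast_nonneg
  rcases J.eq_zero_or_pos with rfl | hJ
  · simp
  have hJ1 : (1 : ℝ) ≤ J := by exact_mod_cast hJ
  have hD : 0 < -g w₀ := by
    have : 0 ≤ 4 * J * η := by positivity
    linarith
  set t : ℝ := 1 - 1 / (4 * J + 1)
  have hpos : (0 : ℝ) < 4 * J + 1 := by linarith
  have ht : t = 4 * J / (4 * J + 1) := by simp only [t]; field_simp; ring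
  have ht1 : t ≤ 1 := by simp only [t]; linarith [one_div_pos.2 hpos]
  have ht0 : 0 < t := by rw [ht]; positivity
  have hpow : ∀ i < J, (1 / 2 : ℝ) ≤ t ^ (2 * i) := by
    intro i hi
    have hi' : (i : ℝ) ≤ J := by exact_mod_cast hi.le
    have hB := one_add_mul_le_pow (a := -(1 / (4 * (J : ℝ) + 1))) ?_ (2 * i)
    · rw [← sub_eq_add_neg] at hB
      refine le_trans ?_ hB
      push_cast
      have : 2 * (i : ℝ) * (1 / (4 * J + 1)) ≤ 1 / 2 := by
        rw [mul_one_div, div_le_div_iff₀ hpos two_pos]; linarith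
      linarith
    · have : 1 / (4 * (J : ℝ) + 1) ≤ 1 := by rw [div_le_one hpos]; linarith
      linarith
  have key := sum_pow_mul_volume_le hS hSK hK hw₀ hg hD (B := η + -g w₀)
    (fun w hw => by
      have := hgS w hw
      constructor <;> linarith) ht0 ht1
    (by rw [ht, div_mul_eq_mul_div, div_lt_iff₀ hpos]; linarith) J
  refine le_trans (mul_le_mul_left ?_ _) key
  calc (J : ℝ≥0∞) * ENNReal.ofReal (1 / 2)
      = ∑ i ∈ Finset.range J, ENNReal.ofReal (1 / 2) := by simp
    _ ≤ _ := Finset.sum_le_sum fun i hi =>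
        ENNReal.ofReal_le_ofReal (hpow i (Finset.mem_range.1 hi))

/-- A convex piece of `Γ` which meets a cap `{cr u v ≤ 0}` of height `η` and contains a point at
depth more than `4 J η` is much larger than its part in the cap. -/
theorem mul_unifOn_le_of_deep_point (hc : IsCompact Γ) (hΓ : Convex ℝ Γ) {J : ℕ} {u v u' v' w₀ : Pt}
    {η : ℝ} (hη : 0 ≤ η) (hmax : ∀ w ∈ Γ, -cr u v w ≤ η) (hw₀ : w₀ ∈ Γ)
    (hw₀' : cr u' v' w₀ ≤ 0) (hdeep : 4 * J * η < cr u v w₀) :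
    (J : ℝ≥0∞) * ENNReal.ofReal (1 / 2) * unifOn Γ ({w | cr u v w ≤ 0} ∩ {w | cr u' v' w ≤ 0})
      ≤ unifOn Γ {w | cr u' v' w ≤ 0} := by
  rw [unifOn_apply hc, unifOn_apply hc, mul_left_comm]
  refine mul_le_mul_right (mul_volume_le_of_deep_point
    (S := ({w | cr u v w ≤ 0} ∩ {w | cr u' v' w ≤ 0}) ∩ Γ) (K := {w | cr u' v' w ≤ 0} ∩ Γ)
    (g := fun w => -cr u v w) (w₀ := w₀) ?_ (fun w hw => ⟨hw.1.2, hw.2⟩) ((convex_cr_nonpos u' v').inter hΓ)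
    (fun p q s => by rw [cr_add_smul_sub]; ring) hη
    (fun w hw => ⟨neg_nonneg.2 hw.1.1, hmax w hw.2⟩) ⟨hw₀', hw₀⟩ (by linarith)) _
  exact ((measurableSet_cr_nonpos u v).inter (measurableSet_cr_nonpos u' v')).inter
    hc.measurableSet

/-- Lowering the base line of a cap by a bounded factor increases its area by a bounded factor. -/
theorem unifOn_deepened_cap_le (hc : IsCompact Γ) (hΓ : Convex ℝ Γ) {u v z : Pt} (hz : z ∈ Γ)
    {l : ℝ} (hl : 0 ≤ l) :
    unifOn Γ {w | cr u v w ≤ l * -cr u v z} ≤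
      ENNReal.ofReal ((1 + l) ^ 2) * unifOn Γ {w | cr u v w ≤ 0} := by
  have hl1 : 0 < 1 + l := by linarith
  have hsub : AffineMap.homothety z (1 + l)⁻¹ '' ({w | cr u v w ≤ l * -cr u v z} ∩ Γ) ⊆
      {w | cr u v w ≤ 0} ∩ Γ := by
    rintro _ ⟨w, ⟨hw, hwΓ⟩, rfl⟩
    have e : AffineMap.homothety z (1 + l)⁻¹ w = z + (1 + l)⁻¹ • (w - z) := by
      simp [AffineMap.homothety_apply, add_comm]
    rw [e]
    refine ⟨?_, hΓ.add_smul_sub_mem hz hwΓ ⟨by positivity, inv_le_one_of_one_le₀ (by linarith)⟩⟩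
    simp only [mem_ofPred_eq] at hw ⊢
    rw [cr_add_smul_sub]
    have : (1 + l)⁻¹ * (cr u v w - cr u v z) ≤ (1 + l)⁻¹ * ((1 + l) * -cr u v z) :=
      mul_le_mul_of_nonneg_left (by linarith) (by positivity)
    rw [inv_mul_cancel_left₀ hl1.ne'] at this
    linarith
  rw [unifOn_apply hc, unifOn_apply hc, mul_left_comm]
  refine mul_le_mul_right ?_ _
  have h1 := measure_mono (μ := volume) hsub
  rw [volume_image_homothety z (inv_nonneg.2 hl1.le)] at h1
  calc volume ({w | cr u v w ≤ l * -cr u v z} ∩ Γ)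
      = ENNReal.ofReal ((1 + l) ^ 2) * (ENNReal.ofReal ((1 + l)⁻¹ ^ 2) *
          volume ({w | cr u v w ≤ l * -cr u v z} ∩ Γ)) := by
        rw [← mul_assoc, ← ENNReal.ofReal_mul (by positivity), ← mul_pow, mul_inv_cancel₀ hl1.ne']
        simp
    _ ≤ _ := mul_le_mul_right h1 _

/-- Small caps which overlap a given small cap substantially have their base points in a set of
comparable measure. -/
theorem exists_overlap_region (hc : IsCompact Γ) (hΓ : Convex ℝ Γ) (hi : (interior Γ).Nonempty)
    (k : ℕ) {δ : ℝ} (hδ : 0 < δ) : ∃ G : ℕ, ∀ N : ℕ, 0 < N → ∀ p ∈ capPairs (unifOn Γ) k N,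
      ∃ Λ : Set Pt, unifOn Γ Λ ≤ (G : ℝ≥0∞) / N ∧ ∀ p' ∈ capPairs (unifOn Γ) k N,
        ENNReal.ofReal (δ / N) < unifOn Γ ({w | cr p.1 p.2 w ≤ 0} ∩ {w | cr p'.1 p'.2 w ≤ 0}) →
          p'.1 ∈ Λ ∧ p'.2 ∈ Λ := by
  obtain ⟨J, hJ⟩ := exists_nat_gt (2 * k / δ)
  refine ⟨(1 + 4 * J) ^ 2 * k, fun N hN p hp => ?_⟩
  obtain ⟨z, hz, hzmax⟩ := hc.exists_isMaxOn (hi.mono interior_subset)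
    (f := fun w => -cr p.1 p.2 w) (by simp only [cr]; fun_prop)
  have hmax : ∀ w ∈ Γ, -cr p.1 p.2 w ≤ -cr p.1 p.2 z := fun w hw => hzmax hw
  rcases lt_or_ge (-cr p.1 p.2 z) 0 with hneg | hη
  · refine ⟨∅, by simp, fun p' _ hov => ?_⟩
    rw [measure_mono_null (t := Γᶜ) (fun w hw hwΓ => ?_) (unifOn_compl_self hc)] at hov
    · exact absurd hov (not_lt.2 zero_le)
    · have h1 := hmax w hwΓ
      have h2 : cr p.1 p.2 w ≤ 0 := hw.1
      linarith
  refine ⟨Γᶜ ∪ {w | cr p.1 p.2 w ≤ (4 * J : ℝ) * -cr p.1 p.2 z}, ?_, fun p' hp' hov => ?_⟩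
  · calc _ ≤ unifOn Γ Γᶜ + unifOn Γ {w | cr p.1 p.2 w ≤ (4 * J : ℝ) * -cr p.1 p.2 z} :=
          measure_union_le _ _
      _ ≤ ENNReal.ofReal ((1 + 4 * J) ^ 2) * unifOn Γ {w | cr p.1 p.2 w ≤ 0} := by
          rw [unifOn_compl_self hc, zero_add]
          exact unifOn_deepened_cap_le hc hΓ hz (by positivity)
      _ ≤ ENNReal.ofReal ((1 + 4 * J) ^ 2) * (k / N) := mul_le_mul_right hp _
      _ = _ := by
          rw [show ((1 + 4 * (J : ℝ)) ^ 2) = (((1 + 4 * J) ^ 2 : ℕ) : ℝ) by push_cast; ring,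
            ENNReal.ofReal_natCast, ← mul_div_assoc, Nat.cast_mul]
  · have hk : unifOn Γ {w | cr p'.1 p'.2 w ≤ 0} ≤ (k : ℝ≥0∞) / N := hp'
    have main : ∀ w₀, cr p'.1 p'.2 w₀ ≤ 0 →
        w₀ ∈ Γᶜ ∪ {w | cr p.1 p.2 w ≤ (4 * J : ℝ) * -cr p.1 p.2 z} := by
      intro w₀ hw₀
      by_contra hcon
      simp only [mem_union, mem_compl_iff, not_or, not_not, mem_ofPred_eq, not_le] at hcon
      have h1 := (mul_unifOn_le_of_deep_point hc hΓ hη hmax hcon.1 hw₀ hcon.2).trans hk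
      have h2 : (J : ℝ≥0∞) * ENNReal.ofReal (1 / 2) * ENNReal.ofReal (δ / N) ≤ (k : ℝ≥0∞) / N :=
        (mul_le_mul_right hov.le _).trans h1
      have hN' : (0 : ℝ) < N := by exact_mod_cast hN
      rw [← ENNReal.ofReal_natCast, ← ENNReal.ofReal_natCast k, ← ENNReal.ofReal_natCast N,
        ← ENNReal.ofReal_div_of_pos hN', ← ENNReal.ofReal_mul (by positivity),
        ← ENNReal.ofReal_mul (by positivity), ENNReal.ofReal_le_ofReal_iff (by positivity),
        ← mul_div_assoc, div_le_div_iff_of_pos_right hN'] at h2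
      rw [div_lt_iff₀ hδ] at hJ
      linarith
    exact ⟨main _ (cr_self_left _ _).le, main _ (cr_self_right _ _).le⟩

end Overlap

section Doubling

variable {Γ : Set Pt}

theorem cr_homothety (z x y w : Pt) (r : ℝ) :
    cr (z + r • (x - z)) (z + r • (y - z)) w = r * (cr x y w - (1 - r) * cr x y z) := by
  simp only [cr, Prod.fst_add, Prod.snd_add, Prod.smul_fst, Prod.smul_snd, Prod.fst_sub,
    Prod.snd_sub, smul_eq_mul]
  ring

theorem two_mul_unifOn_shrunk_cap_le (hc : IsCompact Γ) (hΓ : Convex ℝ Γ) {x y z : Pt} (hx : x ∈ Γ)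
    (hxy : x ≠ y) (hmin : ∀ w ∈ Γ, cr x y z ≤ cr x y w) :
    2 * unifOn Γ {w | cr (z + (1 / 5 : ℝ) • (x - z)) (z + (1 / 5 : ℝ) • (y - z)) w ≤ 0} ≤
      unifOn Γ {w | cr x y w ≤ 0} := by
  have e : {w | cr (z + (1 / 5 : ℝ) • (x - z)) (z + (1 / 5 : ℝ) • (y - z)) w ≤ 0} =
      {w | cr x y w ≤ 4 / 5 * cr x y z} := by
    ext w
    simp only [mem_ofPred_eq, cr_homothety]
    constructor <;> intro h <;> linarith
  rw [e]
  have hD : cr x y z ≤ 0 := (hmin x hx).trans_eq (cr_self_left x y)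
  rcases hD.eq_or_lt with h0 | hneg
  · rw [measure_mono_null (t := {w | cr x y w = 0} ∪ Γᶜ)]
    · simp
    · intro w hw
      by_cases hwΓ : w ∈ Γ
      · left
        have h1 := hmin w hwΓ
        simp only [mem_ofPred_eq] at hw ⊢
        linarith
      · exact Or.inr hwΓ
    · rw [measure_union_null_iff]
      exact ⟨unifOn_line_eq_zero hc hxy, unifOn_compl_self hc⟩
  have key := sum_pow_mul_volume_le (S := {w | cr x y w ≤ 4 / 5 * cr x y z} ∩ Γ)
    (K := {w | cr x y w ≤ 0} ∩ Γ)
    ((measurableSet_le (measurable_cr_right x y) measurable_const).inter hc.measurableSet)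
    (fun w hw => ⟨le_trans (show cr x y w ≤ _ from hw.1) (by linarith), hw.2⟩)
    ((convex_cr_nonpos x y).inter hΓ) (w := x) ⟨(cr_self_left x y).le, hx⟩
    (g := fun w => -cr x y w) (fun p q s => by rw [cr_add_smul_sub]; ring)
    (A := 4 / 5 * -cr x y z) (by linarith) (B := -cr x y z)
    (fun w hw => by
      have h1 := hmin w hw.2
      have h2 : cr x y w ≤ 4 / 5 * cr x y z := hw.1
      rw [cr_self_left]
      constructor <;> linarith) (t := 79 / 100) (by norm_num) (by norm_num) (by linarith) 3
  rw [unifOn_apply hc, unifOn_apply hc, mul_left_comm]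
  refine mul_le_mul_right (le_trans (mul_le_mul_left ?_ _) key) _
  rw [← ENNReal.ofReal_sum_of_nonneg (fun i _ => by positivity)]
  rw [← ENNReal.ofReal_ofNat]
  refine ENNReal.ofReal_le_ofReal ?_
  norm_num [Finset.sum_range_succ]

theorem unifOn_left_le_sq (hc : IsCompact Γ) (hΓ : Convex ℝ Γ) (hi : (interior Γ).Nonempty)
    {x y z : Pt} (hx : x ∈ Γ) (hxy : x ≠ y)
    (hmin : ∀ w ∈ Γ, cr x y z ≤ cr x y w) :
    unifOn Γ {w | 0 < cr x y w} ≤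
      unifOn Γ {w | 0 < cr (z + (1 / 5 : ℝ) • (x - z)) (z + (1 / 5 : ℝ) • (y - z)) w} ^ 2 := by
  have := isProbabilityMeasure_unifOn hc hi
  have h := two_mul_unifOn_shrunk_cap_le hc hΓ hx hxy hmin
  set x' := z + (1 / 5 : ℝ) • (x - z)
  set y' := z + (1 / 5 : ℝ) • (y - z)
  have h1 := probReal_compl_eq_one_sub (μ := unifOn Γ) (measurableSet_left' x y)
  have h2 := probReal_compl_eq_one_sub (μ := unifOn Γ) (measurableSet_left' x' y')
  rw [compl_left] at h1 h2
  have h3 : 2 * (unifOn Γ).real {w | cr x' y' w ≤ 0} ≤ (unifOn Γ).real {w | cr x y w ≤ 0} := by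
    have := ENNReal.toReal_mono (measure_ne_top _ _) h
    simpa [measureReal_def] using this
  rw [← ofReal_measureReal, ← ofReal_measureReal (s := {w | 0 < cr x' y' w}),
    ← ENNReal.ofReal_pow measureReal_nonneg]
  exact ENNReal.ofReal_le_ofReal
    (by nlinarith [sq_nonneg ((unifOn Γ).real {w | 0 < cr x' y' w} - 1)])

/-- The pairs of points of `Γ` whose abscissas are ordered according to the sign of `σ`. -/
def orientedPairs (Γ : Set Pt) (σ : ℝ) : Set (Pt × Pt) :=
  {p : Pt × Pt | 0 < σ * (p.2.1 - p.1.1) ∧ p.1 ∈ Γ ∧ p.2 ∈ Γ}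

/-- The integrand of the powers of the mass on the left of a random line, restricted to pairs of
points of `Γ` with a prescribed direction. -/
def leftPow (Γ : Set Pt) (σ : ℝ) (n : ℕ) (x y : Pt) : ℝ≥0∞ :=
  (orientedPairs Γ σ).indicator
    (fun p => unifOn Γ {w | 0 < cr p.1 p.2 w} ^ n) (x, y)

instance (Γ : Set Pt) : SFinite (unifOn Γ) := by unfold unifOn; infer_instance

theorem measurable_unifOn_left :
    Measurable fun p : Pt × Pt => unifOn Γ {w | 0 < cr p.1 p.2 w} :=
  measurable_measure_prodMk_left (ν := unifOn Γ)
    (s := {q : (Pt × Pt) × Pt | 0 < cr q.1.1 q.1.2 q.2})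
    (measurableSet_left (by fun_prop) (by fun_prop) (by fun_prop))

theorem measurable_leftPow (hc : IsCompact Γ) (σ : ℝ) (n : ℕ) :
    Measurable (Function.uncurry (leftPow Γ σ n)) := by
  have : Function.uncurry (leftPow Γ σ n) =
    (orientedPairs Γ σ).indicator
      (fun p => unifOn Γ {w | 0 < cr p.1 p.2 w} ^ n) := rfl
  rw [this]
  refine (measurable_unifOn_left.pow_const n).indicator ?_
  have hΓ := hc.measurableSet
  exact (measurableSet_lt measurable_const
    (by fun_prop : Measurable fun p : Pt × Pt => σ * (p.2.1 - p.1.1))).inter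
    ((measurable_fst hΓ).inter (measurable_snd hΓ))

theorem leftPow_le (hc : IsCompact Γ) (hΓ : Convex ℝ Γ) (hi : (interior Γ).Nonempty) {σ a b : ℝ}
    {z : Pt} (hz : z ∈ Γ) (hmin : ∀ w ∈ Γ, σ * (z.2 - a * z.1) ≤ σ * (w.2 - a * w.1))
    (n : ℕ) (t₁ t₂ : ℝ) :
    leftPow Γ σ n (t₁, b + a * t₁) (t₂, b + a * t₂) ≤ leftPow Γ σ (2 * n)
      (z + (1 / 5 : ℝ) • ((t₁, b + a * t₁) - z)) (z + (1 / 5 : ℝ) • ((t₂, b + a * t₂) - z)) := by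
  by_cases hmem : 0 < σ * (t₂ - t₁) ∧ (t₁, b + a * t₁) ∈ Γ ∧ (t₂, b + a * t₂) ∈ Γ
  swap
  · rw [leftPow, indicator_of_notMem (show ((t₁, b + a * t₁), (t₂, b + a * t₂)) ∉ orientedPairs Γ σ
      from hmem)]
    exact zero_le
  obtain ⟨hσ, h1, h2⟩ := hmem
  have hne : ((t₁, b + a * t₁) : Pt) ≠ (t₂, b + a * t₂) := by
    intro h
    rw [Prod.ext_iff] at h
    simp only at h
    rw [h.1, sub_self, mul_zero] at hσ
    exact lt_irrefl _ hσ
  have hmin' : ∀ w ∈ Γ, cr (t₁, b + a * t₁) (t₂, b + a * t₂) z ≤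
      cr (t₁, b + a * t₁) (t₂, b + a * t₂) w := by
    intro w hw
    have h3 := mul_nonneg hσ.le (sub_nonneg.2 (hmin w hw))
    have hσ2 : 0 < σ ^ 2 := by
      have : σ ≠ 0 := by rintro rfl; simp at hσ
      positivity
    have e : σ * (t₂ - t₁) * (σ * (w.2 - a * w.1) - σ * (z.2 - a * z.1)) =
      σ ^ 2 * (cr (t₁, b + a * t₁) (t₂, b + a * t₂) w -
        cr (t₁, b + a * t₁) (t₂, b + a * t₂) z) := by
      simp only [cr]; ring
    rw [e] at h3
    exact sub_nonneg.1 (nonneg_of_mul_nonneg_right h3 hσ2)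
  have hr : (1 / 5 : ℝ) ∈ Icc (0 : ℝ) 1 := by norm_num
  rw [leftPow, leftPow, indicator_of_mem (show ((t₁, b + a * t₁), (t₂, b + a * t₂)) ∈ orientedPairs Γ σ
    from ⟨hσ, h1, h2⟩), indicator_of_mem, pow_mul]
  · exact pow_le_pow_left' (unifOn_left_le_sq hc hΓ hi h1 hne hmin') n
  · refine ⟨?_, hΓ.add_smul_sub_mem hz h1 hr, hΓ.add_smul_sub_mem hz h2 hr⟩
    simp only [Prod.fst_add, Prod.smul_fst, Prod.fst_sub, smul_eq_mul]
    linarith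

theorem lintegral_homothety (z : Pt) (a : ℝ) {r : ℝ} (hr : 0 < r) {F : Pt → Pt → ℝ≥0∞}
    (hF : Measurable (Function.uncurry F)) :
    ENNReal.ofReal (r ^ 4) * ∫⁻ b : ℝ, ∫⁻ t₁ : ℝ, ∫⁻ t₂ : ℝ, ENNReal.ofReal |t₁ - t₂| *
      F (z + r • ((t₁, b + a * t₁) - z)) (z + r • ((t₂, b + a * t₂) - z)) =
    ∫⁻ b : ℝ, ∫⁻ t₁ : ℝ, ∫⁻ t₂ : ℝ, ENNReal.ofReal |t₁ - t₂| *
      F (t₁, b + a * t₁) (t₂, b + a * t₂) := by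
  have hF' : Measurable fun p : Pt × Pt => F p.1 p.2 := hF
  have hF2 : ∀ {β : Type} [MeasurableSpace β] {u v : β → Pt}, Measurable u → Measurable v →
      Measurable fun z => F (u z) (v z) := fun hu hv => hF'.comp (hu.prodMk hv)
  set β := z.2 - a * z.1
  have hz : ∀ b t : ℝ, z + r • ((t, b + a * t) - z) =
      ((1 - r) * z.1 + t * r, ((1 - r) * β + b * r) + a * ((1 - r) * z.1 + t * r)) := by
    intro b t
    ext <;> simp [β] <;> ring
  set H : ℝ → ℝ → ℝ → ℝ≥0∞ := fun b t₁ t₂ => ENNReal.ofReal |t₁ - t₂| *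
      F (t₁, b + a * t₁) (t₂, b + a * t₂) with hH
  have hHm : Measurable fun q : (ℝ × ℝ) × ℝ => H q.1.1 q.1.2 q.2 :=
    Measurable.mul (by fun_prop) (hF2 (by fun_prop) (by fun_prop))
  have hm2 : Measurable fun q : ℝ × ℝ => ∫⁻ t₂, H q.1 q.2 t₂ := hHm.lintegral_prod_right'
  have hm1 : Measurable fun b : ℝ => ∫⁻ t₁, ∫⁻ t₂, H b t₁ t₂ :=
    Measurable.lintegral_prod_right' (f := fun q : ℝ × ℝ => ∫⁻ t₂, H q.1 q.2 t₂) hm2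
  have e : ∀ b t₁ t₂ : ℝ, ENNReal.ofReal r * (ENNReal.ofReal |t₁ - t₂| *
      F (z + r • ((t₁, b + a * t₁) - z)) (z + r • ((t₂, b + a * t₂) - z))) =
      H ((1 - r) * β + b * r) ((1 - r) * z.1 + t₁ * r) ((1 - r) * z.1 + t₂ * r) := by
    intro b t₁ t₂
    rw [hz, hz, hH]
    simp only
    rw [← mul_assoc, ← ENNReal.ofReal_mul hr.le]
    congr 2
    rw [← abs_of_pos hr, ← abs_mul, abs_of_pos hr]
    ring_nf
  have h0 := abs_of_pos hr
  have e3 : ∀ {f : ℝ → ℝ≥0∞} (_ : Measurable f) (d : ℝ),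
      ENNReal.ofReal r * ∫⁻ a, f (d + a * r) = ∫⁻ s, f s := by
    intro f hf d
    have := lintegral_comp_add_mul hf hr.ne' d
    rwa [h0] at this
  have hr' : ENNReal.ofReal r ≠ ∞ := ENNReal.ofReal_ne_top
  calc _ = ENNReal.ofReal r * ∫⁻ b : ℝ, ENNReal.ofReal r * ∫⁻ t₁ : ℝ, ENNReal.ofReal r *
        ∫⁻ t₂ : ℝ, ENNReal.ofReal r * (ENNReal.ofReal |t₁ - t₂| *
        F (z + r • ((t₁, b + a * t₁) - z)) (z + r • ((t₂, b + a * t₂) - z))) := by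
        simp_rw [lintegral_const_mul' _ _ hr', ← mul_assoc, ← ENNReal.ofReal_mul hr.le]
        congr 2
        rw [← ENNReal.ofReal_mul (by positivity), ← ENNReal.ofReal_mul (by positivity)]
        ring_nf
    _ = ENNReal.ofReal r * ∫⁻ b : ℝ, ENNReal.ofReal r * ∫⁻ t₁ : ℝ,
        ∫⁻ t₂ : ℝ, H ((1 - r) * β + b * r) ((1 - r) * z.1 + t₁ * r) t₂ := by
        simp_rw [e]
        congr 1
        refine lintegral_congr fun b => ?_
        congr 1
        refine lintegral_congr fun t₁ => ?_
        exact e3 (hHm.comp (by fun_prop : Measurable fun s : ℝ =>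
          (((1 - r) * β + b * r, (1 - r) * z.1 + t₁ * r), s))) _
    _ = ENNReal.ofReal r * ∫⁻ b : ℝ, ∫⁻ t₁ : ℝ,
        ∫⁻ t₂ : ℝ, H ((1 - r) * β + b * r) t₁ t₂ := by
        congr 1
        refine lintegral_congr fun b => ?_
        exact e3 (hm2.comp (by fun_prop : Measurable fun s : ℝ => ((1 - r) * β + b * r, s))) _
    _ = _ := e3 hm1 _

theorem lintegral_leftPow_le (hc : IsCompact Γ) (hΓ : Convex ℝ Γ) (hi : (interior Γ).Nonempty)
    (σ : ℝ) (n : ℕ) :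
    ∫⁻ x, ∫⁻ y, leftPow Γ σ n x y ≤ 625 * ∫⁻ x, ∫⁻ y, leftPow Γ σ (2 * n) x y := by
  rw [lintegral_slope_coordinates (measurable_leftPow hc σ n),
    lintegral_slope_coordinates (measurable_leftPow hc σ (2 * n)),
    ← lintegral_const_mul' _ _ (by norm_num)]
  refine lintegral_mono fun a => ?_
  obtain ⟨z, hz, hzmin⟩ := hc.exists_isMinOn (hi.mono interior_subset)
    (f := fun w => σ * (w.2 - a * w.1)) (by fun_prop)
  rw [← lintegral_homothety z a (r := 1 / 5) (by norm_num) (measurable_leftPow hc σ (2 * n)),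
    ← mul_assoc, ← ENNReal.ofReal_ofNat, ← ENNReal.ofReal_mul (by norm_num)]
  norm_num only [ENNReal.ofReal_one, one_mul]
  refine lintegral_mono fun b => lintegral_mono fun t₁ => lintegral_mono fun t₂ =>
    mul_le_mul_right ?_ _
  have := leftPow_le (b := b) hc hΓ hi hz (fun w hw => hzmin hw) n t₁ t₂
  norm_num only at this ⊢
  exact this

end Doubling

section MeanEdges

variable {Γ : Set Pt}

theorem ae_fst_ne (x : Pt) : ∀ᵐ y : Pt, y.1 ≠ x.1 := by
  have h : x ≠ x + (0, 1) := by simp [Prod.ext_iff]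
  refine measure_mono_null (fun y hy => ?_) (volume_line_eq_zero h)
  simp only [mem_compl_iff, mem_ofPred_eq, not_not] at hy
  simp [cr, hy]

theorem lintegral_unifOn (hc : IsCompact Γ) (f : Pt → ℝ≥0∞) :
    ∫⁻ x, f x ∂(unifOn Γ) = (volume Γ)⁻¹ * ∫⁻ x, Γ.indicator f x := by
  rw [unifOn, lintegral_smul_measure, lintegral_indicator hc.measurableSet, smul_eq_mul]

theorem lintegral_pow_left_eq (hc : IsCompact Γ) (hi : (interior Γ).Nonempty) (n : ℕ) :
    ∫⁻ p, unifOn Γ {w | 0 < cr p.1 p.2 w} ^ n ∂((unifOn Γ).prod (unifOn Γ)) =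
      (volume Γ)⁻¹ * ((volume Γ)⁻¹ *
        ((∫⁻ x, ∫⁻ y, leftPow Γ 1 n x y) + ∫⁻ x, ∫⁻ y, leftPow Γ (-1) n x y)) := by
  have hv : (volume Γ)⁻¹ ≠ ∞ := ENNReal.inv_ne_top.2 (volume_ne_zero hi)
  rw [lintegral_prod _ (measurable_unifOn_left.pow_const n).aemeasurable]
  rw [lintegral_unifOn hc, ← lintegral_add_left]
  · congr 1
    rw [← lintegral_const_mul' _ _ hv]
    refine lintegral_congr fun x => ?_
    rw [← lintegral_add_left]
    · by_cases hx : x ∈ Γ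
      · rw [indicator_of_mem hx, lintegral_unifOn hc]
        congr 1
        refine lintegral_congr_ae ?_
        filter_upwards [ae_fst_ne x] with y hy
        by_cases hyΓ : y ∈ Γ
        · rw [indicator_of_mem hyΓ]
          rcases lt_or_gt_of_ne hy with h | h
          · rw [leftPow, leftPow, indicator_of_notMem, indicator_of_mem, zero_add]
            · exact ⟨by simp only; linarith, hx, hyΓ⟩
            · rintro ⟨h', -⟩
              simp only at h'; linarith
          · rw [leftPow, leftPow, indicator_of_mem, indicator_of_notMem, add_zero]
            · rintro ⟨h', -⟩
              simp only at h'; linarith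
            · exact ⟨by simp only; linarith, hx, hyΓ⟩
        · rw [indicator_of_notMem hyΓ, leftPow, leftPow, indicator_of_notMem, indicator_of_notMem,
            add_zero]
          · exact fun h => hyΓ h.2.2
          · exact fun h => hyΓ h.2.2
      · rw [indicator_of_notMem hx]
        symm
        convert mul_zero _
        rw [lintegral_eq_zero_iff' (Measurable.aemeasurable _)]
        · refine Eventually.of_forall fun y => ?_
          simp only [Pi.zero_apply]
          rw [leftPow, leftPow, indicator_of_notMem, indicator_of_notMem, add_zero]
          · exact fun h => hx h.2.1
          · exact fun h => hx h.2.1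
        · exact ((measurable_leftPow hc 1 n).comp measurable_prodMk_left).add
            ((measurable_leftPow hc (-1) n).comp measurable_prodMk_left)
    · exact (measurable_leftPow hc 1 n).comp measurable_prodMk_left
  · exact (measurable_leftPow hc 1 n).lintegral_prod_right'

theorem lintegral_pow_left_le (hc : IsCompact Γ) (hΓ : Convex ℝ Γ) (hi : (interior Γ).Nonempty)
    (n : ℕ) : ∫⁻ p, unifOn Γ {w | 0 < cr p.1 p.2 w} ^ n ∂((unifOn Γ).prod (unifOn Γ)) ≤
      625 * ∫⁻ p, unifOn Γ {w | 0 < cr p.1 p.2 w} ^ (2 * n) ∂((unifOn Γ).prod (unifOn Γ)) := by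
  rw [lintegral_pow_left_eq hc hi, lintegral_pow_left_eq hc hi, mul_left_comm 625,
    mul_left_comm 625, mul_add 625]
  exact mul_le_mul_right (mul_le_mul_right (add_le_add (lintegral_leftPow_le hc hΓ hi 1 n)
    (lintegral_leftPow_le hc hΓ hi (-1) n)) _) _

/-- Up to a constant factor, only pairs of points which cut off a small cap contribute. -/
theorem lintegral_pow_left_le_meanEdges (hc : IsCompact Γ) (hΓ : Convex ℝ Γ)
    (hi : (interior Γ).Nonempty) {N : ℕ} (hN : 64 ≤ N) :
    (N * (N - 1) : ℕ) * ∫⁻ p, unifOn Γ {w | 0 < cr p.1 p.2 w} ^ (N - 2)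
      ∂((unifOn Γ).prod (unifOn Γ)) ≤ 2 * meanEdges (unifOn Γ) 64 N := by
  have := isProbabilityMeasure_unifOn hc hi
  rw [meanEdges_eq, mul_left_comm]
  refine mul_le_mul_right ?_ _
  set μ := unifOn Γ
  set f : ℕ → Pt × Pt → ℝ≥0∞ := fun n p => μ {w | 0 < cr p.1 p.2 w} ^ n with hf
  have hcap := measurableSet_capPairs μ 64 N
  have hfin : ∀ (n : ℕ) (s : Set (Pt × Pt)), ∫⁻ p in s, f n p ∂(μ.prod μ) ≠ ∞ := by
    intro n s
    refine ne_of_lt (lt_of_le_of_lt (lintegral_mono (g := fun _ => 1) fun p => ?_) (by simp))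
    exact pow_le_one₀ zero_le prob_le_one
  have hN0 : (0 : ℝ) < N := by exact_mod_cast (by omega : 0 < N)
  have hcompl : ∫⁻ p in (capPairs μ 64 N)ᶜ, f (N - 2) p ∂(μ.prod μ) ≤
      ENNReal.ofReal (1 / 2) * ∫⁻ p, f (N - 2) p ∂(μ.prod μ) := by
    set n := (N - 1) / 2 with hn
    have hsplit : N - 2 = (N - 2 - n) + n := by omega
    have h8 : N ≤ 8 * (N - 2 - n) := by omega
    calc ∫⁻ p in (capPairs μ 64 N)ᶜ, f (N - 2) p ∂(μ.prod μ)
        ≤ ∫⁻ p in (capPairs μ 64 N)ᶜ, ENNReal.ofReal (1 / 1250) * f n p ∂(μ.prod μ) := by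
          refine setLIntegral_mono' hcap.compl fun p hp => ?_
          simp only [hf]
          rw [hsplit, pow_add]
          refine mul_le_mul_left ?_ _
          have hp' : (64 : ℝ) / N ≤ μ.real {w | cr p.1 p.2 w ≤ 0} := by
            have hp2 : ((64 : ℕ) : ℝ≥0∞) / N < μ {w | cr p.1 p.2 w ≤ 0} := not_le.1 hp
            have := ENNReal.toReal_mono (measure_ne_top _ _) hp2.le
            simpa [measureReal_def] using this
          have h1 := probReal_compl_eq_one_sub (μ := μ) (measurableSet_left' p.1 p.2)
          rw [compl_left] at h1
          rw [← ofReal_measureReal, ← ENNReal.ofReal_pow measureReal_nonneg]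
          refine ENNReal.ofReal_le_ofReal ?_
          have h2 : μ.real {w | 0 < cr p.1 p.2 w} ≤ Real.exp (-(64 / N)) := by
            have := Real.one_sub_le_exp_neg (64 / (N : ℝ))
            linarith
          refine (pow_le_pow_left₀ measureReal_nonneg h2 _).trans ?_
          rw [← Real.exp_nat_mul]
          have h3 : ((N - 2 - n : ℕ) : ℝ) * -(64 / N) ≤ -8 := by
            have h8' : (N : ℝ) ≤ 8 * ((N - 2 - n : ℕ) : ℝ) := by exact_mod_cast h8
            rw [mul_neg, neg_le_neg_iff, ← mul_div_assoc, le_div_iff₀ hN0]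
            linarith
          refine (Real.exp_le_exp.2 h3).trans ?_
          rw [Real.exp_neg, one_div]
          refine inv_anti₀ (by norm_num) ?_
          have h4 : Real.exp 8 = Real.exp 1 ^ 8 := by rw [← Real.exp_nat_mul]; norm_num
          rw [h4]
          have h5 : (2.7 : ℝ) ≤ Real.exp 1 := by linarith [Real.exp_one_gt_d9]
          refine le_trans ?_ (pow_le_pow_left₀ (by norm_num) h5 8)
          norm_num
      _ = ENNReal.ofReal (1 / 1250) * ∫⁻ p in (capPairs μ 64 N)ᶜ, f n p ∂(μ.prod μ) :=
          lintegral_const_mul' _ _ ENNReal.ofReal_ne_top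
      _ ≤ ENNReal.ofReal (1 / 1250) * (625 * ∫⁻ p, f (2 * n) p ∂(μ.prod μ)) := by
          refine mul_le_mul_right ((setLIntegral_le_lintegral _ _).trans ?_) _
          exact lintegral_pow_left_le hc hΓ hi n
      _ ≤ _ := by
          rw [← mul_assoc, ← ENNReal.ofReal_ofNat, ← ENNReal.ofReal_mul (by norm_num)]
          norm_num only
          refine mul_le_mul_right (lintegral_mono fun p => ?_) _
          exact pow_le_pow_right_of_le_one' prob_le_one (by omega)
  have hadd := lintegral_add_compl (μ := μ.prod μ) (f (N - 2)) hcap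
  have hf0 := hfin (N - 2) univ
  rw [Measure.restrict_univ] at hf0
  have hr := congrArg ENNReal.toReal hadd
  rw [ENNReal.toReal_add (hfin _ _) (hfin _ _)] at hr
  have hr2 := ENNReal.toReal_mono (ENNReal.mul_ne_top ENNReal.ofReal_ne_top hf0) hcompl
  rw [ENNReal.toReal_mul, ENNReal.toReal_ofReal (by norm_num)] at hr2
  rw [← ENNReal.toReal_le_toReal hf0 (ENNReal.mul_ne_top (by norm_num) (hfin _ _)),
    ENNReal.toReal_mul, ENNReal.toReal_ofNat]
  linarith

theorem exp_neg_le_pow_of_le {k : ℕ} {N : ℕ} (hN0 : 0 < N) (hN : 2 * k ≤ N) {x : ℝ}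
    (hx : 1 - (k : ℝ) / N ≤ x) (hx1 : x ≤ 1) {m : ℕ} (hm : m ≤ N) :
    Real.exp (-(2 * k)) ≤ x ^ m := by
  have hN0' : (0 : ℝ) < N := by exact_mod_cast hN0
  have hN' : 2 * (k : ℝ) ≤ N := by exact_mod_cast hN
  set u := (k : ℝ) / N
  have hu0 : 0 ≤ u := by positivity
  have hu : u ≤ 1 / 2 := by rw [div_le_div_iff₀ hN0' two_pos]; linarith
  have h1 : Real.exp (-(2 * u)) ≤ x := by
    rw [Real.exp_neg]
    have h2 := Real.add_one_le_exp (2 * u)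
    refine le_trans (inv_le_of_inv_le₀ (by linarith) (le_trans ?_ h2)) hx
    rw [inv_le_iff_one_le_mul₀ (by linarith)]
    nlinarith
  calc Real.exp (-(2 * k)) = Real.exp (-(2 * u)) ^ N := by
        rw [← Real.exp_nat_mul]; congr 1; simp only [u]; field_simp
    _ ≤ x ^ N := pow_le_pow_left₀ (Real.exp_pos _).le h1 N
    _ ≤ x ^ m := pow_le_pow_of_le_one (by linarith) hx1 hm

theorem eventually_sq_mul_capPairs_le (hc : IsCompact Γ) (hi : (interior Γ).Nonempty) (k : ℕ) :
    ∃ K : ℕ, ∀ᶠ N : ℕ in atTop, (N : ℝ≥0∞) ^ 2 *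
      ((unifOn Γ).prod (unifOn Γ)) (capPairs (unifOn Γ) k N) ≤ K * meanEdges (unifOn Γ) k N := by
  have := isProbabilityMeasure_unifOn hc hi
  obtain ⟨K, hK⟩ := exists_nat_ge (2 * Real.exp (2 * k))
  refine ⟨K, ?_⟩
  filter_upwards [eventually_ge_atTop (2 * k + 2)] with N hN
  rw [meanEdges_eq]
  set μ := unifOn Γ
  have h1 : ENNReal.ofReal (Real.exp (-(2 * k))) * (μ.prod μ) (capPairs μ k N) ≤
      ∫⁻ p in capPairs μ k N, (μ {w | 0 < cr p.1 p.2 w}) ^ (N - 2) ∂(μ.prod μ) := by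
    rw [← setLIntegral_const]
    refine setLIntegral_mono' (measurableSet_capPairs μ k N) fun p hp => ?_
    rw [← ofReal_measureReal, ← ENNReal.ofReal_pow measureReal_nonneg]
    exact ENNReal.ofReal_le_ofReal (exp_neg_le_pow_of_le (by omega) (by omega)
      (left_real_ge (by omega) hp) measureReal_le_one (by omega))
  refine le_trans ?_ (mul_le_mul_right (mul_le_mul_right h1 _) _)
  rw [← mul_assoc, ← mul_assoc]
  refine mul_le_mul_left ?_ _
  have e1 : (N : ℝ≥0∞) ^ 2 = ENNReal.ofReal ((N : ℝ) ^ 2) := by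
    rw [ENNReal.ofReal_pow (by positivity), ENNReal.ofReal_natCast]
  rw [e1, ← ENNReal.ofReal_natCast K, ← ENNReal.ofReal_natCast (N * (N - 1)),
    ← ENNReal.ofReal_mul (by positivity), ← ENNReal.ofReal_mul (by positivity)]
  refine ENNReal.ofReal_le_ofReal ?_
  have hN2 : (2 : ℝ) ≤ N := by exact_mod_cast (by omega : 2 ≤ N)
  have h2 : 2 ≤ (K : ℝ) * Real.exp (-(2 * k)) := by
    have := mul_le_mul_of_nonneg_right hK (Real.exp_pos (-(2 * (k : ℝ)))).le
    rwa [mul_assoc, ← Real.exp_add, add_neg_cancel, Real.exp_zero, mul_one] at this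
  push_cast [Nat.cast_sub (by omega : 1 ≤ N)]
  nlinarith [mul_nonneg (by nlinarith : (0 : ℝ) ≤ N * (N - 1)) (sub_nonneg.2 h2)]

end MeanEdges

section ExtremePoints

variable {N : ℕ}

theorem exists_isHullEdge_of_mem_extremePoints (hN : 2 ≤ N) {x : Fin N → Pt}
    (hx : Function.Injective x)
    (hgp : ∀ i j, i ≠ j → ∀ k, k ≠ i → k ≠ j → cr (x i) (x j) (x k) ≠ 0) {a : Fin N}
    (ha : x a ∈ extremePoints ℝ (convexHull ℝ (range x))) : ∃ b, IsHullEdge univ x (a, b) := by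
  have hnot : x a ∉ convexHull ℝ (range x \ {x a}) := fun h =>
    ((convex_convexHull ℝ (range x)).mem_extremePoints_iff_mem_sdiff_convexHull_sdiff.1 ha).2
      (convexHull_mono (sdiff_subset_sdiff_left (subset_convexHull ℝ _)) h)
  obtain ⟨f, u, hfa, hfu⟩ := geometric_hahn_banach_point_closed (convex_convexHull ℝ _)
    ((finite_range x).sdiff.isClosed_convexHull (𝕜 := ℝ)) hnot
  have hfk : ∀ k, k ≠ a → 0 < f (x k - x a) := fun k hk => by
    have := hfu (x k) (subset_convexHull ℝ _ ⟨mem_range_self k, fun h => hk (hx h)⟩)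
    rw [map_sub]; linarith
  set α := f (1, 0)
  set β := f (0, 1)
  have hf : ∀ v : Pt, f v = α * v.1 + β * v.2 := by
    intro v
    have : v = v.1 • ((1, 0) : Pt) + v.2 • ((0, 1) : Pt) := by ext <;> simp
    conv_lhs => rw [this]
    rw [map_add, map_smul, map_smul, smul_eq_mul, smul_eq_mul]; ring
  have hne : (Finset.univ.erase a).Nonempty := by
    rw [← Finset.card_pos, Finset.card_erase_of_mem (Finset.mem_univ a), Finset.card_univ,
      Fintype.card_fin]
    omega
  obtain ⟨b, hb, hmin⟩ := (Finset.univ.erase a).exists_min_image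
    (fun k => (α * (x k - x a).2 - β * (x k - x a).1) / f (x k - x a)) hne
  have hba := Finset.ne_of_mem_erase hb
  refine ⟨b, hba.symm, mem_univ _, fun k hka hkb => ?_⟩
  refine lt_of_le_of_ne ?_ (hgp a b hba.symm k hka hkb).symm
  have h1 := hmin k (Finset.mem_erase.2 ⟨hka, Finset.mem_univ _⟩)
  rw [div_le_div_iff₀ (hfk b hba) (hfk k hka)] at h1
  have hpos : 0 < α ^ 2 + β ^ 2 := by
    have h2 := hfk b hba
    rw [hf] at h2
    rcases eq_or_ne α 0 with h0 | h0
    · rcases eq_or_ne β 0 with h0' | h0'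
      · rw [h0, h0'] at h2; simp at h2
      · positivity
    · positivity
  refine nonneg_of_mul_nonneg_right ?_ hpos
  rw [hf, hf] at h1
  simp only [Prod.fst_sub, Prod.snd_sub] at h1
  simp only [cr]
  linarith

theorem ncard_extremePoints_le (hN : 2 ≤ N) {x : Fin N → Pt} (hx : Function.Injective x)
    (hgp : ∀ i j, i ≠ j → ∀ k, k ≠ i → k ≠ j → cr (x i) (x j) (x k) ≠ 0) :
    (range x ∩ extremePoints ℝ (convexHull ℝ (range x))).ncard ≤ (hullEdges univ x).card := by
  classical
  have hsub : range x ∩ extremePoints ℝ (convexHull ℝ (range x)) ⊆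
      ((hullEdges univ x).image fun e => x e.1 : Finset Pt) := by
    rintro _ ⟨⟨a, rfl⟩, ha⟩
    obtain ⟨b, hb⟩ := exists_isHullEdge_of_mem_extremePoints hN hx hgp ha
    rw [Finset.mem_coe, Finset.mem_image]
    exact ⟨(a, b), mem_hullEdges.2 hb, rfl⟩
  calc _ ≤ (((hullEdges univ x).image fun e => x e.1 : Finset Pt) : Set Pt).ncard :=
        ncard_le_ncard hsub (Finset.finite_toSet _)
    _ ≤ _ := by rw [ncard_coe_finset]; exact Finset.card_image_le

theorem measure_singleton_eq_zero_of_line {μ : Measure Pt}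
    (hline : ∀ p q : Pt, p ≠ q → μ {w | cr p q w = 0} = 0)
    (p : Pt) : μ {p} = 0 :=
  measure_mono_null (singleton_subset_iff.2 (cr_self_left p (p + (1, 0))))
    (hline p (p + (1, 0)) (by simp [Prod.ext_iff]))

theorem ae_general_position {μ : Measure Pt} [IsProbabilityMeasure μ]
    (hline : ∀ p q : Pt, p ≠ q → μ {w | cr p q w = 0} = 0) (N : ℕ) :
    ∀ᵐ x ∂(Measure.pi fun _ : Fin N => μ),
      ∀ i j, i ≠ j → ∀ k, k ≠ i → k ≠ j → cr (x i) (x j) (x k) ≠ 0 := by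
  rw [ae_all_iff]; intro i
  rw [ae_all_iff]; intro j
  rw [eventually_imp_distrib_left]; intro hij
  have hi : Function.Injective (![i, j] : Fin 2 → Fin N) := by
    intro a b; fin_cases a <;> fin_cases b <;> simp [hij, hij.symm]
  have hB : MeasurableSet {q : (Fin 2 → Pt) × Pt | cr (q.1 0) (q.1 1) q.2 ≠ 0} := by
    refine (measurableSet_eq_fun ?_ measurable_const).compl
    unfold cr; fun_prop
  have h := measure_sample_eq_of_measurePreserving μ (measurePreserving_vec2 μ) _ hi
    MeasurableSet.univ hB
  have h1 : ∀ᵐ p : Pt × Pt ∂(μ.prod μ), μ {w | cr p.1 p.2 w ≠ 0} ^ (N - 2) = 1 := by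
    have hne : ∀ᵐ p : Pt × Pt ∂(μ.prod μ), p.1 ≠ p.2 := by
      rw [ae_iff, Measure.measure_prod_null]
      · refine Eventually.of_forall fun p => ?_
        refine measure_mono_null (t := {p}) (fun q hq => ?_)
          (measure_singleton_eq_zero_of_line hline p)
        simpa [eq_comm] using hq
      · simpa using measurableSet_eq_fun measurable_fst measurable_snd
    filter_upwards [hne] with p hp
    have := (prob_compl_eq_one_iff (μ := μ) (s := {w | cr p.1 p.2 w = 0})
      (measurableSet_eq_fun (measurable_cr_right _ _) measurable_const)).2 (hline p.1 p.2 hp)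
    rw [show {w | cr p.1 p.2 w ≠ 0} = {w | cr p.1 p.2 w = 0}ᶜ from rfl, this, one_pow]
  have e : ∀ p : Pt × Pt, {w | (![p.1, p.2], w) ∈
      {q : (Fin 2 → Pt) × Pt | cr (q.1 0) (q.1 1) q.2 ≠ 0}} = {w | cr p.1 p.2 w ≠ 0} :=
    fun p => by ext; simp
  simp only [mem_univ, true_and, preimage_univ, Measure.restrict_univ, e] at h
  rw [lintegral_congr_ae h1, lintegral_one, measure_univ] at h
  have hms : MeasurableSet {x : Fin N → Pt | ∀ k, k ∉ range ![i, j] →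
      cr (x i) (x j) (x k) ≠ 0} := by
    simp only [ofPred_forall]
    refine MeasurableSet.iInter fun k => MeasurableSet.iInter fun _ => ?_
    refine (measurableSet_eq_fun ?_ measurable_const).compl
    unfold cr; fun_prop
  have h2 := (mem_ae_iff_prob_eq_one hms).2 h
  filter_upwards [h2] with x hx k hki hkj
  exact hx k (by simp [hki, hkj])

end ExtremePoints

theorem expHullPoints_le {Γ : Set Pt} (hc : IsCompact Γ) (hΓ : Convex ℝ Γ)
    (hi : (interior Γ).Nonempty) {N : ℕ} (hN : 64 ≤ N) :
    expHullPoints Γ N ≤ 2 * (meanEdges (unifOn Γ) 64 N).toReal := by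
  have := isProbabilityMeasure_unifOn hc hi
  set μ := unifOn Γ
  have hline : ∀ p q : Pt, p ≠ q → μ {w | cr p q w = 0} = 0 := fun p q h =>
    unifOn_line_eq_zero hc h
  have hle : ∀ᵐ x ∂(Measure.pi fun _ : Fin N => μ),
      ((range x ∩ extremePoints ℝ (convexHull ℝ (range x))).ncard : ℝ) ≤
        ((hullEdges univ x).card : ℝ) := by
    filter_upwards [ae_injective (measure_singleton_eq_zero_of_line hline) N,
      ae_general_position hline N] with x hx hgp
    exact_mod_cast ncard_extremePoints_le (by omega) hx hgp
  have hmeas : Measurable fun x : Fin N → Pt => ((hullEdges univ x).card : ℝ≥0∞) :=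
    measurable_card_hullEdges MeasurableSet.univ
  have hlin : ∫⁻ x, ((hullEdges univ x).card : ℝ≥0∞) ∂(Measure.pi fun _ : Fin N => μ) ≤
      2 * meanEdges μ 64 N := by
    rw [lintegral_card_hullEdges μ MeasurableSet.univ, Measure.restrict_univ]
    exact lintegral_pow_left_le_meanEdges hc hΓ hi hN
  have hfin : 2 * meanEdges μ 64 N ≠ ∞ := ENNReal.mul_ne_top (by norm_num) (meanEdges_ne_top _ _)
  have e : ∫ x, ((hullEdges univ x).card : ℝ) ∂(Measure.pi fun _ : Fin N => μ) =
      (∫⁻ x, ((hullEdges univ x).card : ℝ≥0∞) ∂(Measure.pi fun _ : Fin N => μ)).toReal := by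
    rw [← integral_toReal hmeas.aemeasurable (Eventually.of_forall fun x => by simp)]
    simp
  have hint : Integrable (fun x : Fin N → Pt => ((hullEdges univ x).card : ℝ))
      (Measure.pi fun _ => μ) := by
    have := integrable_toReal_of_lintegral_ne_top hmeas.aemeasurable
      (ne_top_of_le_ne_top hfin hlin)
    simpa using this
  calc expHullPoints Γ N ≤ ∫ x, ((hullEdges univ x).card : ℝ) ∂(Measure.pi fun _ : Fin N => μ) :=
        integral_mono_of_nonneg (Eventually.of_forall fun x => by positivity) hint hle
    _ ≤ (2 * meanEdges μ 64 N).toReal := by rw [e]; exact ENNReal.toReal_mono hfin hlin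
    _ = _ := by rw [ENNReal.toReal_mul, ENNReal.toReal_ofNat]

section Slices

theorem IsCompact.convexJoin {E : Type*} [AddCommGroup E] [Module ℝ E] [TopologicalSpace E]
    [IsTopologicalAddGroup E] [ContinuousSMul ℝ E] {s t : Set E} (hs : IsCompact s)
    (ht : IsCompact t) : IsCompact (convexJoin ℝ s t) := by
  have h : _root_.convexJoin ℝ s t =
      (fun p : (E × E) × ℝ => p.1.1 + p.2 • (p.1.2 - p.1.1)) '' ((s ×ˢ t) ×ˢ Icc 0 1) := by
    ext x
    simp only [mem_convexJoin, segment_eq_image', mem_image, Prod.exists, mem_prod]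
    constructor
    · rintro ⟨a, ha, b, hb, r, hr, rfl⟩
      exact ⟨a, b, r, ⟨⟨ha, hb⟩, hr⟩, rfl⟩
    · rintro ⟨a, b, r, ⟨⟨ha, hb⟩, hr⟩, rfl⟩
      exact ⟨a, ha, b, hb, r, hr, rfl⟩
  rw [h]
  exact ((hs.prod ht).prod isCompact_Icc).image (by fun_prop)

/-- An extreme point of a compact convex set can be separated from a compact subset which does not
contain it. -/
theorem exists_clm_lt_of_mem_extremePoints {E : Type*} [NormedAddCommGroup E] [NormedSpace ℝ E]
    {Γ : Set E} (hΓ : Convex ℝ Γ) {z : E} (hz : z ∈ extremePoints ℝ Γ) {s : Set E}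
    (hs : IsCompact s) (hsΓ : s ⊆ Γ) (hΓc : IsCompact Γ) (hzs : z ∉ s) :
    ∃ (l : E →L[ℝ] ℝ) (c : ℝ), (∀ a ∈ s, l a < c) ∧ c < l z := by
  obtain ⟨K, hK, hKconv, hsK, hzK⟩ : ∃ K, (IsCompact K ∧ K ⊆ Γ) ∧ Convex ℝ K ∧ s ⊆ K ∧ z ∉ K := by
    refine hs.induction_on (p := fun s => ∃ K, (IsCompact K ∧ K ⊆ Γ) ∧ Convex ℝ K ∧ s ⊆ K ∧ z ∉ K)
      ⟨∅, ⟨isCompact_empty, empty_subset _⟩, convex_empty, Subset.rfl, by simp⟩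
      (fun s t hst ⟨K, h1, h2, h3, h4⟩ => ⟨K, h1, h2, hst.trans h3, h4⟩) ?_ ?_
    · rintro s t ⟨K, h1, h2, h3, h4⟩ ⟨K', h1', h2', h3', h4'⟩
      rcases K.eq_empty_or_nonempty with rfl | hne
      · exact ⟨K', h1', h2', union_subset (h3.trans (empty_subset _)) h3', h4'⟩
      rcases K'.eq_empty_or_nonempty with rfl | hne'
      · exact ⟨K, h1, h2, union_subset h3 (h3'.trans (empty_subset _)), h4⟩
      refine ⟨_, ⟨h1.1.convexJoin h1'.1, convexJoin_subset h1.2 h1'.2 hΓ⟩, h2.convexJoin h2',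
        union_subset (h3.trans (subset_convexJoin_left hne'))
          (h3'.trans (subset_convexJoin_right hne)), fun hzj => ?_⟩
      obtain ⟨a, ha, b, hb, hab⟩ := mem_convexJoin.1 hzj
      rcases (mem_extremePoints_iff_forall_segment.1 hz).2 a (h1.2 ha) b (h1'.2 hb) hab with rfl | rfl
      exacts [h4 ha, h4' hb]
    · intro x hx
      have hd : 0 < dist z x := dist_pos.2 fun h => hzs (h ▸ hx)
      refine ⟨s ∩ Metric.closedBall x (dist z x / 2),
        inter_mem_nhdsWithin _ (Metric.closedBall_mem_nhds _ (by linarith)),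
        Γ ∩ Metric.closedBall x (dist z x / 2),
        ⟨hΓc.inter_right Metric.isClosed_closedBall, inter_subset_left⟩,
        hΓ.inter (convex_closedBall _ _), inter_subset_inter_left _ hsΓ, fun h => ?_⟩
      have := Metric.mem_closedBall.1 h.2
      linarith
  obtain ⟨l, c, h, h'⟩ := geometric_hahn_banach_closed_point hKconv hK.1.isClosed hzK
  exact ⟨l, c, fun a ha => h a (hsK ha), h'⟩

variable {Γ : Set Pt}

/-- `Γ` has `M` caps of area at least `τ` with pairwise overlaps of area at most `ε τ`. -/
def HasCaps (Γ : Set Pt) (M : ℕ) (ε τ : ℝ) : Prop :=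
  ∃ (l : Fin M → (Pt →L[ℝ] ℝ)) (b : Fin M → ℝ),
    (∀ j, ENNReal.ofReal τ ≤ volume ({w | b j ≤ l j w} ∩ Γ)) ∧
    ∀ i j, i ≠ j → volume ({w | b i ≤ l i w} ∩ {w | b j ≤ l j w} ∩ Γ) ≤ ENNReal.ofReal (ε * τ)

theorem eventually_hasCaps_of_infinite (hc : IsCompact Γ) (hΓ : Convex ℝ Γ)
    (hi : (interior Γ).Nonempty) (hinf : (extremePoints ℝ Γ).Infinite) (M : ℕ) (ε : ℝ) :
    ∀ᶠ τ in 𝓝[>] (0 : ℝ), HasCaps Γ M ε τ := by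
  set z : Fin M → Pt := fun j => hinf.natEmbedding _ j
  have hzinj : Function.Injective z := fun i j hij =>
    Fin.ext ((hinf.natEmbedding _).injective (Subtype.ext hij))
  have hz : ∀ j, z j ∈ extremePoints ℝ Γ := fun j => (hinf.natEmbedding _ j).2
  obtain ⟨U, hU, hdisj⟩ := (finite_range z).t2_separation
  have hsep : ∀ j, ∃ (l : Pt →L[ℝ] ℝ) (c : ℝ), (∀ a ∈ Γ \ U (z j), l a < c) ∧ c < l (z j) := fun j =>
    exists_clm_lt_of_mem_extremePoints hΓ (hz j) (hc.diff (hU (z j)).2) sdiff_subset hc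
      fun h => h.2 (hU (z j)).1
  choose l b hlt hgt using hsep
  have hpos : ∀ j, 0 < volume ({w | b j ≤ l j w} ∩ Γ) := by
    intro j
    have hopen : IsOpen {w | b j < l j w} := isOpen_lt continuous_const (l j).continuous
    have hcl : z j ∈ closure (interior Γ) := by
      rw [hΓ.closure_interior_eq_closure_of_nonempty_interior hi]
      exact subset_closure (hz j).1
    refine ((hopen.inter isOpen_interior).measure_pos volume
      (mem_closure_iff.1 hcl _ hopen (hgt j))).trans_le (measure_mono ?_)
    exact inter_subset_inter (fun w (hw : b j < l j w) => hw.le) interior_subset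
  have hev : ∀ᶠ τ in 𝓝[>] (0 : ℝ), ∀ j, ENNReal.ofReal τ ≤ volume ({w | b j ≤ l j w} ∩ Γ) := by
    refine eventually_all.2 fun j => ?_
    have ht : Tendsto ENNReal.ofReal (𝓝[>] 0) (𝓝 0) := by
      have := (ENNReal.continuous_ofReal.tendsto 0).mono_left (nhdsWithin_le_nhds (s := Ioi 0))
      rwa [ENNReal.ofReal_zero] at this
    exact (ht.eventually (gt_mem_nhds (hpos j))).mono fun τ h => h.le
  filter_upwards [hev] with τ hτ
  refine ⟨l, b, hτ, fun i j hij => ?_⟩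
  have hsub : ∀ j w, w ∈ Γ → b j ≤ l j w → w ∈ U (z j) := fun j w hw h => by
    by_contra hn
    exact absurd (hlt j w ⟨hw, hn⟩) (not_lt.2 h)
  have hempty : {w | b i ≤ l i w} ∩ {w | b j ≤ l j w} ∩ Γ = ∅ := by
    refine eq_empty_of_forall_notMem fun w hw => ?_
    exact disjoint_left.1 (hdisj (mem_range_self i) (mem_range_self j) (hzinj.ne hij))
      (hsub i w hw.2 hw.1.1) (hsub j w hw.2 hw.1.2)
  rw [hempty, measure_empty]
  exact zero_le

end Slices

section Corner

variable {Γ : Set Pt}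

/-- A convex polygon has a corner, at which it is an affine image of a quadrant. -/
theorem exists_corner (hc : IsCompact Γ) (hΓ : Convex ℝ Γ) (hi : (interior Γ).Nonempty)
    (hfin : (extremePoints ℝ Γ).Finite) : ∃ (z : Pt) (T : Pt ≃L[ℝ] Pt),
      (∀ q : Pt, 0 ≤ q.1 → 0 ≤ q.2 → q.1 + q.2 ≤ 1 → z + T q ∈ Γ) ∧
      ∀ q : Pt, z + T q ∈ Γ → 0 ≤ q.1 ∧ 0 ≤ q.2 := by
  have hΓV : Γ = convexHull ℝ (extremePoints ℝ Γ) := by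
    conv_lhs => rw [← closure_convexHull_extremePoints hc hΓ]
    exact (hfin.isClosed_convexHull ℝ).closure_eq
  obtain ⟨z, hz⟩ := hc.extremePoints_nonempty (hi.mono interior_subset)
  set s := extremePoints ℝ Γ \ {z}
  have hsfin : s.Finite := hfin.subset sdiff_subset
  have hsΓ : s ⊆ Γ := sdiff_subset.trans extremePoints_subset
  have hline : ∀ u, u ≠ z → ¬ ∀ w ∈ extremePoints ℝ Γ, cr z u w = 0 := by
    intro u hu h
    refine volume_ne_zero hi (measure_mono_null ?_ (volume_line_eq_zero hu.symm))
    have hsub : Γ ⊆ {w | cr z u w ≤ 0} ∩ {w | cr u z w ≤ 0} := by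
      conv_lhs => rw [hΓV]
      refine convexHull_min (fun w hw => ⟨(h w hw).le, ?_⟩)
        ((convex_cr_nonpos z u).inter (convex_cr_nonpos u z))
      rw [mem_ofPred_eq, cr_swap_left, h w hw, neg_zero]
    intro w hw
    have h2 : cr u z w ≤ 0 := (hsub hw).2
    rw [cr_swap_left] at h2
    exact le_antisymm (hsub hw).1 (by linarith)
  have hsne : s.Nonempty := by
    by_contra hne
    refine hline (z + (1, 0)) (by simp [Prod.ext_iff]) fun w hw => ?_
    have : w = z := by
      by_contra hwz
      exact hne ⟨w, hw, hwz⟩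
    rw [this, cr_self_left]
  obtain ⟨l, c, hlc, hcz⟩ := exists_clm_lt_of_mem_extremePoints hΓ hz hsfin.isCompact hsΓ hc
    (fun h => h.2 rfl)
  have hl : ∀ w : Pt, l w = l (1, 0) * w.1 + l (0, 1) * w.2 := by
    intro w
    have : w = w.1 • ((1 : ℝ), (0 : ℝ)) + w.2 • ((0 : ℝ), (1 : ℝ)) := by ext <;> simp
    conv_lhs => rw [this]
    rw [map_add, map_smul, map_smul, smul_eq_mul, smul_eq_mul]
    ring
  set a := l (1, 0)
  set b := l (0, 1)
  have hneg : ∀ w ∈ s, 0 < -(a * (w.1 - z.1) + b * (w.2 - z.2)) := by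
    intro w hw
    have h1 := (hlc w hw).trans hcz
    rw [hl w, hl z] at h1
    linarith
  have hab : 0 < a ^ 2 + b ^ 2 := by
    obtain ⟨w, hw⟩ := hsne
    by_contra hn
    have ha : a = 0 := by nlinarith [sq_nonneg a, sq_nonneg b]
    have hb : b = 0 := by nlinarith [sq_nonneg a, sq_nonneg b]
    have := hneg w hw
    rw [ha, hb] at this
    linarith
  have hratio : ∀ w ∈ s, ∀ w' ∈ s,
      (-b * (w.1 - z.1) + a * (w.2 - z.2)) / -(a * (w.1 - z.1) + b * (w.2 - z.2)) ≤
        (-b * (w'.1 - z.1) + a * (w'.2 - z.2)) / -(a * (w'.1 - z.1) + b * (w'.2 - z.2)) →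
      cr z w w' ≤ 0 := by
    intro w hw w' hw' h
    rw [div_le_div_iff₀ (hneg w hw) (hneg w' hw')] at h
    refine nonpos_of_mul_nonpos_right ?_ hab
    unfold cr
    linarith
  obtain ⟨u, hu, humax⟩ := s.exists_max_image (fun w =>
    (-b * (w.1 - z.1) + a * (w.2 - z.2)) / -(a * (w.1 - z.1) + b * (w.2 - z.2))) hsfin hsne
  obtain ⟨v, hv, hvmin⟩ := s.exists_min_image (fun w =>
    (-b * (w.1 - z.1) + a * (w.2 - z.2)) / -(a * (w.1 - z.1) + b * (w.2 - z.2))) hsfin hsne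
  have hwu : ∀ w ∈ s, cr z w u ≤ 0 := fun w hw => hratio w hw u hu (humax w hw)
  have hvw : ∀ w ∈ s, cr z v w ≤ 0 := fun w hw => hratio v hv w hw (hvmin w hw)
  have hΔ : cr z v u < 0 := by
    refine lt_of_le_of_ne (hvw u hu) fun h0 => hline u hu.2 fun w hw => ?_
    by_cases hwz : w = z
    · rw [hwz, cr_self_left]
    have h1 := hwu w ⟨hw, hwz⟩
    have h2 := hvw w ⟨hw, hwz⟩
    have h3 := hneg u hu
    have h4 := hneg v hv
    have hP : (a * (u.1 - z.1) + b * (u.2 - z.2)) * cr z v w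
        + (a * (v.1 - z.1) + b * (v.2 - z.2)) * cr z w u
        = (a * (w.1 - z.1) + b * (w.2 - z.2)) * cr z v u := by unfold cr; ring
    rw [h0, mul_zero] at hP
    have h5 : cr z w u = 0 := by nlinarith
    rw [cr_swap_right, h5, neg_zero]
  have hmem : ∀ w ∈ Γ, cr z u w ≥ 0 ∧ cr z v w ≤ 0 := by
    have hsub : Γ ⊆ {w | cr u z w ≤ 0} ∩ {w | cr z v w ≤ 0} := by
      conv_lhs => rw [hΓV]
      refine convexHull_min (fun w hw => ?_)
        ((convex_cr_nonpos u z).inter (convex_cr_nonpos z v))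
      by_cases hwz : w = z
      · simp [hwz, cr_self_left, cr_self_right]
      have h1 := hwu w ⟨hw, hwz⟩
      rw [cr_swap_right] at h1
      exact ⟨by rw [mem_ofPred_eq, cr_swap_left]; exact h1, hvw w ⟨hw, hwz⟩⟩
    intro w hw
    have h1 : cr u z w ≤ 0 := (hsub hw).1
    rw [cr_swap_left] at h1
    exact ⟨by linarith, (hsub hw).2⟩
  set f : Pt →ₗ[ℝ] Pt := (LinearMap.fst ℝ ℝ ℝ).smulRight (u - z) +
    (LinearMap.snd ℝ ℝ ℝ).smulRight (v - z)
  have hf : ∀ q : Pt, f q = q.1 • (u - z) + q.2 • (v - z) := fun q => by simp [f]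
  have hv1 : ∀ q : Pt, cr z v (z + f q) = q.1 * cr z v u := fun q => by
    rw [hf]; simp [cr]; ring
  have hu1 : ∀ q : Pt, cr z u (z + f q) = -q.2 * cr z v u := fun q => by
    rw [hf]; simp [cr]; ring
  have hinj : Function.Injective f := by
    rw [injective_iff_map_eq_zero]
    intro q hq
    have h1 := hv1 q
    have h2 := hu1 q
    rw [hq, add_zero, cr_self_left] at h1 h2
    ext
    · simpa [hΔ.ne] using h1
    · simpa [hΔ.ne] using h2
  refine ⟨z, (LinearEquiv.ofInjectiveEndo f hinj).toContinuousLinearEquiv, fun q h1 h2 h3 => ?_,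
    fun q hq => ?_⟩
  · change z + f q ∈ Γ
    have e : z + f q = (1 - q.1 - q.2) • z + q.1 • u + q.2 • v := by
      rw [hf]; module
    have hsum : (Finset.univ : Finset (Fin 3)).sum ![1 - q.1 - q.2, q.1, q.2] = 1 := by
      simp [Fin.sum_univ_three]; ring
    have := hΓ.sum_mem (t := Finset.univ) (w := ![1 - q.1 - q.2, q.1, q.2]) (z := ![z, u, v])
      (by intro i _; fin_cases i <;> simp <;> linarith) hsum
      (by
        intro i _
        fin_cases i
        exacts [extremePoints_subset hz, hsΓ hu, hsΓ hv])
    rw [e]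
    simpa [Fin.sum_univ_three] using this
  · obtain ⟨h1, h2⟩ := hmem _ hq
    change 0 ≤ cr z u (z + f q) at h1
    change cr z v (z + f q) ≤ 0 at h2
    rw [hu1] at h1
    rw [hv1] at h2
    constructor <;> nlinarith

theorem volume_translate_image_box (z : Pt) (T : Pt ≃L[ℝ] Pt) {a : ℝ} (ha : 0 ≤ a) (b : ℝ) :
    volume ((fun q => z + T q) '' (Icc 0 a ×ˢ Icc 0 b)) =
      ENNReal.ofReal (|LinearMap.det (T : Pt →ₗ[ℝ] Pt)| * (a * b)) := by
  have e : (fun q => z + T q) '' (Icc 0 a ×ˢ Icc 0 b) =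
      (fun w => -z + w) ⁻¹' (T '' (Icc 0 a ×ˢ Icc 0 b)) := by
    rw [← image_add_left, image_image]
  rw [e, measure_preimage_add, Measure.addHaar_image_continuousLinearEquiv, Measure.volume_eq_prod,
    Measure.prod_prod, Real.volume_Icc, Real.volume_Icc, sub_zero, sub_zero,
    ENNReal.ofReal_mul (abs_nonneg _), ENNReal.ofReal_mul ha]

theorem eventually_hasCaps_of_finite (hc : IsCompact Γ) (hΓ : Convex ℝ Γ)
    (hi : (interior Γ).Nonempty) (hfin : (extremePoints ℝ Γ).Finite) (M : ℕ) {ε : ℝ} (hε : 0 < ε) :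
    ∀ᶠ τ in 𝓝[>] (0 : ℝ), HasCaps Γ M ε τ := by
  obtain ⟨z, T, hin, hout⟩ := exists_corner hc hΓ hi hfin
  set D := |LinearMap.det (T : Pt →ₗ[ℝ] Pt)|
  have hD : 0 < D := abs_pos.2 T.toLinearEquiv.isUnit_det'.ne_zero
  set E := 1 + 4 / ε
  have hE1 : 1 ≤ E := by simp only [E]; linarith [div_pos four_pos hε]
  have hE0 : 0 < E := by linarith
  have hEε : 4 / E ≤ ε := by
    rw [div_le_iff₀ hE0]
    have : ε * (4 / ε) = 4 := mul_div_cancel₀ _ hε.ne'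
    simp only [E]; linarith
  have hsmall : ∀ᶠ τ in 𝓝[>] (0 : ℝ), τ ≤ D / 4 * (E ^ M)⁻¹ ^ 2 :=
    nhdsWithin_le_nhds (Iic_mem_nhds (by positivity))
  filter_upwards [hsmall, self_mem_nhdsWithin] with τ hτ hτ0
  replace hτ0 : 0 < τ := hτ0
  set ρ := √(4 * τ / D)
  have hρ0 : 0 ≤ ρ := Real.sqrt_nonneg _
  have hρ2 : ρ ^ 2 = 4 * τ / D := Real.sq_sqrt (by positivity)
  have hDρ : D * ρ ^ 2 = 4 * τ := by rw [hρ2]; field_simp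
  have hρE : ρ * E ^ M ≤ 1 := by
    have h1 : ρ ≤ (E ^ M)⁻¹ := by
      refine abs_le_of_sq_le_sq' ?_ (by positivity) |>.2
      refine le_of_mul_le_mul_left ?_ hD
      linarith
    calc ρ * E ^ M ≤ (E ^ M)⁻¹ * E ^ M := mul_le_mul_of_nonneg_right h1 (by positivity)
      _ = 1 := inv_mul_cancel₀ (by positivity)
  set l : Fin M → (Pt →L[ℝ] ℝ) := fun j =>
    (-(E ^ (j : ℕ) • ContinuousLinearMap.fst ℝ ℝ ℝ + (E ^ (j : ℕ))⁻¹ • ContinuousLinearMap.snd ℝ ℝ ℝ)).comp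
      (T.symm : Pt →L[ℝ] Pt)
  have hl : ∀ j q, l j (z + T q) = l j z - (E ^ (j : ℕ) * q.1 + (E ^ (j : ℕ))⁻¹ * q.2) := by
    intro j q
    rw [map_add, sub_eq_add_neg]
    congr 1
    simp [l]
  have hmem : ∀ j q, l j z - ρ ≤ l j (z + T q) ↔
      E ^ (j : ℕ) * q.1 + (E ^ (j : ℕ))⁻¹ * q.2 ≤ ρ := by
    intro j q
    rw [hl]
    constructor <;> intro h <;> linarith
  refine ⟨l, fun j => l j z - ρ, fun j => ?_, ?_⟩
  · have he : 0 < E ^ (j : ℕ) := by positivity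
    have he1 : 1 ≤ E ^ (j : ℕ) := one_le_pow₀ hE1
    have heM : E ^ (j : ℕ) ≤ E ^ M := pow_le_pow_right₀ hE1 j.2.le
    have hinv : (E ^ (j : ℕ))⁻¹ ≤ 1 := inv_le_one_of_one_le₀ he1
    have hbox : (fun q => z + T q) ''
        (Icc 0 (ρ / 2 * (E ^ (j : ℕ))⁻¹) ×ˢ Icc 0 (ρ / 2 * E ^ (j : ℕ))) ⊆
        {w | l j z - ρ ≤ l j w} ∩ Γ := by
      rintro _ ⟨q, ⟨h1, h2⟩, rfl⟩
      refine ⟨(hmem j q).2 ?_, hin q h1.1 h2.1 ?_⟩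
      · have h3 : E ^ (j : ℕ) * q.1 ≤ E ^ (j : ℕ) * (ρ / 2 * (E ^ (j : ℕ))⁻¹) :=
          mul_le_mul_of_nonneg_left h1.2 he.le
        have h4 : (E ^ (j : ℕ))⁻¹ * q.2 ≤ (E ^ (j : ℕ))⁻¹ * (ρ / 2 * E ^ (j : ℕ)) :=
          mul_le_mul_of_nonneg_left h2.2 (inv_nonneg.2 he.le)
        have h5 : E ^ (j : ℕ) * (E ^ (j : ℕ))⁻¹ = 1 := mul_inv_cancel₀ he.ne'
        calc _ ≤ E ^ (j : ℕ) * (ρ / 2 * (E ^ (j : ℕ))⁻¹) + (E ^ (j : ℕ))⁻¹ * (ρ / 2 * E ^ (j : ℕ)) :=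
              add_le_add h3 h4
          _ = ρ * (E ^ (j : ℕ) * (E ^ (j : ℕ))⁻¹) := by ring
          _ = ρ := by rw [h5, mul_one]
      · have h3 : ρ / 2 * (E ^ (j : ℕ))⁻¹ ≤ ρ / 2 * E ^ M :=
          mul_le_mul_of_nonneg_left (by linarith) (by linarith)
        have h4 : ρ / 2 * E ^ (j : ℕ) ≤ ρ / 2 * E ^ M :=
          mul_le_mul_of_nonneg_left heM (by linarith)
        linarith [h1.2, h2.2]
    refine le_of_eq_of_le ?_ (measure_mono hbox)
    rw [volume_translate_image_box z T (by positivity)]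
    congr 1
    change τ = D * _
    field_simp
    linarith
  · have key : ∀ i j : Fin M, i < j → volume ({w | l i z - ρ ≤ l i w} ∩ {w | l j z - ρ ≤ l j w} ∩ Γ)
        ≤ ENNReal.ofReal (ε * τ) := by
      intro i j hij
      have hei : 0 < E ^ (i : ℕ) := by positivity
      have hej : 0 < E ^ (j : ℕ) := by positivity
      have hsub : {w | l i z - ρ ≤ l i w} ∩ {w | l j z - ρ ≤ l j w} ∩ Γ ⊆
          (fun q => z + T q) '' (Icc 0 (ρ * (E ^ (j : ℕ))⁻¹) ×ˢ Icc 0 (ρ * E ^ (i : ℕ))) := by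
        rintro w ⟨⟨h1, h2⟩, h3⟩
        obtain ⟨q, rfl⟩ : ∃ q, z + T q = w := ⟨T.symm (w - z), by simp⟩
        obtain ⟨hq1, hq2⟩ := hout q h3
        replace h1 := (hmem i q).1 h1
        replace h2 := (hmem j q).1 h2
        have h4 : 0 ≤ E ^ (i : ℕ) * q.1 := by positivity
        have h5 : 0 ≤ (E ^ (j : ℕ))⁻¹ * q.2 := by positivity
        refine ⟨q, ⟨⟨hq1, ?_⟩, ⟨hq2, ?_⟩⟩, rfl⟩
        · rw [← div_eq_mul_inv, le_div_iff₀ hej]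
          linarith
        · rw [← div_le_iff₀ hei, div_eq_mul_inv]
          linarith
      refine (measure_mono hsub).trans ?_
      rw [volume_translate_image_box z T (by positivity)]
      refine ENNReal.ofReal_le_ofReal ?_
      change D * _ ≤ _
      have hratio : E ^ (i : ℕ) * (E ^ (j : ℕ))⁻¹ ≤ E⁻¹ := by
        have : E ^ ((i : ℕ) + 1) ≤ E ^ (j : ℕ) := pow_le_pow_right₀ hE1 hij
        rw [← div_eq_mul_inv, div_le_iff₀ hej, inv_mul_eq_div, le_div_iff₀ hE0]
        rwa [pow_succ] at this
      calc D * (ρ * (E ^ (j : ℕ))⁻¹ * (ρ * E ^ (i : ℕ)))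
          = (D * ρ ^ 2) * (E ^ (i : ℕ) * (E ^ (j : ℕ))⁻¹) := by ring
        _ ≤ (4 * τ) * E⁻¹ := by
            rw [hDρ]; exact mul_le_mul_of_nonneg_left hratio (by linarith)
        _ = 4 / E * τ := by ring
        _ ≤ ε * τ := mul_le_mul_of_nonneg_right hEε hτ0.le
    intro i j hij
    rcases lt_or_gt_of_ne hij with h | h
    · exact key i j h
    · rw [inter_comm {w | l i z - ρ ≤ l i w}]
      exact key j i h

theorem eventually_hasCaps (hc : IsCompact Γ) (hΓ : Convex ℝ Γ) (hi : (interior Γ).Nonempty)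
    (M : ℕ) {ε : ℝ} (hε : 0 < ε) : ∀ᶠ τ in 𝓝[>] (0 : ℝ), HasCaps Γ M ε τ := by
  rcases (extremePoints ℝ Γ).finite_or_infinite with h | h
  · exact eventually_hasCaps_of_finite hc hΓ hi h M hε
  · exact eventually_hasCaps_of_infinite hc hΓ hi h M ε

end Corner

section ManyEdges

theorem le_ncard_extremePoints {N M : ℕ} {x : Fin N → Pt} {l : Fin M → (Pt →L[ℝ] ℝ)} {b : Fin M → ℝ}
    (hhit : ∀ j, ∃ i, b j ≤ l j (x i))
    (hdisj : ∀ j j', j ≠ j' → ∀ i, ¬ (b j ≤ l j (x i) ∧ b j' ≤ l j' (x i))) :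
    M ≤ (range x ∩ extremePoints ℝ (convexHull ℝ (range x))).ncard := by
  have hK : IsCompact (convexHull ℝ (range x)) := (finite_range x).isCompact_convexHull ℝ
  have hex : ∀ j, ∃ p ∈ extremePoints ℝ (convexHull ℝ (range x)), b j ≤ l j p := by
    intro j
    obtain ⟨i, hi⟩ := hhit j
    have hxi : x i ∈ convexHull ℝ (range x) := subset_convexHull ℝ _ (mem_range_self i)
    have hexp : IsExposed ℝ (convexHull ℝ (range x)) ((l j).toExposed (convexHull ℝ (range x))) :=
      ContinuousLinearMap.toExposed.isExposed
    obtain ⟨w, hw, hmax⟩ := hK.exists_isMaxOn ⟨_, hxi⟩ (l j).continuous.continuousOn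
    obtain ⟨p, hp⟩ := (hexp.isCompact hK).extremePoints_nonempty ⟨w, hw, fun y hy => hmax hy⟩
    exact ⟨p, hexp.isExtreme.extremePoints_subset_extremePoints hp,
      hi.trans ((extremePoints_subset hp).2 _ hxi)⟩
  choose p hp hpb using hex
  have hpx : ∀ j, p j ∈ range x := fun j => extremePoints_convexHull_subset (hp j)
  have hinj : Function.Injective p := by
    intro j j' hjj
    by_contra hne
    obtain ⟨i, hi⟩ := hpx j
    refine hdisj j j' hne i ⟨?_, ?_⟩
    · rw [hi]; exact hpb j
    · rw [hi, hjj]; exact hpb j'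
  calc M = (range p).ncard := by rw [ncard_range_of_injective hinj, Nat.card_fin]
    _ ≤ (range x ∩ extremePoints ℝ (convexHull ℝ (range x))).ncard :=
      ncard_le_ncard (range_subset_iff.2 fun j => ⟨hpx j, hp j⟩)
        ((finite_range x).subset inter_subset_left)

/-- If the caps `C j` are large and have small overlaps, then a random sample is likely to hit each
of them and to avoid their overlaps. -/
theorem measure_miss_or_overlap_le {μ : Measure Pt} [IsProbabilityMeasure μ] {M N : ℕ} (hN : 0 < N)
    {C : Fin M → Set Pt} (hC : ∀ j, MeasurableSet (C j)) {L ε : ℝ} (hL : 0 ≤ L) (hε : 0 ≤ ε)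
    (hlarge : ∀ j, ENNReal.ofReal (L / N) ≤ μ (C j))
    (hsmall : ∀ i j, i ≠ j → μ (C i ∩ C j) ≤ ENNReal.ofReal (ε / N)) :
    (Measure.pi fun _ : Fin N => μ) {x | (∃ j, ∀ i, x i ∉ C j) ∨
      ∃ j j', j ≠ j' ∧ ∃ i, x i ∈ C j ∧ x i ∈ C j'} ≤
      ENNReal.ofReal (M * Real.exp (-L) + M * M * ε) := by
  have hN' : (0 : ℝ) < N := by exact_mod_cast hN
  set B : Fin M × Fin M → Set Pt := fun p => {w | p.1 ≠ p.2 ∧ w ∈ C p.1 ∩ C p.2}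
  have hBm : ∀ p, MeasurableSet (B p) := fun p =>
    (MeasurableSet.const _).inter ((hC p.1).inter (hC p.2))
  have hB : ∀ p, μ (B p) ≤ ENNReal.ofReal (ε / N) := by
    intro p
    by_cases h : p.1 = p.2
    · rw [show B p = ∅ from eq_empty_of_forall_notMem fun w hw => hw.1 h, measure_empty]
      exact zero_le
    · exact (measure_mono fun w hw => hw.2).trans (hsmall _ _ h)
  have hsub : {x : Fin N → Pt | (∃ j, ∀ i, x i ∉ C j) ∨
      ∃ j j', j ≠ j' ∧ ∃ i, x i ∈ C j ∧ x i ∈ C j'} ⊆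
      (⋃ j, univ.pi fun _ : Fin N => (C j)ᶜ) ∪ ⋃ p, ⋃ i, Function.eval i ⁻¹' B p := by
    rintro x (⟨j, hj⟩ | ⟨j, j', hjj, i, h1, h2⟩)
    · exact Or.inl (mem_iUnion.2 ⟨j, fun i _ => hj i⟩)
    · exact Or.inr (mem_iUnion.2 ⟨(j, j'), mem_iUnion.2 ⟨i, hjj, h1, h2⟩⟩)
  have hmiss : ∀ j, (Measure.pi fun _ : Fin N => μ) (univ.pi fun _ : Fin N => (C j)ᶜ) ≤
      ENNReal.ofReal (Real.exp (-L)) := by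
    intro j
    have hLN : L ≤ N := by
      have := (hlarge j).trans prob_le_one
      rw [ENNReal.ofReal_le_one, div_le_one hN'] at this
      exact this
    rw [Measure.pi_pi, Finset.prod_const, Finset.card_univ, Fintype.card_fin,
      prob_compl_eq_one_sub (hC j)]
    calc (1 - μ (C j)) ^ N ≤ (1 - ENNReal.ofReal (L / N)) ^ N :=
          pow_le_pow_left₀ zero_le (tsub_le_tsub_left (hlarge j) 1) N
      _ = ENNReal.ofReal ((1 - L / N) ^ N) := by
          rw [← ENNReal.ofReal_one, ← ENNReal.ofReal_sub _ (by positivity), ENNReal.ofReal_pow]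
          rw [sub_nonneg, div_le_one hN']
          exact hLN
      _ ≤ _ := ENNReal.ofReal_le_ofReal (Real.one_sub_div_pow_le_exp_neg hLN)
  have hover : ∀ p, (Measure.pi fun _ : Fin N => μ) (⋃ i, Function.eval i ⁻¹' B p) ≤
      ENNReal.ofReal ε := by
    intro p
    refine (measure_iUnion_fintype_le _ _).trans ?_
    calc ∑ i : Fin N, (Measure.pi fun _ : Fin N => μ) (Function.eval i ⁻¹' B p)
        ≤ ∑ _i : Fin N, ENNReal.ofReal (ε / N) := Finset.sum_le_sum fun i _ => by
          rw [(measurePreserving_eval (fun _ : Fin N => μ) i).measure_preimage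
            (hBm p).nullMeasurableSet]
          exact hB p
      _ = ENNReal.ofReal ε := by
          rw [Finset.sum_const, Finset.card_univ, Fintype.card_fin, nsmul_eq_mul,
            ← ENNReal.ofReal_natCast, ← ENNReal.ofReal_mul hN'.le, mul_div_cancel₀ _ hN'.ne']
  refine (measure_mono hsub).trans ((measure_union_le _ _).trans ?_)
  rw [ENNReal.ofReal_add (by positivity) (by positivity)]
  refine add_le_add ((measure_iUnion_fintype_le _ _).trans ?_)
    ((measure_iUnion_fintype_le _ _).trans ?_)
  · refine (Finset.sum_le_sum fun j _ => hmiss j).trans (le_of_eq ?_)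
    rw [Finset.sum_const, Finset.card_univ, Fintype.card_fin, nsmul_eq_mul,
      ENNReal.ofReal_mul M.cast_nonneg, ENNReal.ofReal_natCast]
  · refine (Finset.sum_le_sum fun p _ => hover p).trans (le_of_eq ?_)
    rw [Finset.sum_const, Finset.card_univ, Fintype.card_prod, Fintype.card_fin, nsmul_eq_mul,
      ENNReal.ofReal_mul (by positivity), ENNReal.ofReal_mul M.cast_nonneg, ENNReal.ofReal_natCast,
      Nat.cast_mul]

variable {Γ : Set Pt}

theorem eventually_le_lintegral_card_hullEdges (hc : IsCompact Γ) (hΓ : Convex ℝ Γ)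
    (hi : (interior Γ).Nonempty) (M : ℕ) : ∀ᶠ N : ℕ in atTop, (M : ℝ≥0∞) * 2⁻¹ ≤
      ∫⁻ x, ((hullEdges univ x).card : ℝ≥0∞) ∂(Measure.pi fun _ : Fin N => unifOn Γ) := by
  have := isProbabilityMeasure_unifOn hc hi
  have hV0 := volume_ne_zero hi
  have hVt := hc.measure_lt_top (μ := volume) |>.ne
  obtain ⟨L, hL1, hL⟩ : ∃ L : ℝ, 1 ≤ L ∧ M * Real.exp (-L) ≤ 1 / 4 := by
    have ht : Tendsto (fun L : ℝ => M * Real.exp (-L)) atTop (𝓝 (M * 0)) :=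
      (Real.tendsto_exp_neg_atTop_nhds_zero).const_mul _
    rw [mul_zero] at ht
    obtain ⟨L, h1, h2⟩ := ((eventually_ge_atTop (1 : ℝ)).and
      (ht.eventually (ge_mem_nhds (by norm_num : (0 : ℝ) < 1 / 4)))).exists
    exact ⟨L, h1, h2⟩
  have hL0 : 0 < L := by linarith
  set ε : ℝ := 1 / (4 * (M * M + 1))
  have hε : 0 < ε := by positivity
  have hMε : M * M * ε ≤ 1 / 4 := by
    simp only [ε]
    rw [mul_one_div, div_le_div_iff₀ (by positivity) (by norm_num)]
    linarith
  set V := (volume Γ).toReal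
  have hV : 0 < V := ENNReal.toReal_pos hV0 hVt
  have hτ : Tendsto (fun N : ℕ => L * V / (N : ℝ)) atTop (𝓝[>] 0) := by
    refine tendsto_nhdsWithin_iff.2 ⟨tendsto_const_div_atTop_nhds_zero_nat _, ?_⟩
    filter_upwards [eventually_gt_atTop 0] with N hN
    have : (0 : ℝ) < N := by exact_mod_cast hN
    exact div_pos (mul_pos hL0 hV) this
  have hline : ∀ p q : Pt, p ≠ q → unifOn Γ {w | cr p q w = 0} = 0 := fun p q h =>
    unifOn_line_eq_zero hc h
  filter_upwards [hτ.eventually (eventually_hasCaps hc hΓ hi M (div_pos hε hL0)),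
    eventually_ge_atTop 2] with N hcaps hN
  have hN' : (0 : ℝ) < N := by exact_mod_cast (by omega : 0 < N)
  obtain ⟨l, b, hlarge, hsmall⟩ := hcaps
  have hofV : ∀ t : ℝ, 0 ≤ t → (volume Γ)⁻¹ * ENNReal.ofReal (t * V) = ENNReal.ofReal t := by
    intro t ht
    rw [ENNReal.ofReal_mul ht, ENNReal.ofReal_toReal hVt, mul_left_comm,
      ENNReal.inv_mul_cancel hV0 hVt, mul_one]
  set C : Fin M → Set Pt := fun j => {w | b j ≤ l j w}
  have hC : ∀ j, MeasurableSet (C j) := fun j =>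
    measurableSet_le measurable_const (l j).continuous.measurable
  have hbad := measure_miss_or_overlap_le (μ := unifOn Γ) (by omega : 0 < N) hC hL0.le hε.le
    (fun j => by
      rw [unifOn_apply hc, ← hofV _ (by positivity)]
      refine mul_le_mul_right (le_of_eq_of_le ?_ (hlarge j)) _
      congr 1; ring)
    (fun i j hij => by
      rw [unifOn_apply hc, ← hofV _ (by positivity)]
      refine mul_le_mul_right ((hsmall i j hij).trans_eq ?_) _
      congr 1; field_simp)
  have hmeas : MeasurableSet {x : Fin N → Pt | (M : ℝ≥0∞) ≤ (hullEdges univ x).card} :=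
    measurableSet_le measurable_const (measurable_card_hullEdges MeasurableSet.univ)
  have hhalf : (2 : ℝ≥0∞)⁻¹ ≤ (Measure.pi fun _ : Fin N => unifOn Γ)
      {x : Fin N → Pt | (M : ℝ≥0∞) ≤ (hullEdges univ x).card} := by
    have hcompl : (Measure.pi fun _ : Fin N => unifOn Γ)
        {x : Fin N → Pt | (M : ℝ≥0∞) ≤ (hullEdges univ x).card}ᶜ ≤ 2⁻¹ := by
      refine (measure_mono_ae ?_).trans (hbad.trans ?_)
      · filter_upwards [ae_injective (measure_singleton_eq_zero_of_line hline) N,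
          ae_general_position hline N] with x hx hgp hxM
        by_contra hgood
        have hgood' : ¬ ((∃ j, ∀ i, x i ∉ C j) ∨
          ∃ j j', j ≠ j' ∧ ∃ i, x i ∈ C j ∧ x i ∈ C j') := hgood
        push Not at hgood'
        refine hxM ?_
        have h := (le_ncard_extremePoints hgood'.1 fun j j' hjj i h =>
          hgood'.2 j j' hjj i h.1 h.2).trans (ncard_extremePoints_le hN hx hgp)
        rw [mem_ofPred_eq]
        exact_mod_cast h
      · rw [← ENNReal.ofReal_ofNat, ← ENNReal.ofReal_inv_of_pos two_pos]
        refine ENNReal.ofReal_le_ofReal ?_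
        norm_num
        linarith
    have h1 := prob_add_prob_compl (μ := Measure.pi fun _ : Fin N => unifOn Γ) hmeas
    refine le_of_not_gt fun hlt => absurd h1 (ne_of_lt ?_)
    calc _ < (2 : ℝ≥0∞)⁻¹ + 2⁻¹ := ENNReal.add_lt_add_of_lt_of_le
          (ne_of_lt (hcompl.trans_lt (by simp))) hlt hcompl
      _ = 1 := ENNReal.inv_two_add_inv_two
  exact (mul_le_mul_right hhalf _).trans
    (mul_meas_ge_le_lintegral (measurable_card_hullEdges MeasurableSet.univ) _)

theorem tendsto_meanEdges (hc : IsCompact Γ) (hΓ : Convex ℝ Γ) (hi : (interior Γ).Nonempty) :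
    Tendsto (meanEdges (unifOn Γ) 64) atTop (𝓝 ∞) := by
  have := isProbabilityMeasure_unifOn hc hi
  rw [ENNReal.tendsto_nhds_top_iff_nat]
  intro n
  filter_upwards [eventually_le_lintegral_card_hullEdges hc hΓ hi (4 * (n + 1)),
    eventually_ge_atTop 64] with N h1 hN
  rw [lintegral_card_hullEdges _ MeasurableSet.univ, Measure.restrict_univ] at h1
  replace h1 := h1.trans (lintegral_pow_left_le_meanEdges hc hΓ hi hN)
  have e : ((4 * (n + 1) : ℕ) : ℝ≥0∞) * 2⁻¹ = 2 * ((n + 1 : ℕ) : ℝ≥0∞) := by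
    rw [show 4 * (n + 1) = 2 * (n + 1) * 2 by ring, Nat.cast_mul, mul_assoc, Nat.cast_ofNat,
      ENNReal.mul_inv_cancel two_ne_zero ENNReal.ofNat_ne_top, mul_one, Nat.cast_mul,
      Nat.cast_ofNat]
  rw [e, ENNReal.mul_le_mul_iff_right two_ne_zero ENNReal.ofNat_ne_top] at h1
  exact lt_of_lt_of_le (by exact_mod_cast n.lt_succ_self) h1

end ManyEdges

/-- random upper bound: there is an `s > 0` such that, for `2n` i.i.d. uniform
points in a compact convex set `Γ` with nonempty interior, with probability tending to `1` there
exists a set of at most `2n - s·C(Γ,2n)` edges whose removal eliminates every non-crossing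
perfect matching. -/
theorem random_upper_bound (Γ : Set Pt) (hΓc : IsCompact Γ) (hΓconv : Convex ℝ Γ)
    (hΓint : (interior Γ).Nonempty) :
    ∃ s : ℝ, 0 < s ∧
      Tendsto (fun n : ℕ =>
        Measure.pi (fun _ : Fin (2 * n) => unifOn Γ)
          {x : Fin (2 * n) → Pt |
            ∃ S : Finset (Sym2 Pt),
              (∀ e ∈ S, IsEdgeOf (Finset.image x Finset.univ) e) ∧
              (S.card : ℝ) ≤ 2 * n - s * expHullPoints Γ (2 * n) ∧
              ∀ M : Finset (Sym2 Pt),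
                IsNCMatching (Finset.image x Finset.univ) M → ¬ Avoids M S})
        atTop (nhds 1) := by
  have := isProbabilityMeasure_unifOn hΓc hΓint
  obtain ⟨K, hK⟩ := eventually_sq_mul_capPairs_le hΓc hΓint 64
  have hblock := tendsto_measure_blocking (fun p q h => unifOn_line_eq_zero hΓc h)
    (fun k δ hδ => exists_overlap_region hΓc hΓconv hΓint k hδ) hK
    (tendsto_meanEdges hΓc hΓconv hΓint)
  have hdouble : Tendsto (fun n : ℕ => 2 * n) atTop atTop :=
    tendsto_id.const_mul_atTop' two_pos
  refine ⟨1 / 32, by norm_num, tendsto_of_tendsto_of_tendsto_of_le_of_le'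
    (hblock.comp hdouble) tendsto_const_nhds ?_ (Eventually.of_forall fun n => prob_le_one)⟩
  filter_upwards [hdouble.eventually (eventually_ge_atTop 64)] with n hn
  refine measure_mono fun x => ?_
  rintro ⟨S, hS, hcard, hM⟩
  refine ⟨S, hS, hcard.trans ?_, hM⟩
  have := expHullPoints_le hΓc hΓconv hΓint hn
  push_cast
  linarith
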